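/- There exists n₀ ∈ ℕ such that the following holds. Suppose H is a 3-uniform hypergraph whose order n ≥ n₀ is divisible by 3. If δ₁(H) > C(n-1,2) − C(2n/3,2) (where C(a,b) denotes the binomial coefficient), then H has a perfect matching. -/

import Mathlib

open Finset

section Basics
variable {V : Type*} [DecidableEq V]

/-- `S` is the union of a set of pairwise disjoint edges of `H`. -/
def PerfectlyMatched (H : Finset (Finset V)) (S : Finset V) : Prop :=
  ∃ M ⊆ H, (M : Set (Finset V)).PairwiseDisjoint id ∧ M.biUnion id = S

lemma PerfectlyMatched.empty (H : Finset (Finset V)) : PerfectlyMatched H ∅ :=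
  ⟨∅, by simp, by simp, by simp⟩

lemma PerfectlyMatched.of_mem {H : Finset (Finset V)} {e : Finset V} (he : e ∈ H) :
    PerfectlyMatched H e :=
  ⟨{e}, by simpa using he, by simp, by simp⟩

lemma PerfectlyMatched.union {H : Finset (Finset V)} {S T : Finset V} (hST : Disjoint S T)
    (hS : PerfectlyMatched H S) (hT : PerfectlyMatched H T) : PerfectlyMatched H (S ∪ T) := by
  obtain ⟨M, hM, hMd, rfl⟩ := hS
  obtain ⟨N, hN, hNd, rfl⟩ := hT
  refine ⟨M ∪ N, union_subset hM hN, ?_, by rw [union_biUnion]⟩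
  rw [coe_union, Set.pairwiseDisjoint_union]
  refine ⟨hMd, hNd, fun i hi j hj _ => ?_⟩
  exact hST.mono (subset_biUnion_of_mem id hi) (subset_biUnion_of_mem id hj)

lemma PerfectlyMatched.mono {H H' : Finset (Finset V)} (h : H ⊆ H') {S : Finset V}
    (hS : PerfectlyMatched H S) : PerfectlyMatched H' S := by
  obtain ⟨M, hM, hMd, rfl⟩ := hS
  exact ⟨M, hM.trans h, hMd, rfl⟩

lemma card_biUnion_of_card_eq_three {M : Finset (Finset V)}
    (hM : ∀ e ∈ M, e.card = 3) (hMd : (M : Set (Finset V)).PairwiseDisjoint id) :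
    (M.biUnion id).card = 3 * M.card := by
  rw [card_biUnion (fun x hx y hy hxy => hMd hx hy hxy),
    sum_const_nat (m := 3) (f := fun u => (id u).card) (fun e he => hM e he), mul_comm]

lemma PerfectlyMatched.three_dvd_card {H : Finset (Finset V)} (hH : ∀ e ∈ H, e.card = 3)
    {S : Finset V} (hS : PerfectlyMatched H S) : 3 ∣ S.card := by
  obtain ⟨M, hM, hMd, rfl⟩ := hS
  rw [card_biUnion_of_card_eq_three (fun e he => hH e (hM he)) hMd]
  exact dvd_mul_right _ _

/-- The ordered pairs in `X ×ˢ Y` which form an edge together with `v`. -/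
def link (H : Finset (Finset V)) (v : V) (X Y : Finset V) : Finset (V × V) :=
  {p ∈ X ×ˢ Y | ({v, p.1, p.2} : Finset V) ∈ H}

lemma mem_link {H : Finset (Finset V)} {v : V} {X Y : Finset V} {p : V × V} :
    p ∈ link H v X Y ↔ (p.1 ∈ X ∧ p.2 ∈ Y) ∧ ({v, p.1, p.2} : Finset V) ∈ H := by
  simp [link]

lemma triple_rotate (x y z : V) : ({x, y, z} : Finset V) = {y, z, x} := by
  ext; simp; tauto

lemma triple_swap (x y z : V) : ({x, y, z} : Finset V) = {x, z, y} := by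
  ext; simp; tauto

lemma ne_of_card_triple {x y z : V} (h : ({x, y, z} : Finset V).card = 3) :
    x ≠ y ∧ x ≠ z ∧ y ≠ z := by
  refine ⟨?_, ?_, ?_⟩ <;> rintro rfl
  · have := card_le_two (a := x) (b := z)
    simp at h; omega
  · have := card_le_two (a := y) (b := x)
    rw [show ({x, y, x} : Finset V) = {y, x} by ext; simp] at h
    omega
  · have := card_le_two (a := x) (b := y)
    simp at h; omega

lemma card_triple {x y z : V} (hxy : x ≠ y) (hxz : x ≠ z) (hyz : y ≠ z) :
    ({x, y, z} : Finset V).card = 3 := card_eq_three.2 ⟨x, y, z, hxy, hxz, hyz, rfl⟩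

lemma card_link_swap (H : Finset (Finset V)) (v : V) (X Y : Finset V) :
    (link H v X Y).card = (link H v Y X).card := by
  refine card_bij (fun p _ => p.swap) ?_ ?_ ?_
  · intro p hp
    rw [mem_link] at hp ⊢
    exact ⟨⟨hp.1.2, hp.1.1⟩, by rw [triple_swap]; exact hp.2⟩
  · intro p _ q _ h
    exact Prod.swap_injective h
  · intro p hp
    rw [mem_link] at hp
    exact ⟨p.swap, by rw [mem_link]; exact ⟨⟨hp.1.2, hp.1.1⟩, by rw [triple_swap]; exact hp.2⟩,
      by simp⟩

lemma card_link_le_mul (H : Finset (Finset V)) (v : V) (X Y : Finset V) :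
    (link H v X Y).card ≤ X.card * Y.card := by
  rw [← card_product]
  exact card_le_card (filter_subset _ _)

lemma card_link_union_left (H : Finset (Finset V)) (v : V) (X X' Y : Finset V) :
    (link H v (X ∪ X') Y).card ≤ (link H v X Y).card + (link H v X' Y).card := by
  refine (card_le_card ?_).trans (card_union_le _ _)
  intro p hp
  rw [mem_union, mem_link, mem_link]
  rw [mem_link, mem_union] at hp
  tauto

lemma card_link_union_right (H : Finset (Finset V)) (v : V) (X Y Y' : Finset V) :
    (link H v X (Y ∪ Y')).card ≤ (link H v X Y).card + (link H v X Y').card := by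
  rw [card_link_swap, card_link_swap H v X Y, card_link_swap H v X Y']
  exact card_link_union_left H v Y Y' X

lemma card_link_sdiff (H : Finset (Finset V)) (v : V) (X Y F : Finset V) :
    (link H v X Y).card ≤
      (link H v (X \ F) (Y \ F)).card + F.card * Y.card + X.card * F.card := by
  have h : link H v X Y ⊆ link H v (X \ F) (Y \ F) ∪ F ×ˢ Y ∪ X ×ˢ F := by
    intro p hp
    simp only [mem_union, mem_link, mem_product, mem_sdiff] at hp ⊢
    tauto
  refine (card_le_card h).trans ((card_union_le _ _).trans ?_)
  rw [card_product]
  have := card_union_le (link H v (X \ F) (Y \ F)) (F ×ˢ Y)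
  rw [card_product] at this
  omega

lemma card_link_univ [Fintype V] {H : Finset (Finset V)} (hH : ∀ e ∈ H, e.card = 3) (v : V) :
    (link H v univ univ).card = 2 * (H.filter fun e => v ∈ e).card := by
  rw [card_eq_sum_card_fiberwise (f := fun p : V × V => ({v, p.1, p.2} : Finset V))
    (t := H.filter fun e => v ∈ e)]
  · rw [sum_congr rfl (g := fun _ => 2), sum_const, smul_eq_mul, mul_comm]
    intro e he
    rw [mem_filter] at he
    obtain ⟨heH, hve⟩ := he
    have h2 : (e.erase v).card = 2 := by rw [card_erase_of_mem hve, hH e heH]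
    obtain ⟨a, b, hab, hE⟩ := card_eq_two.1 h2
    have hE' : e = {v, a, b} := by rw [← insert_erase hve, hE]
    have hva : v ∉ ({a, b} : Finset V) := by rw [← hE]; simp
    have : {p ∈ link H v univ univ | ({v, p.1, p.2} : Finset V) = e} = {(a, b), (b, a)} := by
      ext ⟨x, y⟩
      simp only [mem_filter, mem_link, mem_univ, true_and, mem_insert, mem_singleton, Prod.mk.injEq]
      constructor
      · rintro ⟨h1, h2⟩
        have h3 := hH _ h1
        obtain ⟨hvx, hvy, hxy⟩ := ne_of_card_triple h3
        have hx : x ∈ e.erase v := by rw [← h2]; simp [hvx.symm]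
        have hy : y ∈ e.erase v := by rw [← h2]; simp [hvy.symm]
        rw [hE] at hx hy
        simp only [mem_insert, mem_singleton] at hx hy
        grind
      · rintro (⟨rfl, rfl⟩ | ⟨rfl, rfl⟩)
        · exact ⟨hE' ▸ heH, hE'.symm⟩
        · rw [triple_swap]; exact ⟨hE' ▸ heH, hE'.symm⟩
    rw [this, card_pair]
    simp only [ne_eq, Prod.mk.injEq, not_and]
    exact fun h => absurd h hab
  · intro p hp
    rw [mem_coe, mem_link] at hp
    simp [hp.2]

end Basics

section Absorption
variable {V : Type*} [DecidableEq V]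

lemma card_mul_le_of_forall_mem {α β : Type*} [DecidableEq α] [DecidableEq β]
    {S : Finset α} {T : α → Finset β} {R : Finset (α × β)} {t : ℕ}
    (hR : ∀ a ∈ S, ∀ b ∈ T a, (a, b) ∈ R) (hT : ∀ a ∈ S, t ≤ (T a).card) :
    S.card * t ≤ R.card := by
  calc S.card * t = ∑ _a ∈ S, t := by simp
    _ ≤ ∑ a ∈ S, (T a).card := sum_le_sum hT
    _ = (S.sigma T).card := (card_sigma _ _).symm
    _ ≤ R.card := by
      refine card_le_card_of_injOn (fun x => (x.1, x.2)) ?_ ?_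
      · intro x hx
        rw [mem_coe, mem_sigma] at hx
        exact hR _ hx.1 _ hx.2
      · rintro ⟨a, b⟩ _ ⟨a', b'⟩ _ h
        simp only [Prod.mk.injEq] at h
        obtain ⟨rfl, rfl⟩ := h
        rfl

/-- `S` avoids `U` and `T`, and both `S` and `S ∪ T` are perfectly matched. -/
def AbsorbsTriple (H : Finset (Finset V)) (U T S : Finset V) : Prop :=
  Disjoint S U ∧ Disjoint S T ∧ S.card ≤ 6 ∧ PerfectlyMatched H S ∧ PerfectlyMatched H (S ∪ T)

/-- The set of the six entries of three ordered pairs. -/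
def entries (t : (V × V) × (V × V) × (V × V)) : Finset V :=
  {t.1.1, t.2.1.1, t.2.1.2} ∪ {t.1.2, t.2.2.1, t.2.2.2}

variable [Fintype V]

lemma absorbs_entries {H : Finset (Finset V)} (hH : ∀ e ∈ H, e.card = 3)
    {U : Finset V} {x y z : V} (hT : ({x, y, z} : Finset V).card = 3) {a b c : V × V}
    {F F' F'' : Finset V} (hF : F = U ∪ {x, y, z}) (hF' : F' = F ∪ {a.1, a.2})
    (hF'' : F'' = F' ∪ {b.1, b.2}) (ha : a ∈ link H x (univ \ F) (univ \ F))
    (hb : b ∈ link H a.1 (univ \ F') (univ \ F') ∩ link H y (univ \ F') (univ \ F'))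
    (hc : c ∈ link H a.2 (univ \ F'') (univ \ F'') ∩ link H z (univ \ F'') (univ \ F'')) :
    AbsorbsTriple H U {x, y, z} (entries (a, b, c)) := by
  subst hF'' hF' hF
  obtain ⟨a1, a2⟩ := a
  obtain ⟨b1, b2⟩ := b
  obtain ⟨c1, c2⟩ := c
  simp only [mem_inter, mem_link, mem_sdiff, mem_univ, true_and, mem_union, mem_insert,
    mem_singleton, not_or] at ha hb hc
  obtain ⟨⟨ha1, ha2⟩, hae⟩ := ha
  obtain ⟨⟨⟨hb1, hb2⟩, hbe⟩, -, hbe'⟩ := hb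
  obtain ⟨⟨⟨hc1, hc2⟩, hce⟩, -, hce'⟩ := hc
  have n1 := ne_of_card_triple (hH _ hae)
  have n2 := ne_of_card_triple (hH _ hbe)
  have n3 := ne_of_card_triple (hH _ hce)
  have n4 := ne_of_card_triple hT
  have hd1 : Disjoint ({a1, b1, b2} : Finset V) {a2, c1, c2} := by
    simp only [disjoint_insert_left, disjoint_singleton_left, mem_insert, mem_singleton]
    grind
  refine ⟨?_, ?_, ?_, (PerfectlyMatched.of_mem hbe).union hd1 (PerfectlyMatched.of_mem hce), ?_⟩
  · simp only [entries, disjoint_left, mem_union, mem_insert, mem_singleton]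
    grind
  · simp only [entries, disjoint_left, mem_union, mem_insert, mem_singleton]
    grind
  · refine (card_union_le _ _).trans ?_
    simp only
    rw [hH _ hbe, hH _ hce]
  · have h1 : Disjoint ({x, a1, a2} : Finset V) {y, b1, b2} := by
      simp only [disjoint_insert_left, disjoint_singleton_left, mem_insert, mem_singleton]
      grind
    have h2 : Disjoint ({x, a1, a2} ∪ {y, b1, b2} : Finset V) {z, c1, c2} := by
      simp only [disjoint_left, mem_union, mem_insert, mem_singleton]
      grind
    have := ((PerfectlyMatched.of_mem hae).union h1 (PerfectlyMatched.of_mem hbe')).union h2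
      (PerfectlyMatched.of_mem hce')
    convert this using 1
    ext v
    simp only [entries, mem_union, mem_insert, mem_singleton]
    apply iff_of_eq
    ac_rfl

lemma card_link_univ_le (H : Finset (Finset V)) (v : V) (F : Finset V) :
    (link H v univ univ).card ≤ (link H v (univ \ F) (univ \ F)).card
      + 2 * (F.card * Fintype.card V) := by
  have := card_link_sdiff H v univ univ F
  rw [card_univ] at this
  linarith

lemma le_card_link_inter {H : Finset (Finset V)}
    (hd : ∀ v, 11 * Fintype.card V ^ 2 ≤ 20 * (link H v univ univ).card) (u v : V) {F : Finset V}
    (hF : 100 * F.card ≤ Fintype.card V) :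
    Fintype.card V ^ 2 ≤ 20 * (link H u (univ \ F) (univ \ F)
      ∩ link H v (univ \ F) (univ \ F)).card := by
  have hu := card_link_univ_le H u F
  have hv := card_link_univ_le H v F
  have hdu := hd u
  have hdv := hd v
  have h1 := card_union_add_card_inter (link H u (univ \ F) (univ \ F))
    (link H v (univ \ F) (univ \ F))
  have h2 : (link H u (univ \ F) (univ \ F) ∪ link H v (univ \ F) (univ \ F)).card
      ≤ Fintype.card V ^ 2 := by
    refine (card_le_univ _).trans ?_
    rw [Fintype.card_prod, sq]
  have h3 : 100 * (F.card * Fintype.card V) ≤ Fintype.card V ^ 2 := by nlinarith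
  omega

open Classical in
lemma le_card_absorbs {H : Finset (Finset V)} (hH : ∀ e ∈ H, e.card = 3)
    (hd : ∀ v, 11 * Fintype.card V ^ 2 ≤ 20 * (link H v univ univ).card) {U T : Finset V}
    (hT : T.card = 3) (hU : 100 * (U.card + 7) ≤ Fintype.card V) :
    Fintype.card V ^ 6 ≤ 1000 *
      (univ.filter fun t : (V × V) × (V × V) × (V × V) => AbsorbsTriple H U T (entries t)).card := by
  obtain ⟨x, y, z, -, -, -, rfl⟩ := card_eq_three.1 hT
  set n := Fintype.card V with hn
  set R := univ.filter fun t : (V × V) × (V × V) × (V × V) => AbsorbsTriple H U {x, y, z} (entries t)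
    with hR
  set F := U ∪ {x, y, z} with hF
  have hFc : F.card ≤ U.card + 3 := (card_union_le _ _).trans (by rw [hT])
  have h1 : n ^ 2 ≤ 2 * (link H x (univ \ F) (univ \ F)).card := by
    have := card_link_univ_le H x F
    rw [← hn] at this
    have h2 := hd x
    have h3 : 100 * (F.card * n) ≤ n ^ 2 := by nlinarith
    omega
  have key : (link H x (univ \ F) (univ \ F)).card * (n ^ 2 * n ^ 2) ≤ 400 * R.card := by
    have hpos : ∀ a ∈ link H x (univ \ F) (univ \ F), n ^ 2 * n ^ 2 ≤
        400 * (univ.filter fun bc : (V × V) × (V × V) => (a, bc) ∈ R).card := by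
      intro a ha
      have hF' : (F ∪ {a.1, a.2}).card ≤ U.card + 5 :=
        (card_union_le _ _).trans (by have := card_le_two (a := a.1) (b := a.2); omega)
      have hb := le_card_link_inter hd a.1 y (F := F ∪ {a.1, a.2}) (by omega)
      have hc : ∀ b : V × V, n ^ 2 ≤ 20 *
          (link H a.2 (univ \ (F ∪ {a.1, a.2} ∪ {b.1, b.2})) (univ \ (F ∪ {a.1, a.2} ∪ {b.1, b.2}))
          ∩ link H z (univ \ (F ∪ {a.1, a.2} ∪ {b.1, b.2}))
            (univ \ (F ∪ {a.1, a.2} ∪ {b.1, b.2}))).card := by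
        intro b
        refine le_card_link_inter hd a.2 z ?_
        have := card_union_le (F ∪ {a.1, a.2}) {b.1, b.2}
        have := card_le_two (a := b.1) (b := b.2)
        omega
      have := card_mul_le_of_forall_mem
        (S := link H a.1 (univ \ (F ∪ {a.1, a.2})) (univ \ (F ∪ {a.1, a.2}))
          ∩ link H y (univ \ (F ∪ {a.1, a.2})) (univ \ (F ∪ {a.1, a.2})))
        (T := fun b =>
          link H a.2 (univ \ (F ∪ {a.1, a.2} ∪ {b.1, b.2})) (univ \ (F ∪ {a.1, a.2} ∪ {b.1, b.2}))
          ∩ link H z (univ \ (F ∪ {a.1, a.2} ∪ {b.1, b.2}))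
            (univ \ (F ∪ {a.1, a.2} ∪ {b.1, b.2})))
        (R := univ.filter fun bc : (V × V) × (V × V) => (a, bc) ∈ R) (t := (n ^ 2 + 19) / 20)
        (by
          intro b hb c hc
          rw [mem_filter]
          refine ⟨mem_univ _, ?_⟩
          rw [hR, mem_filter]
          exact ⟨mem_univ _, absorbs_entries hH hT hF rfl rfl ha hb hc⟩)
        (by
          intro b _
          have := hc b
          omega)
      calc n ^ 2 * n ^ 2 ≤ (20 * _) * (20 * ((n ^ 2 + 19) / 20)) :=
            Nat.mul_le_mul hb (by omega)
        _ = 400 * (_ * ((n ^ 2 + 19) / 20)) := by ring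
        _ ≤ _ := Nat.mul_le_mul_left _ this
    have := card_mul_le_of_forall_mem (S := link H x (univ \ F) (univ \ F))
      (T := fun a => univ.filter fun bc : (V × V) × (V × V) => (a, bc) ∈ R)
      (R := R) (t := (n ^ 2 * n ^ 2 + 399) / 400)
      (by intro a _ b hb; exact (mem_filter.1 hb).2)
      (by intro a ha; have := hpos a ha; omega)
    calc _ ≤ (link H x (univ \ F) (univ \ F)).card * (400 * ((n ^ 2 * n ^ 2 + 399) / 400)) :=
          Nat.mul_le_mul_left _ (by omega)
      _ = 400 * ((link H x (univ \ F) (univ \ F)).card * ((n ^ 2 * n ^ 2 + 399) / 400)) := by ring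
      _ ≤ _ := Nat.mul_le_mul_left _ this
  have h4 : n ^ 6 ≤ 2 * (link H x (univ \ F) (univ \ F)).card * (n ^ 2 * n ^ 2) := by
    calc n ^ 6 = n ^ 2 * (n ^ 2 * n ^ 2) := by ring
      _ ≤ _ := Nat.mul_le_mul_right _ h1
  nlinarith

open Classical in
/-- The triples which are disjoint from `W` but not absorbed by it. -/
noncomputable def unabsorbed (H : Finset (Finset V)) (W : Finset V) : Finset (Finset V) :=
  (powersetCard 3 univ).filter fun T => Disjoint T W ∧ ¬ PerfectlyMatched H (W ∪ T)

lemma exists_absorbing_step {H : Finset (Finset V)} (hH : ∀ e ∈ H, e.card = 3)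
    (hd : ∀ v, 11 * Fintype.card V ^ 2 ≤ 20 * (link H v univ univ).card) {U W : Finset V}
    (hU : 100 * (U.card + W.card + 7) ≤ Fintype.card V) (hWU : Disjoint W U)
    (hW : PerfectlyMatched H W) :
    ∃ W', W'.card ≤ W.card + 6 ∧ Disjoint W' U ∧ PerfectlyMatched H W' ∧
      1000 * (unabsorbed H W').card ≤ 999 * (unabsorbed H W).card := by
  classical
  set n := Fintype.card V with hn
  have hcard : (univ : Finset ((V × V) × (V × V) × (V × V))).card = n ^ 6 := by
    simp only [card_univ, Fintype.card_prod, ← hn]; ring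
  have hcU : 100 * ((U ∪ W).card + 7) ≤ n := by
    have := card_union_le U W
    omega
  obtain ⟨t, ht⟩ : ∃ t : (V × V) × (V × V) × (V × V), (unabsorbed H W).card ≤
      1000 * ((unabsorbed H W).filter fun T => AbsorbsTriple H (U ∪ W) T (entries t)).card := by
    by_contra! hcon
    have h1 := sum_card_bipartiteAbove_eq_sum_card_bipartiteBelow
      (fun (T : Finset V) (t : (V × V) × (V × V) × (V × V)) => AbsorbsTriple H (U ∪ W) T (entries t))
      (s := unabsorbed H W) (t := univ)
    have h2 : (unabsorbed H W).card * n ^ 6 ≤ 1000 * ∑ T ∈ unabsorbed H W,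
        (bipartiteAbove (fun (T : Finset V) (t : (V × V) × (V × V) × (V × V)) =>
          AbsorbsTriple H (U ∪ W) T (entries t)) univ T).card := by
      rw [mul_sum, ← smul_eq_mul, ← sum_const]
      refine sum_le_sum fun T hT => ?_
      rw [unabsorbed, mem_filter, mem_powersetCard] at hT
      exact le_card_absorbs hH hd hT.1.2 hcU
    have h3 : 1000 * ∑ t, (bipartiteBelow (fun (T : Finset V) (t : (V × V) × (V × V) × (V × V)) =>
          AbsorbsTriple H (U ∪ W) T (entries t)) (unabsorbed H W) t).card
          < (unabsorbed H W).card * n ^ 6 := by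
      rw [mul_sum, ← hcard, mul_comm, ← smul_eq_mul, ← sum_const]
      refine sum_lt_sum_of_nonempty ?_ fun t _ => hcon t
      rw [← card_pos, hcard]
      exact pow_pos (by omega) _
    omega
  by_cases hne : ((unabsorbed H W).filter fun T => AbsorbsTriple H (U ∪ W) T (entries t)).Nonempty
  · obtain ⟨T₀, hT₀⟩ := hne
    obtain ⟨hS1, -, hS3, hS4, -⟩ := (mem_filter.1 hT₀).2
    rw [disjoint_union_right] at hS1
    refine ⟨W ∪ entries t, ?_, disjoint_union_left.2 ⟨hWU, hS1.1⟩, hW.union hS1.2.symm hS4, ?_⟩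
    · exact (card_union_le _ _).trans (by omega)
    · have hsub : unabsorbed H (W ∪ entries t) ⊆
          (unabsorbed H W).filter fun T => ¬ AbsorbsTriple H (U ∪ W) T (entries t) := by
        intro T hT
        rw [unabsorbed, mem_filter, disjoint_union_right] at hT
        rw [mem_filter, unabsorbed, mem_filter]
        refine ⟨⟨hT.1, hT.2.1.1, fun h => hT.2.2 ?_⟩, fun h => hT.2.2 ?_⟩
        · rw [union_right_comm]
          exact h.union (disjoint_union_left.2 ⟨hS1.2.symm, hT.2.1.2⟩) hS4
        · rw [union_assoc]
          exact hW.union (disjoint_union_right.2 ⟨hS1.2.symm, hT.2.1.1.symm⟩) h.2.2.2.2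
      have h1 := card_le_card hsub
      have h2 := card_filter_add_card_filter_not (s := unabsorbed H W)
        (fun T => AbsorbsTriple H (U ∪ W) T (entries t))
      omega
  · rw [not_nonempty_iff_eq_empty] at hne
    rw [hne, card_empty] at ht
    exact ⟨W, by omega, hWU, hW, by omega⟩

open Classical in
lemma exists_absorbing_iterate {H : Finset (Finset V)} (hH : ∀ e ∈ H, e.card = 3)
    (hd : ∀ v, 11 * Fintype.card V ^ 2 ≤ 20 * (link H v univ univ).card) {U : Finset V} (l : ℕ)
    (hU : 100 * (U.card + 6 * l + 7) ≤ Fintype.card V) :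
    ∃ W, W.card ≤ 6 * l ∧ Disjoint W U ∧ PerfectlyMatched H W ∧
      ((unabsorbed H W).card : ℝ) ≤ (999 / 1000) ^ l * (Fintype.card V : ℝ) ^ 3 := by
  induction l with
  | zero =>
    refine ⟨∅, by simp, by simp, .empty H, ?_⟩
    have h1 : (unabsorbed H ∅).card ≤ Fintype.card V ^ 3 := by
      refine (card_filter_le _ _).trans ?_
      rw [card_powersetCard, card_univ]
      exact Nat.choose_le_pow _ _
    rw [pow_zero, one_mul]
    exact_mod_cast h1
  | succ l ih =>
    obtain ⟨W, h1, h2, h3, h4⟩ := ih (by omega)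
    obtain ⟨W', h1', h2', h3', h4'⟩ := exists_absorbing_step hH hd (U := U) (W := W)
      (by omega) h2 h3
    refine ⟨W', by omega, h2', h3', ?_⟩
    have h5 : (1000 : ℝ) * (unabsorbed H W').card ≤ 999 * (unabsorbed H W).card := by
      exact_mod_cast h4'
    rw [pow_succ]
    linarith

end Absorption

lemma exists_forall_pow_mul_lt_one (K : ℕ) (hK : 0 < K) :
    ∃ n₀ : ℕ, ∀ n ≥ n₀, (999 / 1000 : ℝ) ^ (n / K) * (n : ℝ) ^ 3 < 1 := by
  have h := tendsto_pow_const_mul_const_pow_of_abs_lt_one 3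
    (r := (999 / 1000 : ℝ)) (by rw [abs_of_pos] <;> norm_num)
  have hK' : (0 : ℝ) < K := by exact_mod_cast hK
  have h2 := (h.eventually (gt_mem_nhds (show (0 : ℝ) < 999 / 1000 / (K : ℝ) ^ 3 by positivity)))
  rw [Filter.eventually_atTop] at h2
  obtain ⟨N, hN⟩ := h2
  refine ⟨K * N, fun n hn => ?_⟩
  have hl : N ≤ n / K := (Nat.le_div_iff_mul_le hK).2 (by linarith)
  have h3 := hN (n / K + 1) (by omega)
  have h4 : (n : ℝ) ≤ K * ((n / K + 1 : ℕ) : ℝ) := by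
    have := Nat.lt_mul_div_succ n hK
    exact_mod_cast this.le
  rw [lt_div_iff₀ (by positivity), pow_succ (999 / 1000 : ℝ)] at h3
  have h5 : (n : ℝ) ^ 3 ≤ (K * ((n / K + 1 : ℕ) : ℝ)) ^ 3 := by gcongr
  have h6 : (0 : ℝ) < (999 / 1000 : ℝ) ^ (n / K) := by positivity
  have h7 := mul_le_mul_of_nonneg_left h5 h6.le
  rw [mul_pow] at h7
  nlinarith

open Classical in
lemma exists_absorbing_round (K : ℕ) (hK : 0 < K) : ∃ n₀ : ℕ, ∀ (V : Type*) [Fintype V]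
    [DecidableEq V] (H : Finset (Finset V)), (∀ e ∈ H, e.card = 3) → n₀ ≤ Fintype.card V →
    (∀ v, 11 * Fintype.card V ^ 2 ≤ 20 * (link H v univ univ).card) → ∀ U : Finset V,
    100 * (U.card + 6 * (Fintype.card V / K) + 7) ≤ Fintype.card V →
    ∃ W : Finset V, W.card ≤ 6 * (Fintype.card V / K) ∧ Disjoint W U ∧ PerfectlyMatched H W ∧
      ∀ T : Finset V, T.card = 3 → Disjoint T W → PerfectlyMatched H (W ∪ T) := by
  obtain ⟨n₀, hn₀⟩ := exists_forall_pow_mul_lt_one K hK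
  refine ⟨n₀, fun V _ _ H hH hn hd U hU => ?_⟩
  obtain ⟨W, h1, h2, h3, h4⟩ := exists_absorbing_iterate hH hd _ hU
  refine ⟨W, h1, h2, h3, fun T hT hTW => ?_⟩
  have h5 := h4.trans_lt (hn₀ _ hn)
  have h6 : unabsorbed H W = ∅ := by
    rw [← card_eq_zero]
    have : (unabsorbed H W).card < 1 := by exact_mod_cast h5
    omega
  by_contra hcon
  have : T ∈ unabsorbed H W := by
    rw [unabsorbed, mem_filter, mem_powersetCard]
    exact ⟨⟨subset_univ _, hT⟩, hTW, hcon⟩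
  rw [h6] at this
  simp at this

lemma exists_absorbing_set (K : ℕ) (hK : 0 < K) : ∃ n₀ : ℕ, ∀ (V : Type*) [Fintype V]
    [DecidableEq V] (H : Finset (Finset V)), (∀ e ∈ H, e.card = 3) → n₀ ≤ Fintype.card V →
    (∀ v, 11 * Fintype.card V ^ 2 ≤ 20 * (link H v univ univ).card) → ∀ (c : ℕ),
    100 * (c * (6 * (Fintype.card V / K)) + 7) ≤ Fintype.card V →
    ∃ W : Finset V, W.card ≤ c * (6 * (Fintype.card V / K)) ∧ PerfectlyMatched H W ∧
      ∀ j ≤ c, ∀ L : Finset V, L.card = 3 * j → Disjoint L W → PerfectlyMatched H (W ∪ L) := by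
  obtain ⟨n₀, hn₀⟩ := exists_absorbing_round K hK
  refine ⟨n₀, fun V _ _ H hH hn hd c => ?_⟩
  induction c with
  | zero =>
    intro _
    refine ⟨∅, by simp, .empty H, fun j hj L hL _ => ?_⟩
    obtain rfl : j = 0 := by omega
    rw [mul_zero, card_eq_zero] at hL
    rw [hL]
    exact .empty H
  | succ c ih =>
    intro hc
    rw [add_mul, one_mul] at hc
    obtain ⟨W, h1, h2, h3⟩ := ih (by omega)
    obtain ⟨W', h1', h2', h3', h4'⟩ := hn₀ V H hH hn hd W (by omega)
    refine ⟨W ∪ W', ?_, h2.union h2'.symm h3', fun j hj L hL hLW => ?_⟩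
    · rw [add_mul, one_mul]
      exact (card_union_le _ _).trans (by omega)
    · rw [disjoint_union_right] at hLW
      rcases Nat.eq_zero_or_pos j with rfl | hj0
      · rw [mul_zero, card_eq_zero] at hL
        rw [hL, union_empty]
        exact h2.union h2'.symm h3'
      · obtain ⟨T, hTL, hT⟩ := exists_subset_card_eq (s := L) (n := 3) (by omega)
        have hLT : (L \ T).card = 3 * (j - 1) := by
          rw [card_sdiff_of_subset hTL]; omega
        have e1 := h3 (j - 1) (by omega) (L \ T) hLT (hLW.1.mono_left sdiff_subset)
        have e2 := h4' T hT (hLW.2.mono_left hTL)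
        have hdis : Disjoint (W ∪ L \ T) (W' ∪ T) := by
          rw [disjoint_union_left, disjoint_union_right, disjoint_union_right]
          exact ⟨⟨h2'.symm, (hLW.1.mono_left hTL).symm⟩, hLW.2.mono_left sdiff_subset,
            sdiff_disjoint⟩
        convert e1.union hdis e2 using 1
        conv_lhs => rw [← sdiff_union_of_subset hTL]
        ext v
        simp only [mem_union]
        tauto

section Missing
variable {V : Type*} [DecidableEq V]

/-- The ordered pairs of distinct vertices in `X ×ˢ Y`, both different from `v`,
which do not form an edge together with `v`. -/
def missing (H : Finset (Finset V)) (v : V) (X Y : Finset V) : Finset (V × V) :=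
  {p ∈ X ×ˢ Y | (p.1 ≠ p.2 ∧ p.1 ≠ v ∧ p.2 ≠ v) ∧ ({v, p.1, p.2} : Finset V) ∉ H}

lemma mem_missing {H : Finset (Finset V)} {v : V} {X Y : Finset V} {p : V × V} :
    p ∈ missing H v X Y ↔ (p.1 ∈ X ∧ p.2 ∈ Y) ∧ (p.1 ≠ p.2 ∧ p.1 ≠ v ∧ p.2 ≠ v) ∧
      ({v, p.1, p.2} : Finset V) ∉ H := by
  simp [missing]

lemma missing_mono (H : Finset (Finset V)) (v : V) {X X' Y Y' : Finset V} (hX : X ⊆ X')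
    (hY : Y ⊆ Y') : missing H v X Y ⊆ missing H v X' Y' := by
  intro p hp
  rw [mem_missing] at hp ⊢
  exact ⟨⟨hX hp.1.1, hY hp.1.2⟩, hp.2⟩

lemma card_link_add_card_missing {H : Finset (Finset V)} (hH : ∀ e ∈ H, e.card = 3) {v : V}
    {X : Finset V} (hv : v ∈ X) :
    ((link H v X X).card + (missing H v X X).card : ℤ) = (X.card - 1) * (X.card - 2) := by
  have hdis : Disjoint (link H v X X) (missing H v X X) := by
    rw [disjoint_left]
    intro p hp hp'
    rw [mem_link] at hp
    rw [mem_missing] at hp'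
    exact hp'.2.2 hp.2
  have hun : link H v X X ∪ missing H v X X = (X.erase v).offDiag := by
    ext p
    rw [mem_union, mem_link, mem_missing, mem_offDiag, mem_erase, mem_erase]
    constructor
    · rintro (⟨h1, h2⟩ | ⟨h1, h2, h3⟩)
      · obtain ⟨a, b, c⟩ := ne_of_card_triple (hH _ h2)
        exact ⟨⟨a.symm, h1.1⟩, ⟨b.symm, h1.2⟩, c⟩
      · exact ⟨⟨h2.2.1, h1.1⟩, ⟨h2.2.2, h1.2⟩, h2.1⟩
    · rintro ⟨h1, h2, h3⟩
      by_cases h : ({v, p.1, p.2} : Finset V) ∈ H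
      · exact Or.inl ⟨⟨h1.2, h2.2⟩, h⟩
      · exact Or.inr ⟨⟨h1.2, h2.2⟩, ⟨h3, h1.1, h2.1⟩, h⟩
  have h := card_union_of_disjoint hdis
  rw [hun, offDiag_card, card_erase_of_mem hv] at h
  have hpos : 1 ≤ X.card := card_pos.2 ⟨v, hv⟩
  have h2 : X.card - 1 ≤ (X.card - 1) * (X.card - 1) := Nat.le_mul_self _
  zify [h2, hpos] at h
  linarith

lemma exists_cover_of_large_link {H : Finset (Finset V)} (hH : ∀ e ∈ H, e.card = 3)
    {B₁ B₂ F S : Finset V} (h₁ : Disjoint S B₁) (h₂ : Disjoint S B₂)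
    (hS : ∀ d ∈ S, (F.card + 2 * S.card) * (B₁.card + B₂.card) < (link H d B₁ B₂).card) :
    ∃ Y₁ ⊆ B₁ \ F, ∃ Y₂ ⊆ B₂ \ F, Disjoint Y₁ Y₂ ∧ Y₁.card = S.card ∧ Y₂.card = S.card ∧
      PerfectlyMatched H (S ∪ (Y₁ ∪ Y₂)) := by
  induction S using Finset.induction_on with
  | empty => exact ⟨∅, by simp, ∅, by simp, by simp, by simp, by simp, .empty H⟩
  | insert d S hd ih =>
    rw [disjoint_insert_left] at h₁ h₂
    rw [card_insert_of_notMem hd] at hS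
    obtain ⟨Y₁, hY₁, Y₂, hY₂, hY, hc₁, hc₂, hPM⟩ := ih h₁.2 h₂.2 (fun d' hd' =>
      lt_of_le_of_lt (Nat.mul_le_mul_right _ (by omega)) (hS d' (mem_insert_of_mem hd')))
    have h3 := card_link_sdiff H d B₁ B₂ (F ∪ (Y₁ ∪ Y₂))
    have h4 : (F ∪ (Y₁ ∪ Y₂)).card ≤ F.card + 2 * S.card := by
      have := card_union_le F (Y₁ ∪ Y₂)
      have := card_union_le Y₁ Y₂
      omega
    have h5 := hS d (mem_insert_self _ _)
    have h6 : 0 < (link H d (B₁ \ (F ∪ (Y₁ ∪ Y₂))) (B₂ \ (F ∪ (Y₁ ∪ Y₂)))).card := by nlinarith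
    obtain ⟨⟨x, y⟩, hp⟩ := card_pos.1 h6
    simp only [mem_link, mem_sdiff, mem_union, not_or] at hp
    obtain ⟨⟨⟨hx, hxF, hx1, hx2⟩, hy, hyF, hy1, hy2⟩, he⟩ := hp
    obtain ⟨hdx, hdy, hxy⟩ := ne_of_card_triple (hH _ he)
    have hY₁B : ∀ z ∈ Y₁, z ∈ B₁ := fun z hz => (mem_sdiff.1 (hY₁ hz)).1
    have hY₂B : ∀ z ∈ Y₂, z ∈ B₂ := fun z hz => (mem_sdiff.1 (hY₂ hz)).1
    have hxS : x ∉ S := fun h => disjoint_left.1 h₁.2 h hx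
    have hyS : y ∉ S := fun h => disjoint_left.1 h₂.2 h hy
    refine ⟨insert x Y₁, ?_, insert y Y₂, ?_, ?_, ?_, ?_, ?_⟩
    · exact insert_subset (mem_sdiff.2 ⟨hx, hxF⟩) hY₁
    · exact insert_subset (mem_sdiff.2 ⟨hy, hyF⟩) hY₂
    · rw [disjoint_insert_left, disjoint_insert_right, mem_insert, not_or]
      exact ⟨⟨hxy, hx2⟩, hy1, hY⟩
    · rw [card_insert_of_notMem hx1, card_insert_of_notMem hd, hc₁]
    · rw [card_insert_of_notMem hy2, card_insert_of_notMem hd, hc₂]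
    · have hdis : Disjoint ({d, x, y} : Finset V) (S ∪ (Y₁ ∪ Y₂)) := by
        have := fun h => h₁.1 (hY₁B d h)
        have := fun h => h₂.1 (hY₂B d h)
        simp only [disjoint_insert_left, disjoint_singleton_left, mem_union, not_or]
        tauto
      convert (PerfectlyMatched.of_mem he).union hdis hPM using 1
      ext z
      simp only [mem_union, mem_insert, mem_singleton]
      tauto

/-- Sets of disjoint triples `(a, p, q)` with `a ∈ A` and `p, q ∈ I`, each forming an edge. -/
def IsSplitMatching (H : Finset (Finset V)) (A I : Finset V) (T : Finset (V × V × V)) : Prop :=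
  (∀ t ∈ T, t.1 ∈ A ∧ t.2.1 ∈ I ∧ t.2.2 ∈ I ∧ ({t.1, t.2.1, t.2.2} : Finset V) ∈ H) ∧
  (T : Set (V × V × V)).PairwiseDisjoint fun t => ({t.1, t.2.1, t.2.2} : Finset V)

variable {H : Finset (Finset V)} {A I : Finset V} {T : Finset (V × V × V)}

lemma IsSplitMatching.replace (hT : IsSplitMatching H A I T) {R N : Finset (V × V × V)}
    (hR : R ⊆ T) (hN : IsSplitMatching H A I N) {Z : Finset V}
    (hZ : ∀ t ∈ T, Disjoint Z {t.1, t.2.1, t.2.2})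
    (hNZ : ∀ t ∈ N, ({t.1, t.2.1, t.2.2} : Finset V) ⊆
      Z ∪ R.biUnion fun t => {t.1, t.2.1, t.2.2}) :
    IsSplitMatching H A I (T \ R ∪ N) ∧ (T \ R ∪ N).card = T.card - R.card + N.card := by
  have hdis : ∀ t ∈ T \ R, ∀ s ∈ N, Disjoint ({t.1, t.2.1, t.2.2} : Finset V)
      {s.1, s.2.1, s.2.2} := by
    intro t ht s hs
    rw [mem_sdiff] at ht
    refine Disjoint.mono_right (hNZ s hs) ?_
    rw [disjoint_union_right, disjoint_biUnion_right]
    refine ⟨(hZ t ht.1).symm, fun r hr => hT.2 ht.1 (hR hr) ?_⟩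
    rintro rfl
    exact ht.2 hr
  refine ⟨⟨?_, ?_⟩, ?_⟩
  · intro t ht
    rcases mem_union.1 ht with h | h
    · exact hT.1 t (mem_sdiff.1 h).1
    · exact hN.1 t h
  · rw [coe_union, Set.pairwiseDisjoint_union]
    refine ⟨hT.2.subset (by simp), hN.2, fun t ht s hs _ => hdis t ht s hs⟩
  · rw [card_union_of_disjoint, card_sdiff_of_subset hR]
    rw [disjoint_left]
    intro t ht hs
    have := hdis t ht t hs
    rw [disjoint_self_iff_empty] at this
    simp at this

lemma IsSplitMatching.eq_of_mem (hT : IsSplitMatching H A I T) {s t : V × V × V} (hs : s ∈ T)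
    (ht : t ∈ T) {v : V} (hvs : v ∈ ({s.1, s.2.1, s.2.2} : Finset V))
    (hvt : v ∈ ({t.1, t.2.1, t.2.2} : Finset V)) : s = t :=
  hT.2.elim_finset hs ht v hvs hvt

lemma card_le_of_cover₇ {α : Type*} (P : Finset α) (p₁ p₂ p₃ p₄ p₅ p₆ p₇ : α → Prop)
    [DecidablePred p₁] [DecidablePred p₂] [DecidablePred p₃] [DecidablePred p₄] [DecidablePred p₅]
    [DecidablePred p₆] [DecidablePred p₇] {n₁ n₂ n₃ n₄ n₅ n₆ n₇ : ℕ}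
    (h₁ : (P.filter p₁).card ≤ n₁) (h₂ : (P.filter p₂).card ≤ n₂) (h₃ : (P.filter p₃).card ≤ n₃)
    (h₄ : (P.filter p₄).card ≤ n₄) (h₅ : (P.filter p₅).card ≤ n₅) (h₆ : (P.filter p₆).card ≤ n₆)
    (h₇ : (P.filter p₇).card ≤ n₇)
    (h : ∀ x ∈ P, p₁ x ∨ p₂ x ∨ p₃ x ∨ p₄ x ∨ p₅ x ∨ p₆ x ∨ p₇ x) :
    P.card ≤ n₁ + n₂ + n₃ + n₄ + n₅ + n₆ + n₇ := by
  refine le_trans ?_ (add_le_add (add_le_add (add_le_add (add_le_add (add_le_add (add_le_add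
    h₁ h₂) h₃) h₄) h₅) h₆) h₇)
  simp only [card_filter, ← sum_add_distrib]
  rw [card_eq_sum_ones]
  refine sum_le_sum fun x hx => ?_
  rcases h x hx with h | h | h | h | h | h | h <;> rw [if_pos h] <;> omega

lemma exists_good_triple (hT : IsSplitMatching H A I T) {m : ℕ} {a b b' : V}
    (ha : (missing H a I I).card ≤ m) (hb : (missing H b A I).card ≤ m)
    (hb' : (missing H b' A I).card ≤ m) (hA : ∀ a ∈ A, (missing H a I I).card ≤ m)
    (hm : 3 * T.card + 4 * m < T.card ^ 2) :
    ∃ t₁ ∈ T, ∃ t₂ ∈ T, ∃ t₃ ∈ T, t₁ ≠ t₂ ∧ t₁ ≠ t₃ ∧ t₂ ≠ t₃ ∧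
      (t₁.2.1, t₂.2.1) ∉ missing H a I I ∧ (t₁.1, t₃.2.1) ∉ missing H b A I ∧
      (t₂.1, t₃.2.2) ∉ missing H b' A I ∧ (t₁.2.2, t₂.2.2) ∉ missing H t₃.1 I I := by
  by_contra! hcon
  set P := T ×ˢ (T ×ˢ T) with hP
  have hmem : ∀ {τ : (V × V × V) × (V × V × V) × (V × V × V)}, τ ∈ P ↔
      τ.1 ∈ T ∧ τ.2.1 ∈ T ∧ τ.2.2 ∈ T := by
    intro τ; simp [hP]
  have i1 : ∀ {s t : V × V × V}, s ∈ T → t ∈ T → s.1 = t.1 → s = t := fun {s t} hs ht h =>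
    hT.eq_of_mem hs ht (v := s.1) (by simp) (by rw [h]; simp)
  have i2 : ∀ {s t : V × V × V}, s ∈ T → t ∈ T → s.2.1 = t.2.1 → s = t := fun {s t} hs ht h =>
    hT.eq_of_mem hs ht (v := s.2.1) (by simp) (by rw [h]; simp)
  have i3 : ∀ {s t : V × V × V}, s ∈ T → t ∈ T → s.2.2 = t.2.2 → s = t := fun {s t} hs ht h =>
    hT.eq_of_mem hs ht (v := s.2.2) (by simp) (by rw [h]; simp)
  have c1 : (P.filter fun τ => τ.1 = τ.2.1).card ≤ T.card * T.card := by
    rw [← card_product]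
    refine card_le_card_of_injOn (fun τ => (τ.1, τ.2.2)) ?_ ?_
    · intro τ hτ
      have := hmem.1 (mem_filter.1 hτ).1
      simp [this.1, this.2.2]
    · rintro ⟨x, y, z⟩ h ⟨x', y', z'⟩ h' e
      simp only [coe_filter, Set.mem_ofPred_eq, Prod.mk.injEq] at h h' e ⊢
      exact ⟨e.1, by rw [← h.2, ← h'.2, e.1], e.2⟩
  have c2 : (P.filter fun τ => τ.1 = τ.2.2).card ≤ T.card * T.card := by
    rw [← card_product]
    refine card_le_card_of_injOn (fun τ => (τ.1, τ.2.1)) ?_ ?_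
    · intro τ hτ
      have := hmem.1 (mem_filter.1 hτ).1
      simp [this.1, this.2.1]
    · rintro ⟨x, y, z⟩ h ⟨x', y', z'⟩ h' e
      simp only [coe_filter, Set.mem_ofPred_eq, Prod.mk.injEq] at h h' e ⊢
      exact ⟨e.1, e.2, by rw [← h.2, ← h'.2, e.1]⟩
  have c3 : (P.filter fun τ => τ.2.1 = τ.2.2).card ≤ T.card * T.card := by
    rw [← card_product]
    refine card_le_card_of_injOn (fun τ => (τ.1, τ.2.1)) ?_ ?_
    · intro τ hτ
      have := hmem.1 (mem_filter.1 hτ).1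
      simp [this.1, this.2.1]
    · rintro ⟨x, y, z⟩ h ⟨x', y', z'⟩ h' e
      simp only [coe_filter, Set.mem_ofPred_eq, Prod.mk.injEq] at h h' e ⊢
      exact ⟨e.1, e.2, by rw [← h.2, ← h'.2, e.2]⟩
  have c4 : (P.filter fun τ => (τ.1.2.1, τ.2.1.2.1) ∈ missing H a I I).card ≤ m * T.card := by
    refine le_trans ?_ (Nat.mul_le_mul_right _ ha)
    rw [← card_product]
    refine card_le_card_of_injOn (fun τ => ((τ.1.2.1, τ.2.1.2.1), τ.2.2)) ?_ ?_
    · intro τ hτ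
      have h1 := mem_filter.1 hτ
      have := hmem.1 h1.1
      simp [h1.2, this.2.2]
    · intro τ h τ' h' e
      have h1 := hmem.1 (mem_filter.1 h).1
      have h2 := hmem.1 (mem_filter.1 h').1
      simp only [Prod.mk.injEq] at e
      exact Prod.ext (i2 h1.1 h2.1 e.1.1) (Prod.ext (i2 h1.2.1 h2.2.1 e.1.2) e.2)
  have c5 : (P.filter fun τ => (τ.1.1, τ.2.2.2.1) ∈ missing H b A I).card ≤ m * T.card := by
    refine le_trans ?_ (Nat.mul_le_mul_right _ hb)
    rw [← card_product]
    refine card_le_card_of_injOn (fun τ => ((τ.1.1, τ.2.2.2.1), τ.2.1)) ?_ ?_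
    · intro τ hτ
      have h1 := mem_filter.1 hτ
      have := hmem.1 h1.1
      simp [h1.2, this.2.1]
    · intro τ h τ' h' e
      have h1 := hmem.1 (mem_filter.1 h).1
      have h2 := hmem.1 (mem_filter.1 h').1
      simp only [Prod.mk.injEq] at e
      exact Prod.ext (i1 h1.1 h2.1 e.1.1) (Prod.ext e.2 (i2 h1.2.2 h2.2.2 e.1.2))
  have c6 : (P.filter fun τ => (τ.2.1.1, τ.2.2.2.2) ∈ missing H b' A I).card ≤ m * T.card := by
    refine le_trans ?_ (Nat.mul_le_mul_right _ hb')
    rw [← card_product]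
    refine card_le_card_of_injOn (fun τ => ((τ.2.1.1, τ.2.2.2.2), τ.1)) ?_ ?_
    · intro τ hτ
      have h1 := mem_filter.1 hτ
      have := hmem.1 h1.1
      simp [h1.2, this.1]
    · intro τ h τ' h' e
      have h1 := hmem.1 (mem_filter.1 h).1
      have h2 := hmem.1 (mem_filter.1 h').1
      simp only [Prod.mk.injEq] at e
      exact Prod.ext e.2 (Prod.ext (i1 h1.2.1 h2.2.1 e.1.1) (i3 h1.2.2 h2.2.2 e.1.2))
  have c7 : (P.filter fun τ => (τ.1.2.2, τ.2.1.2.2) ∈ missing H τ.2.2.1 I I).card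
      ≤ m * T.card := by
    calc _ ≤ (T.sigma fun t => missing H t.1 I I).card := by
          refine card_le_card_of_injOn (fun τ => ⟨τ.2.2, (τ.1.2.2, τ.2.1.2.2)⟩) ?_ ?_
          · intro τ hτ
            have h1 := mem_filter.1 hτ
            have := hmem.1 h1.1
            rw [mem_coe, mem_sigma]
            exact ⟨this.2.2, h1.2⟩
          · intro τ h τ' h' e
            have h1 := hmem.1 (mem_filter.1 h).1
            have h2 := hmem.1 (mem_filter.1 h').1
            simp only [Sigma.mk.injEq, heq_eq_eq, Prod.mk.injEq] at e
            exact Prod.ext (i3 h1.1 h2.1 e.2.1) (Prod.ext (i3 h1.2.1 h2.2.1 e.2.2) e.1)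
      _ = ∑ t ∈ T, (missing H t.1 I I).card := card_sigma _ _
      _ ≤ ∑ _t ∈ T, m := sum_le_sum fun t ht => hA _ (hT.1 t ht).1
      _ = m * T.card := by rw [sum_const, smul_eq_mul, mul_comm]
  have hcard := card_le_of_cover₇ P _ _ _ _ _ _ _ c1 c2 c3 c4 c5 c6 c7 (fun τ hτ => by
    obtain ⟨h1, h2, h3⟩ := hmem.1 hτ
    by_contra! h
    exact h.2.2.2.2.2.2 (hcon τ.1 h1 τ.2.1 h2 τ.2.2 h3 h.1 h.2.1 h.2.2.1 h.2.2.2.1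
      h.2.2.2.2.1 h.2.2.2.2.2.1))
  have hPc : P.card = T.card * (T.card * T.card) := by rw [hP, card_product, card_product]
  have htot : T.card * (T.card * T.card) ≤ 3 * (T.card * T.card) + 4 * (m * T.card) := by
    rw [← hPc]; omega
  have : 0 < T.card := by
    rcases Nat.eq_zero_or_pos T.card with h | h
    · rw [h] at hm; simp at hm
    · exact h
  nlinarith

end Missing

section Split
variable {V : Type*} [DecidableEq V] {H : Finset (Finset V)} {A I : Finset V}

lemma IsSplitMatching.of_four {n₁ n₂ n₃ n₄ : V × V × V}
    (hN : ∀ t ∈ ({n₁, n₂, n₃, n₄} : Finset (V × V × V)),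
      t.1 ∈ A ∧ t.2.1 ∈ I ∧ t.2.2 ∈ I ∧ ({t.1, t.2.1, t.2.2} : Finset V) ∈ H)
    (h₁₂ : Disjoint ({n₁.1, n₁.2.1, n₁.2.2} : Finset V) {n₂.1, n₂.2.1, n₂.2.2})
    (h₁₃ : Disjoint ({n₁.1, n₁.2.1, n₁.2.2} : Finset V) {n₃.1, n₃.2.1, n₃.2.2})
    (h₁₄ : Disjoint ({n₁.1, n₁.2.1, n₁.2.2} : Finset V) {n₄.1, n₄.2.1, n₄.2.2})
    (h₂₃ : Disjoint ({n₂.1, n₂.2.1, n₂.2.2} : Finset V) {n₃.1, n₃.2.1, n₃.2.2})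
    (h₂₄ : Disjoint ({n₂.1, n₂.2.1, n₂.2.2} : Finset V) {n₄.1, n₄.2.1, n₄.2.2})
    (h₃₄ : Disjoint ({n₃.1, n₃.2.1, n₃.2.2} : Finset V) {n₄.1, n₄.2.1, n₄.2.2}) :
    IsSplitMatching H A I {n₁, n₂, n₃, n₄} ∧
      ({n₁, n₂, n₃, n₄} : Finset (V × V × V)).card = 4 := by
  have hne : ∀ s t : V × V × V, Disjoint ({s.1, s.2.1, s.2.2} : Finset V) {t.1, t.2.1, t.2.2} →
      s ≠ t := by
    rintro s t h rfl
    rw [disjoint_self_iff_empty] at h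
    simp at h
  refine ⟨⟨hN, ?_⟩, ?_⟩
  · intro s hs t ht hst
    simp only [coe_insert, coe_singleton, Set.mem_insert_iff, Set.mem_singleton_iff] at hs ht
    rcases hs with rfl | rfl | rfl | rfl <;> rcases ht with rfl | rfl | rfl | rfl <;>
      first
      | exact absurd rfl hst
      | assumption
      | (apply Disjoint.symm; assumption)
  · rw [card_insert_of_notMem, card_insert_of_notMem, card_insert_of_notMem, card_singleton]
    · simpa using hne _ _ h₃₄
    · simpa using ⟨hne _ _ h₂₃, hne _ _ h₂₄⟩
    · simpa using ⟨hne _ _ h₁₂, hne _ _ h₁₃, hne _ _ h₁₄⟩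

lemma perfectlyMatched_of_few_missing (hH : ∀ e ∈ H, e.card = 3) (hAI : Disjoint A I)
    (hc : I.card = 2 * A.card) {m : ℕ} (hA : ∀ a ∈ A, (missing H a I I).card ≤ m)
    (hI : ∀ v ∈ I, (missing H v A I).card ≤ m) (h1 : m < A.card ^ 2)
    (h2 : ∀ y, A.card ≤ 2 * y → 3 * y + 4 * m < y ^ 2) : PerfectlyMatched H (A ∪ I) := by
  classical
  have hAIne : ∀ {a b : V}, a ∈ A → b ∈ I → a ≠ b := by
    rintro a b ha hb rfl
    exact disjoint_left.1 hAI ha hb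
  obtain ⟨T, hTm, hmax⟩ := exists_max_image
    ((A ×ˢ (I ×ˢ I)).powerset.filter fun T => IsSplitMatching H A I T) card
    ⟨∅, by simp [IsSplitMatching]⟩
  have hT : IsSplitMatching H A I T := (mem_filter.1 hTm).2
  replace hmax : ∀ T', IsSplitMatching H A I T' → T'.card ≤ T.card := by
    intro T' hT'
    refine hmax T' (mem_filter.2 ⟨mem_powerset.2 fun t ht => ?_, hT'⟩)
    have := hT'.1 t ht
    simp only [mem_product]
    exact ⟨this.1, this.2.1, this.2.2.1⟩
  set U : Finset V := T.biUnion fun t => {t.1, t.2.1, t.2.2} with hU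
  have hUc : U.card = 3 * T.card := by
    rw [hU, card_biUnion (fun x hx y hy hxy => hT.2 hx hy hxy),
      sum_const_nat (m := 3) (fun t ht => hH _ (hT.1 t ht).2.2.2), mul_comm]
  have hUsub : U ⊆ A ∪ I := by
    intro v hv
    simp only [hU, mem_biUnion, mem_insert, mem_singleton] at hv
    obtain ⟨t, ht, hv⟩ := hv
    have := hT.1 t ht
    rw [mem_union]
    rcases hv with rfl | rfl | rfl
    · exact Or.inl this.1
    · exact Or.inr this.2.1
    · exact Or.inr this.2.2.1
  have hAIc : (A ∪ I).card = 3 * A.card := by rw [card_union_of_disjoint hAI, hc]; ring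
  have hyx : T.card ≤ A.card := by
    have := card_le_card hUsub
    omega
  have hnotU : ∀ {v : V}, v ∉ U → ∀ t ∈ T, v ≠ t.1 ∧ v ≠ t.2.1 ∧ v ≠ t.2.2 := by
    intro v hv t ht
    refine ⟨?_, ?_, ?_⟩ <;> rintro rfl <;> exact hv (mem_biUnion.2 ⟨t, ht, by simp⟩)
  rcases hyx.eq_or_lt with heq | hlt
  · have hUeq : U = A ∪ I := eq_of_subset_of_card_le hUsub (by omega)
    refine ⟨T.image fun t => {t.1, t.2.1, t.2.2}, ?_, ?_, ?_⟩
    · intro e he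
      obtain ⟨t, ht, rfl⟩ := mem_image.1 he
      exact (hT.1 t ht).2.2.2
    · rw [coe_image]
      rintro _ ⟨s, hs, rfl⟩ _ ⟨t, ht, rfl⟩ hst
      exact hT.2 hs ht (fun h => hst (by rw [h]))
    · rw [image_biUnion]
      exact hUeq
  exfalso
  have hUA : (U ∩ A).card ≤ T.card := by
    refine (card_le_card (t := T.image fun t => t.1) ?_).trans card_image_le
    intro v hv
    simp only [hU, mem_inter, mem_biUnion, mem_insert, mem_singleton] at hv
    obtain ⟨⟨t, ht, hv⟩, hvA⟩ := hv
    have := hT.1 t ht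
    rcases hv with rfl | rfl | rfl
    · exact mem_image.2 ⟨t, ht, rfl⟩
    · exact absurd rfl (hAIne hvA this.2.1)
    · exact absurd rfl (hAIne hvA this.2.2.1)
  have hUI : (U ∩ I).card ≤ 2 * T.card := by
    have hsub : U ∩ I ⊆ (T.image fun t => t.2.1) ∪ T.image fun t => t.2.2 := by
      intro v hv
      simp only [hU, mem_inter, mem_biUnion, mem_insert, mem_singleton] at hv
      obtain ⟨⟨t, ht, hv⟩, hvI⟩ := hv
      have := hT.1 t ht
      rw [mem_union]
      rcases hv with rfl | rfl | rfl
      · exact absurd rfl (hAIne this.1 hvI)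
      · exact Or.inl (mem_image.2 ⟨t, ht, rfl⟩)
      · exact Or.inr (mem_image.2 ⟨t, ht, rfl⟩)
    have h3 := (card_le_card hsub).trans (card_union_le _ _)
    have h4 : (T.image fun t => t.2.1).card ≤ T.card := card_image_le
    have h5 : (T.image fun t => t.2.2).card ≤ T.card := card_image_le
    omega
  have hJ : 2 * A.card - 2 * T.card ≤ (I \ U).card := by
    have := card_sdiff_add_card_inter I U
    rw [inter_comm] at this
    omega
  obtain ⟨a, ha⟩ : (A \ U).Nonempty := by
    rw [← card_pos]
    have := card_sdiff_add_card_inter A U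
    rw [inter_comm] at this
    omega
  obtain ⟨haA, haU⟩ := mem_sdiff.1 ha
  by_cases hsmall : 2 * T.card < A.card
  · have h3 : (missing H a I I).card < (I \ U).offDiag.card := by
      rw [offDiag_card]
      refine (hA a haA).trans_lt (h1.trans_le ?_)
      have h4 : A.card + 1 ≤ (I \ U).card := by omega
      rw [← Nat.mul_sub_one]
      calc A.card ^ 2 = A.card * A.card := by ring
        _ ≤ _ := Nat.mul_le_mul (by omega) (by omega)
    obtain ⟨⟨p, q⟩, hp, hpm⟩ := exists_mem_notMem_of_card_lt_card h3
    simp only [mem_offDiag, mem_sdiff] at hp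
    obtain ⟨⟨hpI, hpU⟩, ⟨hqI, hqU⟩, hpq⟩ := hp
    have he : ({a, p, q} : Finset V) ∈ H := by
      by_contra he
      exact hpm (mem_missing.2 ⟨⟨hpI, hqI⟩, ⟨hpq, (hAIne haA hpI).symm, (hAIne haA hqI).symm⟩, he⟩)
    obtain ⟨hS, hSc⟩ := hT.replace (R := ∅) (N := {(a, p, q)}) (Z := {a, p, q}) (empty_subset _)
      ⟨by simp [haA, hpI, hqI, he], by simp⟩
      (by
        intro t ht
        have := hnotU haU t ht
        have := hnotU hpU t ht
        have := hnotU hqU t ht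
        simp only [disjoint_insert_left, disjoint_singleton_left, mem_insert, mem_singleton,
          not_or]
        tauto)
      (by simp)
    have := hmax _ hS
    simp at hSc
    simp [hSc] at this
  · have h3 : 1 < (I \ U).card := by omega
    obtain ⟨b, hb, b', hb', hbb⟩ := one_lt_card.1 h3
    obtain ⟨hbI, hbU⟩ := mem_sdiff.1 hb
    obtain ⟨hbI', hbU'⟩ := mem_sdiff.1 hb'
    obtain ⟨⟨x₁, y₁, z₁⟩, ht₁, ⟨x₂, y₂, z₂⟩, ht₂, ⟨x₃, y₃, z₃⟩, ht₃, h12, h13, h23, m1, m2, m3, m4⟩ :=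
      exists_good_triple hT (hA a haA) (hI b hbI) (hI b' hbI') hA (h2 _ (by omega))
    have d12 := hT.2 ht₁ ht₂ h12
    have d13 := hT.2 ht₁ ht₃ h13
    have d23 := hT.2 ht₂ ht₃ h23
    obtain ⟨hx₁, hy₁, hz₁, he₁⟩ := hT.1 _ ht₁
    obtain ⟨hx₂, hy₂, hz₂, he₂⟩ := hT.1 _ ht₂
    obtain ⟨hx₃, hy₃, hz₃, he₃⟩ := hT.1 _ ht₃
    have n₁ := ne_of_card_triple (hH _ he₁)
    have n₂ := ne_of_card_triple (hH _ he₂)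
    have n₃ := ne_of_card_triple (hH _ he₃)
    have a₁ := hnotU haU _ ht₁
    have a₂ := hnotU haU _ ht₂
    have a₃ := hnotU haU _ ht₃
    have b₁ := hnotU hbU _ ht₁
    have b₂ := hnotU hbU _ ht₂
    have b₃ := hnotU hbU _ ht₃
    have c₁ := hnotU hbU' _ ht₁
    have c₂ := hnotU hbU' _ ht₂
    have c₃ := hnotU hbU' _ ht₃
    have hab := hAIne haA hbI
    have hab' := hAIne haA hbI'
    simp only [Function.onFun, disjoint_insert_left, disjoint_singleton_left, mem_insert,
      mem_singleton, not_or] at d12 d13 d23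
    dsimp only at hx₁ hy₁ hz₁ hx₂ hy₂ hz₂ hx₃ hy₃ hz₃ m1 m2 m3 m4
    have e1 : ({a, y₁, y₂} : Finset V) ∈ H := by
      by_contra he
      exact m1 (mem_missing.2 ⟨⟨hy₁, hy₂⟩, ⟨d12.2.1.2.1, a₁.2.1.symm, a₂.2.1.symm⟩, he⟩)
    have e2 : ({x₁, b, y₃} : Finset V) ∈ H := by
      by_contra he
      refine m2 (mem_missing.2 ⟨⟨hx₁, hy₃⟩, ⟨d13.1.2.1, b₁.1.symm, b₃.2.1.symm⟩, ?_⟩)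
      rwa [triple_rotate x₁ b y₃, triple_swap b y₃ x₁] at he
    have e3 : ({x₂, b', z₃} : Finset V) ∈ H := by
      by_contra he
      refine m3 (mem_missing.2 ⟨⟨hx₂, hz₃⟩, ⟨d23.1.2.2, c₂.1.symm, c₃.2.2.symm⟩, ?_⟩)
      rwa [triple_rotate x₂ b' z₃, triple_swap b' z₃ x₂] at he
    have e4 : ({x₃, z₁, z₂} : Finset V) ∈ H := by
      by_contra he
      exact m4 (mem_missing.2 ⟨⟨hz₁, hz₂⟩, ⟨d12.2.2.2.2, d13.2.2.1, d23.2.2.1⟩, he⟩)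
    obtain ⟨hN, hNc⟩ := IsSplitMatching.of_four (H := H) (A := A) (I := I)
      (n₁ := (a, y₁, y₂)) (n₂ := (x₁, b, y₃)) (n₃ := (x₂, b', z₃)) (n₄ := (x₃, z₁, z₂))
      (by
        intro t ht
        simp only [mem_insert, mem_singleton] at ht
        rcases ht with rfl | rfl | rfl | rfl
        · exact ⟨haA, hy₁, hy₂, e1⟩
        · exact ⟨hx₁, hbI, hy₃, e2⟩
        · exact ⟨hx₂, hbI', hz₃, e3⟩
        · exact ⟨hx₃, hz₁, hz₂, e4⟩)
      (by simp only [disjoint_insert_left, disjoint_singleton_left, mem_insert, mem_singleton,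
            not_or]; grind)
      (by simp only [disjoint_insert_left, disjoint_singleton_left, mem_insert, mem_singleton,
            not_or]; grind)
      (by simp only [disjoint_insert_left, disjoint_singleton_left, mem_insert, mem_singleton,
            not_or]; grind)
      (by simp only [disjoint_insert_left, disjoint_singleton_left, mem_insert, mem_singleton,
            not_or]; grind)
      (by simp only [disjoint_insert_left, disjoint_singleton_left, mem_insert, mem_singleton,
            not_or]; grind)
      (by simp only [disjoint_insert_left, disjoint_singleton_left, mem_insert, mem_singleton,
            not_or]; grind)
    obtain ⟨hS, hSc⟩ := hT.replace (R := {(x₁, y₁, z₁), (x₂, y₂, z₂), (x₃, y₃, z₃)})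
      (N := _) (Z := {a, b, b'})
      (by
        intro t ht
        simp only [mem_insert, mem_singleton] at ht
        rcases ht with rfl | rfl | rfl <;> assumption)
      hN
      (by
        intro t ht
        have := hnotU haU t ht
        have := hnotU hbU t ht
        have := hnotU hbU' t ht
        simp only [disjoint_insert_left, disjoint_singleton_left, mem_insert, mem_singleton,
          not_or]
        tauto)
      (by
        intro t ht v hv
        simp only [mem_insert, mem_singleton] at ht
        simp only [mem_union, biUnion_insert, singleton_biUnion, mem_insert, mem_singleton]
        simp only [mem_insert, mem_singleton] at hv
        rcases ht with rfl | rfl | rfl | rfl <;> rcases hv with rfl | rfl | rfl <;> simp)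
    have h4 := hmax _ hS
    rw [hSc, hNc, card_triple h12 h13 h23] at h4
    omega

end Split

section MatchingInside
variable {V : Type*} [DecidableEq V] {H : Finset (Finset V)}

lemma sum_card_link_le {W F : Finset V}
    (hF : ∀ e ∈ H, e ⊆ W → ¬ Disjoint e F) :
    ∑ v ∈ W, (link H v W W).card ≤ 3 * ∑ u ∈ F, (link H u W W).card := by
  set T := (W ×ˢ (W ×ˢ W)).filter fun τ => ({τ.1, τ.2.1, τ.2.2} : Finset V) ∈ H with hT
  have hmem : ∀ τ, τ ∈ T ↔ (τ.1 ∈ W ∧ τ.2.1 ∈ W ∧ τ.2.2 ∈ W) ∧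
      ({τ.1, τ.2.1, τ.2.2} : Finset V) ∈ H := by
    intro τ; simp [hT]
  have h0 : ∑ v ∈ W, (link H v W W).card ≤ T.card := by
    rw [← card_sigma]
    refine card_le_card_of_injOn (fun σ => (σ.1, σ.2)) ?_ ?_
    · rintro ⟨v, p⟩ h
      rw [mem_coe, mem_sigma, mem_link] at h
      rw [mem_coe, hmem]
      exact ⟨⟨h.1, h.2.1⟩, h.2.2⟩
    · rintro ⟨v, p⟩ _ ⟨v', p'⟩ _ e
      simp only [Prod.mk.injEq] at e
      obtain ⟨rfl, rfl⟩ := e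
      rfl
  have key : ∀ f : V × V × V → V × V × V, Function.Injective f →
      (∀ τ ∈ T, f τ ∈ T) → (T.filter fun τ => (f τ).1 ∈ F).card ≤
        ∑ u ∈ F, (link H u W W).card := by
    intro f hf hfT
    rw [← card_sigma]
    refine card_le_card_of_injOn (fun τ => ⟨(f τ).1, (f τ).2⟩) ?_ ?_
    · intro τ hτ
      obtain ⟨h1, h2⟩ := mem_filter.1 hτ
      have h3 := (hmem _).1 (hfT τ h1)
      rw [mem_coe, mem_sigma, mem_link]
      exact ⟨h2, h3.1.2, h3.2⟩
    · intro τ _ τ' _ e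
      simp only [Sigma.mk.injEq, heq_eq_eq] at e
      exact hf (Prod.ext e.1 e.2)
  have k1 := key id Function.injective_id (fun τ h => h)
  have k2 := key (fun τ => (τ.2.1, τ.2.2, τ.1))
    (by rintro ⟨x, y, z⟩ ⟨x', y', z'⟩ h; simp at h; simp [h])
    (by
      rintro ⟨x, y, z⟩ h
      rw [hmem] at h ⊢
      exact ⟨⟨h.1.2.1, h.1.2.2, h.1.1⟩, by rw [← triple_rotate]; exact h.2⟩)
  have k3 := key (fun τ => (τ.2.2, τ.1, τ.2.1))
    (by rintro ⟨x, y, z⟩ ⟨x', y', z'⟩ h; simp at h; simp [h])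
    (by
      rintro ⟨x, y, z⟩ h
      rw [hmem] at h ⊢
      exact ⟨⟨h.1.2.2, h.1.1, h.1.2.1⟩, by rw [triple_rotate]; exact h.2⟩)
  have hsub : T ⊆ (T.filter fun τ => (id τ).1 ∈ F) ∪ (T.filter fun τ => τ.2.1 ∈ F) ∪
      (T.filter fun τ => τ.2.2 ∈ F) := by
    intro τ hτ
    obtain ⟨h1, h2⟩ := (hmem τ).1 hτ
    have h3 := hF _ h2 (by
      intro x hx
      simp only [mem_insert, mem_singleton] at hx
      rcases hx with rfl | rfl | rfl <;> tauto)
    simp only [disjoint_insert_left, disjoint_singleton_left] at h3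
    simp only [mem_union, mem_filter, hτ, true_and, id]
    tauto
  have h4 := card_le_card hsub
  have h5 := card_union_le ((T.filter fun τ => (id τ).1 ∈ F) ∪ (T.filter fun τ => τ.2.1 ∈ F))
      (T.filter fun τ => τ.2.2 ∈ F)
  have h6 := card_union_le (T.filter fun τ => (id τ).1 ∈ F) (T.filter fun τ => τ.2.1 ∈ F)
  dsimp only at k2 k3
  omega

lemma exists_matching_inside [Fintype V] (hH : ∀ e ∈ H, e.card = 3) {k g : ℕ}
    (hV : Fintype.card V = 3 * k) (hdeg : ∀ v, 5 * k ^ 2 + 4 ≤ (link H v univ univ).card + 7 * k)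
    {W I : Finset V} (hIW : I ⊆ W) (hI : ∀ e ∈ H, ¬ e ⊆ I) (hIk : I.card ≤ 2 * k)
    (hg : 1 ≤ g) (hW : W.card = 2 * k + g)
    (hD : ∀ d ∈ W \ I, 10 * (link H d I I).card ≤ k ^ 2) (hDc : 3000 * (W \ I).card ≤ k) :
    ∃ M ⊆ H, (M : Set (Finset V)).PairwiseDisjoint id ∧ M.card = g ∧ M.biUnion id ⊆ W := by
  classical
  obtain ⟨M, hMm, hmax⟩ := exists_max_image
    (H.powerset.filter fun M : Finset (Finset V) => (M : Set (Finset V)).PairwiseDisjoint id ∧ M.biUnion id ⊆ W) card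
    ⟨∅, by simp⟩
  simp only [mem_filter, mem_powerset] at hMm hmax
  obtain ⟨hMH, hMd, hMW⟩ := hMm
  by_cases hgM : g ≤ M.card
  · obtain ⟨N, hN, hNc⟩ := exists_subset_card_eq hgM
    exact ⟨N, hN.trans hMH, hMd.subset (by exact_mod_cast hN), hNc,
      (biUnion_subset_biUnion_of_subset_left _ hN).trans hMW⟩
  exfalso
  have hF : ∀ e ∈ H, e ⊆ W → ¬ Disjoint e (M.biUnion id) := by
    intro e he heW hdis
    rw [disjoint_biUnion_right] at hdis
    have heM : e ∉ M := by
      intro h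
      have := hdis e h
      rw [id, disjoint_self_iff_empty] at this
      have h3 := hH e he
      rw [this] at h3
      simp at h3
    have := hmax (insert e M) ⟨insert_subset he hMH, by
      rw [coe_insert]
      refine hMd.insert fun j hj _ => hdis j hj, by
      rw [biUnion_insert]; exact union_subset heW hMW⟩
    rw [card_insert_of_notMem heM] at this
    omega
  have hsum := sum_card_link_le hF
  have hFc := card_biUnion_of_card_eq_three (fun e he => hH e (hMH he)) hMd
  set F := M.biUnion id with hFdef
  have hWI : (W \ I).card + I.card = W.card := by
    rw [card_sdiff_of_subset hIW]
    have := card_le_card hIW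
    omega
  have hkpos : 1 ≤ k := by omega
  have hlow : ∀ v ∈ W, 4 * k * (g - 1) + 2 ≤ (link H v W W).card := by
    intro v hv
    have h1 := card_link_add_card_missing hH (mem_univ v)
    have h2 := card_link_add_card_missing hH hv
    have h3 := card_le_card (missing_mono H v (subset_univ W) (subset_univ W))
    have h4 := hdeg v
    rw [card_univ, hV] at h1
    rw [hW] at h2
    push_cast at h1 h2
    zify [hg] at h3 h4 ⊢
    have h5 : (0 : ℤ) ≤ ((g : ℤ) - 1) * (g - 2) := by
      rcases eq_or_lt_of_le hg with h | h
      · rw [← h]; norm_num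
      · exact mul_nonneg (by linarith [(Nat.cast_le (α := ℤ)).2 hg]) (by
          have : (2 : ℤ) ≤ g := by exact_mod_cast h
          linarith)
    nlinarith
  have hup : ∀ v ∈ W, 10 * (link H v W W).card ≤ k ^ 2 + 20 * ((W \ I).card * W.card) := by
    intro v hv
    have h1 := card_link_sdiff H v W W (W \ I)
    rw [Finset.sdiff_sdiff_eq_self hIW] at h1
    have h2 : 10 * (link H v I I).card ≤ k ^ 2 := by
      by_cases hvI : v ∈ I
      · have : link H v I I = ∅ := by
          rw [eq_empty_iff_forall_notMem]
          intro p hp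
          rw [mem_link] at hp
          refine hI _ hp.2 ?_
          intro x hx
          simp only [mem_insert, mem_singleton] at hx
          rcases hx with rfl | rfl | rfl <;> tauto
        rw [this]; simp
      · exact hD v (mem_sdiff.2 ⟨hv, hvI⟩)
    have h3 : W.card * (W \ I).card = (W \ I).card * W.card := mul_comm _ _
    omega
  have hlow' : W.card * (4 * k * (g - 1) + 2) ≤ ∑ v ∈ W, (link H v W W).card := by
    rw [← smul_eq_mul, ← sum_const]
    exact sum_le_sum hlow
  have hup' : 10 * ∑ v ∈ F, (link H v W W).card ≤
      F.card * (k ^ 2 + 20 * ((W \ I).card * W.card)) := by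
    rw [mul_sum, ← smul_eq_mul (a := F.card), ← sum_const]
    exact sum_le_sum fun v hv => hup v (hMW hv)
  have hgD : 3000 * g ≤ k := by omega
  have h6 : 3000 * ((W \ I).card * W.card) ≤ 3 * k ^ 2 := by
    calc 3000 * ((W \ I).card * W.card) = (3000 * (W \ I).card) * W.card := by ring
      _ ≤ k * (3 * k) := Nat.mul_le_mul hDc (by omega)
      _ = _ := by ring
  have h7 : k ^ 2 + 20 * ((W \ I).card * W.card) ≤ 2 * k ^ 2 := by omega
  have h8 : 10 * ∑ v ∈ F, (link H v W W).card ≤ (3 * (g - 1)) * (2 * k ^ 2) :=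
    hup'.trans (Nat.mul_le_mul (by omega) h7)
  obtain ⟨g', rfl⟩ : ∃ g', g = g' + 1 := ⟨g - 1, by omega⟩
  rw [Nat.add_sub_cancel] at h8 hlow'
  have h9 : (2 * k) * (4 * k * g' + 2) ≤ W.card * (4 * k * g' + 2) :=
    Nat.mul_le_mul_right _ (by omega)
  have h10 : 0 ≤ k ^ 2 * g' := Nat.zero_le _
  nlinarith

end MatchingInside

section Extremal
variable {V : Type*} [DecidableEq V] {H : Finset (Finset V)}

lemma le_card_link_add_card_missing_of_disjoint {v : V} {X Y : Finset V} (hv : v ∉ X)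
    (hXY : Disjoint X Y) :
    X.card * (Y.card - 1) ≤ (link H v X Y).card + (missing H v X Y).card := by
  calc X.card * (Y.card - 1) ≤ X.card * (Y.erase v).card :=
        Nat.mul_le_mul_left _ pred_card_le_card_erase
    _ = (X ×ˢ Y.erase v).card := (card_product _ _).symm
    _ ≤ (link H v X Y ∪ missing H v X Y).card := by
        refine card_le_card fun p hp => ?_
        rw [mem_product, mem_erase] at hp
        rw [mem_union, mem_link, mem_missing]
        have h1 : p.1 ≠ p.2 := fun h => disjoint_left.1 hXY hp.1 (h ▸ hp.2.2)
        have h2 : p.1 ≠ v := fun h => hv (h ▸ hp.1)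
        tauto
    _ ≤ _ := card_union_le _ _

lemma le_card_link_add_card_missing {v : V} {X : Finset V} (hv : v ∉ X) :
    X.card * X.card - X.card ≤ (link H v X X).card + (missing H v X X).card := by
  rw [← offDiag_card]
  refine (card_le_card fun p hp => ?_).trans (card_union_le _ _)
  rw [mem_offDiag] at hp
  rw [mem_union, mem_link, mem_missing]
  have h2 : p.1 ≠ v := fun h => hv (h ▸ hp.1)
  have h3 : p.2 ≠ v := fun h => hv (h ▸ hp.2.1)
  tauto

lemma sum_card_missing_le (A I X : Finset V) :
    ∑ a ∈ A, (missing H a I X).card ≤ ∑ v ∈ I, (missing H v A X).card := by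
  rw [← card_sigma, ← card_sigma]
  refine card_le_card_of_injOn (fun σ => ⟨σ.2.1, (σ.1, σ.2.2)⟩) ?_ ?_
  · rintro ⟨a, v, w⟩ h
    rw [mem_coe, mem_sigma, mem_missing] at h ⊢
    refine ⟨h.2.1.1, ⟨h.1, h.2.1.2⟩, ⟨h.2.2.1.2.2.symm, h.2.2.1.2.1.symm, h.2.2.1.1.symm⟩, ?_⟩
    intro h'
    apply h.2.2.2
    convert h' using 1
    ext
    simp only [mem_insert, mem_singleton]
    tauto
  · rintro ⟨a, v, w⟩ _ ⟨a', v', w'⟩ _ e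
    simp only [Sigma.mk.injEq, heq_eq_eq, Prod.mk.injEq] at e
    obtain ⟨rfl, rfl, rfl⟩ := e
    rfl

variable [Fintype V] {k : ℕ}

lemma card_missing_univ_le (hH : ∀ e ∈ H, e.card = 3) (hV : Fintype.card V = 3 * k)
    (hdeg : ∀ v, 5 * k ^ 2 + 4 ≤ (link H v univ univ).card + 7 * k) (v : V) :
    (missing H v univ univ).card + 2 * k + 2 ≤ 4 * k ^ 2 := by
  have h1 := card_link_add_card_missing hH (mem_univ v)
  have h4 := hdeg v
  rw [card_univ, hV] at h1
  push_cast at h1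
  zify at h4 ⊢
  nlinarith

lemma card_missing_compl_le (hH : ∀ e ∈ H, e.card = 3) (hV : Fintype.card V = 3 * k)
    (hdeg : ∀ v, 5 * k ^ 2 + 4 ≤ (link H v univ univ).card + 7 * k) {I : Finset V}
    (hI : ∀ e ∈ H, ¬ e ⊆ I) {v : V} (hv : v ∈ I) :
    ((I.card - 1) * (I.card - 2) + (missing H v Iᶜ univ).card + 2 * k + 2 : ℤ) ≤ 4 * k ^ 2 := by
  have h1 := card_link_add_card_missing hH hv
  have h2 : link H v I I = ∅ := by
    rw [eq_empty_iff_forall_notMem]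
    intro p hp
    rw [mem_link] at hp
    refine hI _ hp.2 fun x hx => ?_
    simp only [mem_insert, mem_singleton] at hx
    rcases hx with rfl | rfl | rfl <;> tauto
  rw [h2, card_empty] at h1
  have h3 : (missing H v I I).card + (missing H v Iᶜ univ).card ≤
      (missing H v univ univ).card := by
    rw [← card_union_of_disjoint]
    · exact card_le_card (union_subset (missing_mono _ _ (subset_univ _) (subset_univ _))
        (missing_mono _ _ (subset_univ _) (subset_univ _)))
    · rw [disjoint_left]
      intro p hp hp'
      rw [mem_missing] at hp hp'
      exact mem_compl.1 hp'.1.1 hp.1.1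
  have h4 := card_missing_univ_le hH hV hdeg v
  zify at h3 h4
  push_cast at h1
  linarith

lemma card_independent_le (hH : ∀ e ∈ H, e.card = 3) (hV : Fintype.card V = 3 * k)
    (hdeg : ∀ v, 5 * k ^ 2 + 4 ≤ (link H v univ univ).card + 7 * k) {I : Finset V}
    (hI : ∀ e ∈ H, ¬ e ⊆ I) : I.card ≤ 2 * k := by
  by_contra! h
  obtain ⟨v, hv⟩ : I.Nonempty := card_pos.1 (by omega)
  have h1 := card_missing_compl_le hH hV hdeg hI hv
  obtain ⟨s, hs⟩ : ∃ s, I.card = 2 * k + 1 + s := ⟨I.card - (2 * k + 1), by omega⟩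
  have h2 := Nat.le_mul_self s
  have h3 := Nat.zero_le (k * s)
  rw [hs] at h1
  push_cast at h1
  zify at h2 h3
  nlinarith

/-- In the extremal case, where there is an independent set of almost `2k` of the `3k` vertices,
the vertices split into an independent set and few exceptional vertices `D`. -/
lemma card_exceptional_le (hH : ∀ e ∈ H, e.card = 3) (hV : Fintype.card V = 3 * k)
    (hdeg : ∀ v, 5 * k ^ 2 + 4 ≤ (link H v univ univ).card + 7 * k) (hk : 10 ^ 8 ≤ k)
    {I : Finset V} (hI : ∀ e ∈ H, ¬ e ⊆ I) (hIc : 10 ^ 7 * (2 * k) ≤ 10 ^ 7 * I.card + k) :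
    (∀ v ∈ I, 2000000 * (missing H v Iᶜ univ).card ≤ k ^ 2) ∧
    5000 * (Iᶜ.filter fun a => k ^ 2 ≤ 200 * (missing H a I univ).card).card ≤ k := by
  have hI2 := card_independent_le hH hV hdeg hI
  have h1 : ∀ v ∈ I, 2000000 * (missing H v Iᶜ univ).card ≤ k ^ 2 := by
    intro v hv
    have h := card_missing_compl_le hH hV hdeg hI hv
    obtain ⟨t, ht⟩ : ∃ t, I.card + t = 2 * k := ⟨2 * k - I.card, by omega⟩
    have htk : 10 ^ 7 * t ≤ k := by omega
    have h2 : 10 ^ 7 * (k * t) ≤ k ^ 2 := by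
      calc 10 ^ 7 * (k * t) = k * (10 ^ 7 * t) := by ring
        _ ≤ k * k := Nat.mul_le_mul_left _ htk
        _ = _ := by ring
    have h3 : 10 ^ 8 * k ≤ k ^ 2 := by rw [pow_two]; exact Nat.mul_le_mul_right _ hk
    have hIz : (I.card : ℤ) = 2 * k - t := by zify at ht; linarith
    rw [hIz] at h
    zify at h2 h3 ⊢
    have h4 : (0 : ℤ) ≤ t := by positivity
    nlinarith
  refine ⟨h1, ?_⟩
  set D := Iᶜ.filter fun a => k ^ 2 ≤ 200 * (missing H a I univ).card with hD
  have h2 : D.card * k ^ 2 ≤ 200 * ∑ v ∈ I, (missing H v Iᶜ univ).card := by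
    calc D.card * k ^ 2 = ∑ _a ∈ D, k ^ 2 := by rw [sum_const, smul_eq_mul]
      _ ≤ ∑ a ∈ D, 200 * (missing H a I univ).card := sum_le_sum fun a ha => (mem_filter.1 ha).2
      _ = 200 * ∑ a ∈ D, (missing H a I univ).card := by rw [mul_sum]
      _ ≤ 200 * ∑ a ∈ Iᶜ, (missing H a I univ).card :=
          Nat.mul_le_mul_left _ (sum_le_sum_of_subset (filter_subset _ _))
      _ ≤ _ := Nat.mul_le_mul_left _ (sum_card_missing_le _ _ _)
  have h3 : 2000000 * ∑ v ∈ I, (missing H v Iᶜ univ).card ≤ I.card * k ^ 2 := by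
    rw [mul_sum, ← smul_eq_mul (a := I.card), ← sum_const]
    exact sum_le_sum h1
  have h4 : I.card * k ^ 2 ≤ 2 * k * k ^ 2 := Nat.mul_le_mul_right _ hI2
  have h5 : (5000 * D.card) * k ^ 2 ≤ k * k ^ 2 := by linarith
  exact Nat.le_of_mul_le_mul_right h5 (by positivity)

end Extremal

section ExtremalMain
variable {V : Type*} [DecidableEq V] {H : Finset (Finset V)} [Fintype V] {k : ℕ}

/-- The part of the extremal argument that takes place after the vertices outside of `I` have been
divided into the typical ones `A₁`, and exceptional ones `D₁` and `D₂`, and a matching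
covering the surplus of `D₂` has been found. -/
lemma perfectlyMatched_of_partition (hH : ∀ e ∈ H, e.card = 3) (hk : 10 ^ 8 ≤ k)
    {I A₁ D₁ D₂ F : Finset V} {g : ℕ}
    (h₁ : Disjoint I A₁) (h₂ : Disjoint I D₁) (h₃ : Disjoint I D₂)
    (h₄ : Disjoint A₁ D₁) (h₅ : Disjoint A₁ D₂) (h₆ : Disjoint D₁ D₂)
    (huniv : I ∪ A₁ ∪ D₁ ∪ D₂ = univ) (hV : Fintype.card V = 3 * k)
    (hF : F ⊆ I ∪ D₂) (hFc : F.card = 3 * g) (hFM : PerfectlyMatched H F)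
    (hA₁c : A₁.card + g + D₁.card = k) (hI2 : I.card ≤ 2 * k)
    (hg : 5000 * g ≤ k) (hD₁ : 5000 * D₁.card ≤ k) (hD₂ : 5000 * D₂.card ≤ k)
    (hlD₁ : ∀ d ∈ D₁, k ^ 2 ≤ 10 * (link H d I I).card)
    (hlD₂ : ∀ d ∈ D₂, k ^ 2 ≤ (link H d A₁ I).card)
    (hmA : ∀ a ∈ A₁, 200 * (missing H a I univ).card ≤ k ^ 2)
    (hmI : ∀ v ∈ I, 200 * (missing H v A₁ univ).card ≤ k ^ 2) :
    PerfectlyMatched H univ := by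
  have hD₂F : (D₂ \ F).card ≤ D₂.card := card_le_card sdiff_subset
  obtain ⟨Y₁, hY₁, Y₂, hY₂, hYd, hY₁c, hY₂c, hYM⟩ := exists_cover_of_large_link (F := F) hH
    (S := D₂ \ F) (B₁ := A₁) (B₂ := I) (h₅.symm.mono_left sdiff_subset)
    (h₃.symm.mono_left sdiff_subset) (by
      intro d hd
      refine lt_of_lt_of_le ?_ (hlD₂ d (mem_sdiff.1 hd).1)
      rw [hFc, pow_two]
      calc (3 * g + 2 * (D₂ \ F).card) * (A₁.card + I.card)
          ≤ (3 * g + 2 * (D₂ \ F).card) * (3 * k) := Nat.mul_le_mul_left _ (by omega)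
        _ = (9 * g + 6 * (D₂ \ F).card) * k := by ring
        _ < k * k := Nat.mul_lt_mul_of_pos_right (by omega) (by omega))
  obtain ⟨Z₁, hZ₁, Z₂, hZ₂, hZd, hZ₁c, hZ₂c, hZM⟩ := exists_cover_of_large_link (F := F ∪ Y₂) hH
    (S := D₁) (B₁ := I) (B₂ := I) h₂.symm h₂.symm (by
      intro d hd
      have h := hlD₁ d hd
      have hFY := card_union_le F Y₂
      have h3 : 10 * (((F ∪ Y₂).card + 2 * D₁.card) * (I.card + I.card)) < k ^ 2 := by
        rw [pow_two]
        calc 10 * (((F ∪ Y₂).card + 2 * D₁.card) * (I.card + I.card))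
            ≤ 10 * (((F ∪ Y₂).card + 2 * D₁.card) * (4 * k)) :=
              Nat.mul_le_mul_left _ (Nat.mul_le_mul_left _ (by omega))
          _ = (40 * (F ∪ Y₂).card + 80 * D₁.card) * k := by ring
          _ < k * k := Nat.mul_lt_mul_of_pos_right (by omega) (by omega)
      omega)
  set A₂ := A₁ \ Y₁ with hA₂
  set I₂ := I \ (F ∪ Y₂ ∪ Z₁ ∪ Z₂) with hI₂
  have d1 : Disjoint F (D₂ \ F ∪ (Y₁ ∪ Y₂)) := by
    rw [disjoint_left]
    intro x hx hx'
    simp only [mem_union, mem_sdiff] at hx'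
    rcases hx' with h | h | h
    · exact h.2 hx
    · exact (mem_sdiff.1 (hY₁ h)).2 hx
    · exact (mem_sdiff.1 (hY₂ h)).2 hx
  have d2 : Disjoint (F ∪ (D₂ \ F ∪ (Y₁ ∪ Y₂))) (D₁ ∪ (Z₁ ∪ Z₂)) := by
    rw [disjoint_left] at h₁ h₂ h₃ h₄ h₅ h₆ ⊢
    intro x hx hx'
    have e1 := @hF x
    have e2 := @hY₁ x
    have e3 := @hY₂ x
    have e4 := @hZ₁ x
    have e5 := @hZ₂ x
    have e6 := @h₁ x
    have e7 := @h₂ x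
    have e8 := @h₃ x
    have e9 := @h₄ x
    have e10 := @h₆ x
    simp only [mem_union, mem_sdiff] at hx hx' e1 e2 e3 e4 e5
    grind
  have d3 : Disjoint (F ∪ (D₂ \ F ∪ (Y₁ ∪ Y₂)) ∪ (D₁ ∪ (Z₁ ∪ Z₂))) (A₂ ∪ I₂) := by
    rw [disjoint_left] at h₁ h₂ h₃ h₄ h₅ h₆ ⊢
    intro x hx hx'
    have e1 := @hF x
    have e2 := @hY₁ x
    have e3 := @hY₂ x
    have e4 := @hZ₁ x
    have e5 := @hZ₂ x
    have e6 := @h₁ x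
    have e7 := @h₂ x
    have e8 := @h₃ x
    have e9 := @h₄ x
    have e10 := @h₅ x
    simp only [hA₂, hI₂, mem_union, mem_sdiff] at hx hx' e1 e2 e3 e4 e5
    grind
  have hAI : Disjoint A₂ I₂ := h₁.symm.mono sdiff_subset sdiff_subset
  have hun : F ∪ (D₂ \ F ∪ (Y₁ ∪ Y₂)) ∪ (D₁ ∪ (Z₁ ∪ Z₂)) ∪ (A₂ ∪ I₂) = univ := by
    rw [eq_univ_iff_forall] at huniv ⊢
    intro x
    have := huniv x
    simp only [hA₂, hI₂, mem_union, mem_sdiff] at this ⊢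
    tauto
  have hA₂c : A₂.card + Y₁.card = A₁.card := by
    have hs : Y₁ ⊆ A₁ := hY₁.trans sdiff_subset
    rw [hA₂, card_sdiff_of_subset hs]
    have := card_le_card hs
    omega
  have hcard : 3 * g + ((D₂ \ F).card + (Y₁.card + Y₂.card)) + (D₁.card + (Z₁.card + Z₂.card)) +
      (A₂.card + I₂.card) = 3 * k := by
    rw [← hV, ← card_univ, ← hun, card_union_of_disjoint d3, card_union_of_disjoint d2,
      card_union_of_disjoint d1, hFc, card_union_of_disjoint hAI, card_union_of_disjoint (s := D₁),
      card_union_of_disjoint hZd, card_union_of_disjoint (s := D₂ \ F), card_union_of_disjoint hYd]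
    · rw [disjoint_union_right]
      exact ⟨(h₅.symm.mono sdiff_subset (hY₁.trans sdiff_subset)),
        (h₃.symm.mono sdiff_subset (hY₂.trans sdiff_subset))⟩
    · rw [disjoint_union_right]
      exact ⟨(h₂.symm.mono_right (hZ₁.trans sdiff_subset)),
        (h₂.symm.mono_right (hZ₂.trans sdiff_subset))⟩
  have hfin : PerfectlyMatched H (A₂ ∪ I₂) := by
    have hAk : 99 * k ≤ 100 * A₂.card := by omega
    refine perfectlyMatched_of_few_missing hH hAI (by omega) (m := k ^ 2 / 200) ?_ ?_ ?_ ?_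
    · intro a ha
      have h := hmA a (mem_sdiff.1 ha).1
      have h' := card_le_card (missing_mono H a (X := I₂) (X' := I) (Y := I₂) sdiff_subset
        (subset_univ _))
      omega
    · intro v hv
      have h := hmI v (mem_sdiff.1 hv).1
      have h' := card_le_card (missing_mono H v (X := A₂) (X' := A₁) (Y := I₂) sdiff_subset
        (subset_univ _))
      omega
    · have h4 : (99 * k) ^ 2 ≤ (100 * A₂.card) ^ 2 := Nat.pow_le_pow_left hAk 2
      have h5 : 0 < k ^ 2 := by positivity
      have h6 : k ^ 2 / 200 ≤ k ^ 2 / 2 := Nat.div_le_div_left (by norm_num) (by norm_num)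
      rw [mul_pow, mul_pow] at h4
      omega
    · intro y hy
      have h4 : (99 * k) ^ 2 ≤ (200 * y) ^ 2 := Nat.pow_le_pow_left (by omega) 2
      rw [mul_pow, mul_pow] at h4
      have h5 : 100 * y ≤ y ^ 2 := by rw [pow_two]; exact Nat.mul_le_mul_right _ (by omega)
      have h6 : 0 < k ^ 2 := by positivity
      omega
  rw [← hun]
  exact (((hFM.union d1 hYM).union d2 hZM).union d3 hfin)

lemma perfectlyMatched_of_independent (hH : ∀ e ∈ H, e.card = 3) (hV : Fintype.card V = 3 * k)
    (hdeg : ∀ v, 5 * k ^ 2 + 4 ≤ (link H v univ univ).card + 7 * k) (hk : 10 ^ 8 ≤ k)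
    {I : Finset V} (hI : ∀ e ∈ H, ¬ e ⊆ I) (hIc : 10 ^ 7 * (2 * k) ≤ 10 ^ 7 * I.card + k) :
    PerfectlyMatched H univ := by
  classical
  have hI2 := card_independent_le hH hV hdeg hI
  obtain ⟨hmI, hDc⟩ := card_exceptional_le hH hV hdeg hk hI hIc
  obtain ⟨t, ht⟩ : ∃ t, I.card + t = 2 * k := ⟨2 * k - I.card, by omega⟩
  have htk : 10 ^ 7 * t ≤ k := by omega
  have hIcc : Iᶜ.card = k + t := by rw [card_compl, hV]; omega
  set D := Iᶜ.filter fun a => k ^ 2 ≤ 200 * (missing H a I univ).card with hD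
  set D' := Iᶜ.filter fun a => 10 * (link H a I I).card < k ^ 2 with hD'
  have hkk : 10 ^ 8 * k ≤ k ^ 2 := by rw [pow_two]; exact Nat.mul_le_mul_right _ hk
  have hD'D : D' ⊆ D := by
    intro d hd
    rw [hD', mem_filter] at hd
    rw [hD, mem_filter]
    refine ⟨hd.1, ?_⟩
    have h1 := le_card_link_add_card_missing (H := H) (mem_compl.1 hd.1)
    have h2 := card_le_card (missing_mono H d (Subset.refl I) (subset_univ I))
    have h3 : (3 * k) ^ 2 ≤ (2 * I.card) ^ 2 := Nat.pow_le_pow_left (by omega) 2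
    rw [mul_pow, mul_pow, pow_two I.card] at h3
    omega
  have hD'c := card_le_card hD'D
  obtain ⟨D₂, hD'2, hD2sub, hD2c⟩ := exists_subsuperset_card_eq (s := D') (t := Iᶜ \ (D \ D'))
    (n := max t D'.card) (by
      intro d hd
      rw [mem_sdiff, mem_sdiff]
      exact ⟨(mem_filter.1 hd).1, fun h => h.2 hd⟩) (le_max_right _ _) (by
      have h1 : (D \ D').card ≤ D.card := card_le_card sdiff_subset
      have h2 := le_card_sdiff (D \ D') Iᶜ
      apply max_le <;> omega)
  have hD₂I : ∀ d ∈ D₂, d ∉ I := fun d hd => mem_compl.1 (mem_sdiff.1 (hD2sub hd)).1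
  have hD₂D : ∀ d ∈ D₂, d ∈ D → d ∈ D' := by
    intro d hd hdD
    by_contra h
    exact (mem_sdiff.1 (hD2sub hd)).2 (mem_sdiff.2 ⟨hdD, h⟩)
  have hmaxt := le_max_left t D'.card
  have hmaxD := le_max_right t D'.card
  have hmaxk : 5000 * max t D'.card ≤ k := by
    rcases max_choice t D'.card with h | h <;> rw [h] <;> omega
  obtain ⟨g, hg⟩ : ∃ g, D₂.card = t + g := ⟨D₂.card - t, by omega⟩
  have hID₂ : Disjoint I D₂ := by
    rw [disjoint_left]
    exact fun x hx hx' => hD₂I x hx' hx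
  obtain ⟨F, hF, hFc, hFM⟩ : ∃ F ⊆ I ∪ D₂, F.card = 3 * g ∧ PerfectlyMatched H F := by
    rcases Nat.eq_zero_or_pos g with rfl | hgpos
    · exact ⟨∅, empty_subset _, by simp, .empty H⟩
    · have hDeq : D' = D₂ := by
        refine eq_of_subset_of_card_le hD'2 ?_
        rcases max_choice t D'.card with h | h <;> omega
      have hW : (I ∪ D₂) \ I = D₂ := by
        rw [union_sdiff_left, sdiff_eq_self_of_disjoint hID₂.symm]
      obtain ⟨M, hM, hMd, hMc, hMs⟩ := exists_matching_inside hH hV hdeg (W := I ∪ D₂)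
        subset_union_left hI hI2 hgpos (by rw [card_union_of_disjoint hID₂]; omega)
        (by
          rw [hW]
          intro d hd
          rw [← hDeq] at hd
          exact (mem_filter.1 hd).2.le)
        (by rw [hW]; omega)
      exact ⟨M.biUnion id, hMs, by
        rw [card_biUnion_of_card_eq_three (fun e he => hH e (hM he)) hMd, hMc],
        ⟨M, hM, hMd, rfl⟩⟩
  have hDD : D \ D' ⊆ Iᶜ := sdiff_subset.trans (filter_subset _ _)
  have hD₁c : (D \ D').card ≤ D.card := card_le_card sdiff_subset
  set A₁ := Iᶜ \ (D \ D' ∪ D₂) with hA₁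
  have hd₆ : Disjoint (D \ D') D₂ := by
    rw [disjoint_left]
    intro x hx hx'
    exact (mem_sdiff.1 (hD2sub hx')).2 hx
  have hA₁c : A₁.card + ((D \ D').card + D₂.card) = k + t := by
    have hs : D \ D' ∪ D₂ ⊆ Iᶜ := union_subset hDD (hD2sub.trans sdiff_subset)
    have := card_le_card hs
    rw [card_union_of_disjoint hd₆] at this
    rw [hA₁, card_sdiff_of_subset hs, card_union_of_disjoint hd₆]
    omega
  refine perfectlyMatched_of_partition hH hk (I := I) (A₁ := A₁) (D₁ := D \ D') (D₂ := D₂)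
    (F := F) (g := g) ?_ ?_ hID₂ ?_ ?_ hd₆ ?_ hV hF hFc hFM (by omega) hI2 (by omega) (by omega)
    (by omega) ?_ ?_ ?_ ?_
  · rw [disjoint_left]
    intro x hx hx'
    exact mem_compl.1 (mem_sdiff.1 hx').1 hx
  · rw [disjoint_left]
    intro x hx hx'
    exact mem_compl.1 (hDD hx') hx
  · exact disjoint_sdiff_self_left.mono_right subset_union_left
  · exact disjoint_sdiff_self_left.mono_right subset_union_right
  · rw [eq_univ_iff_forall]
    intro x
    simp only [hA₁, mem_union, mem_sdiff, mem_compl]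
    tauto
  · intro d hd
    rw [mem_sdiff] at hd
    by_contra! h
    exact hd.2 (mem_filter.2 ⟨(mem_filter.1 hd.1).1, h⟩)
  · intro d hd
    have hdI := hD₂I d hd
    have hdA : d ∉ A₁ := by
      rw [hA₁, mem_sdiff, mem_union]
      tauto
    have hA₁I : A₁ ∪ (D \ D' ∪ D₂) = Iᶜ := by
      rw [hA₁, sdiff_union_of_subset (union_subset hDD (hD2sub.trans sdiff_subset))]
    by_cases hdD : d ∈ D
    · have h1 := (mem_filter.1 (hD₂D d hd hdD)).2
      have h2 := hdeg d
      have hun : (univ : Finset V) = I ∪ (A₁ ∪ (D \ D' ∪ D₂)) := by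
        rw [hA₁I, union_compl]
      have h3 : (link H d univ univ).card ≤ (link H d I I).card + (link H d I Iᶜ).card +
          (link H d Iᶜ I).card + (link H d Iᶜ Iᶜ).card := by
        have e0 : (univ : Finset V) = I ∪ Iᶜ := (union_compl I).symm
        have e1 := card_link_union_left H d I Iᶜ (I ∪ Iᶜ)
        have e2 := card_link_union_right H d I I Iᶜ
        have e3 := card_link_union_right H d Iᶜ I Iᶜ
        rw [← e0] at e1 e2 e3
        omega
      rw [card_link_swap H d I Iᶜ] at h3
      have h4 := card_link_le_mul H d Iᶜ Iᶜ
      have h5 := card_link_union_left H d A₁ (D \ D' ∪ D₂) I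
      rw [hA₁I] at h5
      have h6 := card_link_le_mul H d (D \ D' ∪ D₂) I
      have h7 := card_union_le (D \ D') D₂
      have h8 : 2 * ((D \ D' ∪ D₂).card * I.card) ≤ k ^ 2 := by
        calc 2 * ((D \ D' ∪ D₂).card * I.card) ≤ 2 * ((D \ D' ∪ D₂).card * (2 * k)) :=
              Nat.mul_le_mul_left _ (Nat.mul_le_mul_left _ hI2)
          _ = (4 * (D \ D' ∪ D₂).card) * k := by ring
          _ ≤ k * k := Nat.mul_le_mul_right _ (by omega)
          _ = k ^ 2 := by ring
      have h9 : (10 * Iᶜ.card) ^ 2 ≤ (11 * k) ^ 2 := Nat.pow_le_pow_left (by omega) 2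
      rw [mul_pow, mul_pow, pow_two Iᶜ.card] at h9
      omega
    · have hdm : 200 * (missing H d I univ).card < k ^ 2 := by
        by_contra! h
        exact hdD (mem_filter.2 ⟨mem_compl.2 hdI, h⟩)
      have h1 := le_card_link_add_card_missing_of_disjoint (H := H) (v := d) hdI (Y := A₁) (by
        rw [disjoint_left]
        intro x hx hx'
        exact mem_compl.1 (mem_sdiff.1 hx').1 hx)
      have h2 := card_le_card (missing_mono H d (Subset.refl I) (subset_univ A₁))
      rw [card_link_swap]
      have h3 : (19 * k) * (9 * k) ≤ (10 * I.card) * (10 * (A₁.card - 1)) :=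
        Nat.mul_le_mul (by omega) (by omega)
      have h4 : (10 * I.card) * (10 * (A₁.card - 1)) = 100 * (I.card * (A₁.card - 1)) := by ring
      have h5 : (19 * k) * (9 * k) = 171 * k ^ 2 := by ring
      omega
  · intro a ha
    rw [hA₁, mem_sdiff, mem_union, mem_sdiff] at ha
    by_contra! h
    have h1 : a ∈ D := mem_filter.2 ⟨ha.1, h.le⟩
    refine ha.2 ?_
    by_cases h2 : a ∈ D'
    · exact Or.inr (hD'2 h2)
    · exact Or.inl ⟨h1, h2⟩
  · intro v hv
    have h1 := hmI v hv
    have h2 := card_le_card (missing_mono H v (X := A₁) (X' := Iᶜ) (Y := univ) sdiff_subset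
      (Subset.refl _))
    omega

end ExtremalMain

section MaximumMatching
variable {V : Type*} [DecidableEq V]

/-- `M` is a matching in `H` avoiding `V₀` which has maximum size among the matchings covered by
`V₀` and the vertices of `M`. -/
structure IsMaximumMatching (H M : Finset (Finset V)) (V₀ : Finset V) : Prop where
  card_eq : ∀ e ∈ H, e.card = 3
  subset : M ⊆ H
  disjoint : (M : Set (Finset V)).PairwiseDisjoint id
  disjoint_left : Disjoint V₀ (M.biUnion id)
  card_le : ∀ M' ⊆ H, (M' : Set (Finset V)).PairwiseDisjoint id →
    M'.biUnion id ⊆ V₀ ∪ M.biUnion id → M'.card ≤ M.card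

/-- The vertices in `V₀` which form an edge together with `f`. -/
def completions (H : Finset (Finset V)) (V₀ f : Finset V) : Finset V :=
  {v ∈ V₀ | insert v f ∈ H}

lemma mem_completions {H : Finset (Finset V)} {V₀ f : Finset V} {v : V} :
    v ∈ completions H V₀ f ↔ v ∈ V₀ ∧ insert v f ∈ H := by
  simp [completions]

/-- A set which is an edge of `H` or can be completed to an edge by many vertices of `V₀`. -/
def IsRich (H : Finset (Finset V)) (V₀ : Finset V) (c : ℕ) (f : Finset V) : Prop :=
  f ∈ H ∨ c ≤ (completions H V₀ f).card

variable {H M : Finset (Finset V)} {V₀ : Finset V} {c : ℕ}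

lemma IsMaximumMatching.card_le_of_subset (hM : IsMaximumMatching H M V₀)
    {M' N : Finset (Finset V)} (hN : N ⊆ M) (hM' : M' ⊆ H)
    (hd : (M' : Set (Finset V)).PairwiseDisjoint id)
    (hs : M'.biUnion id ⊆ V₀ ∪ N.biUnion id) : M'.card ≤ N.card := by
  have hdis : ∀ e ∈ M', ∀ e' ∈ M \ N, Disjoint e e' := by
    intro e he e' he'
    rw [mem_sdiff] at he'
    have h1 : e ⊆ V₀ ∪ N.biUnion id := (subset_biUnion_of_mem id he).trans hs
    refine Disjoint.mono_left h1 ?_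
    rw [disjoint_union_left, disjoint_biUnion_left]
    refine ⟨hM.disjoint_left.mono_right (subset_biUnion_of_mem id he'.1), fun a ha => ?_⟩
    refine hM.disjoint (hN ha) he'.1 ?_
    rintro rfl
    exact he'.2 ha
  have h := hM.card_le (M' ∪ (M \ N)) (union_subset hM' (sdiff_subset.trans hM.subset)) (by
    rw [coe_union, Set.pairwiseDisjoint_union]
    exact ⟨hd, hM.disjoint.subset (by simp), fun e he e' he' _ => hdis e he e' he'⟩) (by
    rw [union_biUnion]
    refine union_subset (hs.trans (union_subset_union_right
      (biUnion_subset_biUnion_of_subset_left _ hN))) ?_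
    exact (biUnion_subset_biUnion_of_subset_left _ sdiff_subset).trans subset_union_right)
  rw [card_union_of_disjoint, card_sdiff_of_subset hN] at h
  · have := card_le_card hN
    omega
  · rw [Finset.disjoint_left]
    intro e he he'
    have h1 := hdis e he e he'
    rw [disjoint_self_iff_empty] at h1
    have h2 := hM.card_eq e (hM' he)
    rw [h1] at h2
    simp at h2

lemma exists_matching_of_rich (hH : ∀ e ∈ H, e.card = 3) {𝓕 : Finset (Finset V)}
    (hd : (𝓕 : Set (Finset V)).PairwiseDisjoint id) (hr : ∀ f ∈ 𝓕, IsRich H V₀ c f)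
    (hV₀ : ∀ f ∈ 𝓕, Disjoint V₀ f) (hc : 𝓕.card ≤ c) :
    ∃ M ⊆ H, (M : Set (Finset V)).PairwiseDisjoint id ∧ M.card = 𝓕.card ∧
      M.biUnion id ⊆ V₀ ∪ 𝓕.biUnion id ∧ (V₀ ∩ M.biUnion id).card ≤ 𝓕.card := by
  induction 𝓕 using Finset.induction_on with
  | empty => exact ⟨∅, by simp, by simp, by simp, by simp, by simp⟩
  | insert f 𝓕 hf ih =>
    rw [card_insert_of_notMem hf] at hc ⊢
    rw [coe_insert, Set.pairwiseDisjoint_insert] at hd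
    obtain ⟨M, hM, hMd, hMc, hMs, hMV⟩ := ih hd.1 (fun f' h => hr f' (mem_insert_of_mem h))
      (fun f' h => hV₀ f' (mem_insert_of_mem h)) (by omega)
    have hfd : Disjoint f (𝓕.biUnion id) := by
      rw [disjoint_biUnion_right]
      intro f' hf'
      exact hd.2 f' hf' (by rintro rfl; exact hf hf')
    have hfV := hV₀ f (mem_insert_self _ _)
    have hfM : Disjoint f (M.biUnion id) := Disjoint.mono_right hMs (by
      rw [disjoint_union_right]; exact ⟨hfV.symm, hfd⟩)
    obtain ⟨e, heH, hfe, heV, hec, heM⟩ : ∃ e ∈ H, f ⊆ e ∧ e ⊆ V₀ ∪ f ∧ (V₀ ∩ e).card ≤ 1 ∧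
        Disjoint e (M.biUnion id) := by
      rcases hr f (mem_insert_self _ _) with h | h
      · exact ⟨f, h, Subset.refl _, subset_union_right, by
          rw [disjoint_iff_inter_eq_empty.1 hfV]; simp, hfM⟩
      · obtain ⟨v, hv, hv'⟩ := exists_mem_notMem_of_card_lt_card
          (s := V₀ ∩ M.biUnion id) (t := completions H V₀ f) (by omega)
        rw [mem_completions] at hv
        have hvM : v ∉ M.biUnion id := fun h => hv' (mem_inter.2 ⟨hv.1, h⟩)
        refine ⟨insert v f, hv.2, subset_insert _ _, ?_, ?_, ?_⟩
        · exact insert_subset (mem_union_left _ hv.1) subset_union_right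
        · rw [inter_insert_of_mem hv.1, disjoint_iff_inter_eq_empty.1 hfV]
          simp
        · rw [disjoint_insert_left]
          exact ⟨hvM, hfM⟩
    have heM' : e ∉ M := by
      intro h
      have h1 := heM.mono_right (subset_biUnion_of_mem id h)
      rw [id, disjoint_self_iff_empty] at h1
      have h2 := hH e heH
      rw [h1] at h2
      simp at h2
    refine ⟨insert e M, insert_subset heH hM, ?_, ?_, ?_, ?_⟩
    · rw [coe_insert]
      refine hMd.insert fun j hj _ => heM.mono_right (subset_biUnion_of_mem id hj)
    · rw [card_insert_of_notMem heM', hMc]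
    · rw [biUnion_insert, biUnion_insert]
      refine union_subset (heV.trans ?_) (hMs.trans ?_)
      · exact union_subset_union_right subset_union_left
      · exact union_subset_union_right subset_union_right
    · rw [biUnion_insert, inter_union_distrib_left]
      refine (card_union_le _ _).trans ?_
      exact (Nat.add_le_add hec hMV).trans (by omega)

lemma IsMaximumMatching.card_rich_le (hM : IsMaximumMatching H M V₀)
    {𝓕 N : Finset (Finset V)} (hN : N ⊆ M)
    (hd : (𝓕 : Set (Finset V)).PairwiseDisjoint id) (hr : ∀ f ∈ 𝓕, IsRich H V₀ c f)
    (hs : 𝓕.biUnion id ⊆ N.biUnion id) (hc : 𝓕.card ≤ c) : 𝓕.card ≤ N.card := by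
  obtain ⟨M', hM', hM'd, hM'c, hM's, -⟩ := exists_matching_of_rich hM.card_eq hd hr
    (fun f hf => hM.disjoint_left.mono_right (((subset_biUnion_of_mem id hf).trans hs).trans
      (biUnion_subset_biUnion_of_subset_left _ hN))) hc
  rw [← hM'c]
  exact hM.card_le_of_subset hN hM' hM'd (hM's.trans (union_subset_union_right hs))

end MaximumMatching

section Switching
variable {V : Type*} [DecidableEq V] {H : Finset (Finset V)} {V₀ : Finset V} {c : ℕ}

lemma pairwiseDisjoint_pair {s t : Finset V} (h : Disjoint s t) :
    (({s, t} : Finset (Finset V)) : Set (Finset V)).PairwiseDisjoint id := by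
  intro a ha b hb hab
  simp only [coe_insert, coe_singleton, Set.mem_insert_iff, Set.mem_singleton_iff] at ha hb
  rcases ha with rfl | rfl <;> rcases hb with rfl | rfl
  · exact absurd rfl hab
  · exact h
  · exact h.symm
  · exact absurd rfl hab

lemma exists_injOn_choice {ι : Type*} [DecidableEq ι] (D : Finset ι) (N : ι → Finset ι)
    (h : ∀ i ∈ D, D.card ≤ (N i).card) : ∃ r : ι → ι, Set.InjOn r D ∧ ∀ i ∈ D, r i ∈ N i := by
  classical
  have hall := (Finset.all_card_le_biUnion_card_iff_exists_injective (fun i : D => N i)).1 (by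
    intro s
    rcases s.eq_empty_or_nonempty with rfl | ⟨i, hi⟩
    · simp
    · calc s.card ≤ Fintype.card D := card_le_univ s
        _ = D.card := by simp
        _ ≤ (N i).card := h i i.2
        _ ≤ _ := card_le_card (subset_biUnion_of_mem (fun i : D => N i) hi))
  obtain ⟨g, hg, hgN⟩ := hall
  refine ⟨fun i => if hi : i ∈ D then g ⟨i, hi⟩ else i, ?_, ?_⟩
  · intro i hi j hj hij
    rw [mem_coe] at hi hj
    simp only [hi, hj, dif_pos] at hij
    simpa using hg hij
  · intro i hi
    simp only [hi, dif_pos]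
    exact hgN ⟨i, hi⟩

/-- The pair `{x, y}` can be completed to an edge by many vertices of `V₀`. -/
abbrev IsHeavy (H : Finset (Finset V)) (V₀ : Finset V) (c : ℕ) (x y : V) : Prop :=
  c ≤ (completions H V₀ {x, y}).card

lemma IsHeavy.symm {x y : V} (h : IsHeavy H V₀ c x y) : IsHeavy H V₀ c y x := by
  rwa [IsHeavy, Finset.pair_comm]

lemma isHeavy_comm {x y : V} : IsHeavy H V₀ c x y ↔ IsHeavy H V₀ c y x :=
  ⟨IsHeavy.symm, IsHeavy.symm⟩

/-- An indexed family of disjoint triples `f i`, in which the pairs `{f i 0, f i 1}` are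
distinguished, such that there is no switching which increases the size of a matching. -/
structure IsSwitchFree {ι : Type*} [DecidableEq ι] (H : Finset (Finset V)) (V₀ : Finset V) (c : ℕ)
    (f : ι → Fin 3 → V) : Prop where
  inj : ∀ i j k l, f i k = f j l → i = j ∧ k = l
  card_le : ∀ (𝓕 : Finset (Finset V)) (D J : Finset ι),
    (𝓕 : Set (Finset V)).PairwiseDisjoint id → (∀ g ∈ 𝓕, IsRich H V₀ c g) →
    𝓕.biUnion id ⊆ (D.biUnion fun i => {f i 0, f i 1}) ∪ J.image (f · 2) →
    𝓕.card + 2 * (D.card + J.card) ≤ c → 𝓕.card ≤ D.card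

variable {ι : Type*} [Fintype ι] [DecidableEq ι] {f : ι → Fin 3 → V}

/-- The indices of the third vertices forming a heavy pair with `x`. -/
def heavyIndices (H : Finset (Finset V)) (V₀ : Finset V) (c : ℕ) (f : ι → Fin 3 → V) (x : V) :
    Finset ι := {r | IsHeavy H V₀ c x (f r 2)}

omit [DecidableEq ι] in
lemma mem_heavyIndices {x : V} {r : ι} :
    r ∈ heavyIndices H V₀ c f x ↔ IsHeavy H V₀ c x (f r 2) := by
  simp [heavyIndices]

omit [Fintype ι] in
lemma IsSwitchFree.not_heavy_of_ne (hf : IsSwitchFree H V₀ c f) (hc : 30 ≤ c) {i r r' : ι}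
    (hr : r ≠ r') {k l : Fin 3} (hkl : k = 0 ∧ l = 1 ∨ k = 1 ∧ l = 0)
    (h : IsHeavy H V₀ c (f i k) (f r 2)) : ¬ IsHeavy H V₀ c (f i l) (f r' 2) := by
  intro h'
  have hinj := hf.inj
  have hne : ({f i k, f r 2} : Finset V) ≠ {f i l, f r' 2} := by
    intro he
    have : f i k ∈ ({f i l, f r' 2} : Finset V) := by rw [← he]; simp
    simp only [mem_insert, mem_singleton] at this
    rcases this with h | h <;> have := hinj _ _ _ _ h <;> grind
  have := hf.card_le {{f i k, f r 2}, {f i l, f r' 2}} {i} {r, r'} (by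
      refine pairwiseDisjoint_pair ?_
      rw [Finset.disjoint_left]
      intro x hx hx'
      simp only [mem_insert, mem_singleton] at hx hx'
      rcases hx with rfl | rfl <;> rcases hx' with h | h <;> have := hinj _ _ _ _ h <;> grind) (by
      intro g hg
      simp only [mem_insert, mem_singleton] at hg
      rcases hg with rfl | rfl
      · exact Or.inr h
      · exact Or.inr h') (by
      intro x hx
      simp only [mem_biUnion, id, mem_insert, mem_singleton, mem_union, mem_image] at hx ⊢
      rcases hkl with ⟨rfl, rfl⟩ | ⟨rfl, rfl⟩ <;> grind) (by
      rw [card_pair hne, card_pair hr, card_singleton]; omega)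
  rw [card_pair hne, card_singleton] at this
  omega

lemma IsSwitchFree.not_rich (hf : IsSwitchFree H V₀ c f) (hc : 30 ≤ c) {P : Finset ι}
    {α β : ι → Fin 3} (hαβ : ∀ i, α i = 0 ∧ β i = 1 ∨ α i = 1 ∧ β i = 0)
    (hP : ∀ i ∈ P, 3 ≤ (heavyIndices H V₀ c f (f i (α i))).card) {h : Finset V}
    (hh : h ⊆ univ.image (f · 2) ∪ P.image fun i => f i (β i)) (hh3 : h.card ≤ 3) :
    ¬ IsRich H V₀ c h := by
  intro hrich
  have hinj := hf.inj
  set D : Finset ι := {i ∈ P | f i (β i) ∈ h} with hD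
  set J₀ : Finset ι := {r | f r 2 ∈ h} with hJ₀
  have hDJ : D.card + J₀.card ≤ 3 := by
    rw [← card_image_of_injective J₀ (f := (f · 2)) (fun i j hij => (hinj _ _ _ _ hij).1),
      ← card_image_of_injective D (f := fun i => f i (β i)) (fun i j hij => (hinj _ _ _ _ hij).1),
      ← card_union_of_disjoint]
    · refine (card_le_card ?_).trans hh3
      intro x hx
      simp only [mem_union, mem_image, hD, hJ₀, mem_filter, mem_univ, true_and] at hx
      grind
    · rw [Finset.disjoint_left]
      intro x hx hx'
      simp only [mem_image] at hx hx'
      obtain ⟨i, -, rfl⟩ := hx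
      obtain ⟨j, -, hj⟩ := hx'
      have := (hinj _ _ _ _ hj).2
      have := hαβ i
      grind
  obtain ⟨r, hr, hrN⟩ := exists_injOn_choice D
    (fun i => heavyIndices H V₀ c f (f i (α i)) \ J₀) (by
      intro i hi
      have h1 := hP i (mem_filter.1 hi).1
      have h2 := le_card_sdiff J₀ (heavyIndices H V₀ c f (f i (α i)))
      omega)
  have hrJ : ∀ i ∈ D, f (r i) 2 ∉ h := fun i hi hi' =>
    (mem_sdiff.1 (hrN i hi)).2 (by simpa [hJ₀] using hi')
  have hrG : ∀ i ∈ D, IsHeavy H V₀ c (f i (α i)) (f (r i) 2) := fun i hi =>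
    mem_heavyIndices.1 (mem_sdiff.1 (hrN i hi)).1
  have hα : ∀ i, f i (α i) ∉ h := by
    intro i hi
    have := hh hi
    simp only [mem_union, mem_image, mem_univ, true_and] at this
    have h3 := hαβ i
    rcases this with ⟨j, hj⟩ | ⟨j, -, hj⟩
    · have := (hinj _ _ _ _ hj).2
      grind
    · obtain ⟨rfl, h5⟩ := hinj _ _ _ _ hj
      grind
  let g : ι → Finset V := fun i => {f i (α i), f (r i) 2}
  have hgd : ∀ i ∈ D, ∀ j ∈ D, i ≠ j → Disjoint (g i) (g j) := by
    intro i hi j hj hij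
    rw [Finset.disjoint_left]
    intro x hx hx'
    have h3 := hαβ i
    have h4 := hαβ j
    have h5 : r i ≠ r j := fun h => hij (hr hi hj h)
    simp only [g, mem_insert, mem_singleton] at hx hx'
    rcases hx with rfl | rfl <;> rcases hx' with h | h <;> have := hinj _ _ _ _ h <;> grind
  have hgh : ∀ i ∈ D, Disjoint h (g i) := by
    intro i hi
    rw [disjoint_right]
    intro x hx
    simp only [g, mem_insert, mem_singleton] at hx
    rcases hx with rfl | rfl
    · exact hα i
    · exact hrJ i hi
  have hginj : Set.InjOn g D := by
    intro i hi j hj hij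
    by_contra hne
    have := hgd i hi j hj hne
    rw [hij, disjoint_self_iff_empty] at this
    simp [g] at this
  have hhg : h ∉ D.image g := by
    intro hm
    obtain ⟨i, -, hi⟩ := mem_image.1 hm
    exact hα i (by rw [← hi]; simp [g])
  have hcard : (insert h (D.image g)).card = D.card + 1 := by
    rw [card_insert_of_notMem hhg, card_image_of_injOn hginj]
  have hle := hf.card_le (insert h (D.image g)) D (J₀ ∪ D.image r) (by
      rw [coe_insert]
      refine Set.PairwiseDisjoint.insert ?_ ?_
      · intro a ha b hb hab
        simp only [coe_image, Set.mem_image, mem_coe] at ha hb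
        obtain ⟨i, hi, rfl⟩ := ha
        obtain ⟨j, hj, rfl⟩ := hb
        exact hgd i hi j hj (by rintro rfl; exact hab rfl)
      · intro b hb _
        simp only [coe_image, Set.mem_image, mem_coe] at hb
        obtain ⟨j, hj, rfl⟩ := hb
        exact hgh j hj) (by
      intro a ha
      rw [mem_insert, mem_image] at ha
      rcases ha with rfl | ⟨i, hi, rfl⟩
      · exact hrich
      · exact Or.inr (hrG i hi)) (by
      rw [biUnion_insert]
      refine union_subset ?_ ?_
      · intro x hx
        have hx2 := hh hx
        simp only [id, mem_union, mem_image, mem_univ, true_and, mem_biUnion, mem_insert,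
          mem_singleton, hJ₀, mem_filter, hD] at hx hx2 ⊢
        rcases hx2 with ⟨j, rfl⟩ | ⟨j, hj, rfl⟩
        · exact Or.inr ⟨j, Or.inl hx, rfl⟩
        · refine Or.inl ⟨j, ⟨hj, hx⟩, ?_⟩
          rcases hαβ j with ⟨-, h⟩ | ⟨-, h⟩ <;> simp [h]
      · intro x hx
        simp only [mem_biUnion, mem_image, id] at hx
        obtain ⟨_, ⟨i, hi, rfl⟩, hx⟩ := hx
        simp only [g, mem_insert, mem_singleton] at hx
        simp only [mem_union, mem_image, mem_biUnion, mem_insert, mem_singleton]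
        rcases hx with rfl | rfl
        · refine Or.inl ⟨i, hi, ?_⟩
          rcases hαβ i with ⟨h, -⟩ | ⟨h, -⟩ <;> simp [h]
        · exact Or.inr ⟨r i, Or.inr ⟨i, hi, rfl⟩, rfl⟩) (by
      have h1 := card_union_le J₀ (D.image r)
      have h2 := card_image_le (s := D) (f := r)
      omega)
  omega

/-- The indicator of `IsHeavy`. -/
def heavyInd (H : Finset (Finset V)) (V₀ : Finset V) (c : ℕ) (x y : V) : ℕ :=
  if IsHeavy H V₀ c x y then 1 else 0

lemma heavyInd_comm (x y : V) : heavyInd H V₀ c x y = heavyInd H V₀ c y x := by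
  simp only [heavyInd, isHeavy_comm (x := x) (y := y)]

lemma heavyInd_le_one (x y : V) : heavyInd H V₀ c x y ≤ 1 := by
  unfold heavyInd; split_ifs <;> simp

lemma heavyInd_eq_zero {x y : V} : heavyInd H V₀ c x y = 0 ↔ ¬ IsHeavy H V₀ c x y := by
  simp [heavyInd]

lemma IsSwitchFree.exists_independent (hf : IsSwitchFree H V₀ c f) (hc : 30 ≤ c)
    (hH : ∀ e ∈ H, e.card = 3) : ∃ (B : Finset V) (q : ℕ), (∀ e ∈ H, ¬ e ⊆ B) ∧
      (∀ x ∈ B, ∃ i k, f i k = x) ∧ q ≤ Fintype.card ι ∧ B.card + q = 2 * Fintype.card ι ∧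
      (∑ i, ∑ j, ∑ k, ∑ l, heavyInd H V₀ c (f i k) (f j l)) + q ^ 2 ≤
        5 * Fintype.card ι ^ 2 + 9 * Fintype.card ι := by
  have hinj := hf.inj
  set N := fun x => heavyIndices H V₀ c f x with hN
  set P : Finset ι := {i | 3 ≤ (N (f i 0)).card ∨ 3 ≤ (N (f i 1)).card} with hPdef
  set α : ι → Fin 3 := fun i => if 3 ≤ (N (f i 0)).card then 0 else 1 with hα
  set β : ι → Fin 3 := fun i => if 3 ≤ (N (f i 0)).card then 1 else 0 with hβ
  have hαβ : ∀ i, α i = 0 ∧ β i = 1 ∨ α i = 1 ∧ β i = 0 := by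
    intro i
    simp only [hα, hβ]
    split_ifs <;> simp
  have hP : ∀ i ∈ P, 3 ≤ (N (f i (α i))).card := by
    intro i hi
    rw [hPdef, mem_filter] at hi
    simp only [hα]
    split_ifs with h
    · exact h
    · exact hi.2.resolve_left h
  have hβN : ∀ i ∈ P, N (f i (β i)) = ∅ := by
    intro i hi
    rw [eq_empty_iff_forall_notMem]
    intro r' hr'
    obtain ⟨r, hr, hne⟩ := exists_mem_ne (by have := hP i hi; omega : 1 < (N (f i (α i))).card) r'
    exact hf.not_heavy_of_ne hc hne (hαβ i) (mem_heavyIndices.1 hr) (mem_heavyIndices.1 hr')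
  have hrich : ∀ {h : Finset V}, h ⊆ univ.image (f · 2) ∪ P.image (fun i => f i (β i)) →
      h.card ≤ 3 → ¬ IsRich H V₀ c h := fun hh hh3 => hf.not_rich hc hαβ hP hh hh3
  have hPcard : P.card ≤ Fintype.card ι := card_le_univ P
  set L := Fintype.card ι with hL
  have hpr : ∀ i, ∑ j, (heavyInd H V₀ c (f i 0) (f j 2) + heavyInd H V₀ c (f i 1) (f j 2)) ≤
      4 + if i ∈ P then L else 0 := by
    intro i
    have h1 : ∀ x, ∑ j, heavyInd H V₀ c x (f j 2) = (N x).card := by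
      intro x
      simp only [heavyInd, hN, heavyIndices, card_filter]
    rw [sum_add_distrib, h1, h1]
    split_ifs with hi
    · have h2 := hβN i hi
      have h3 : (N (f i (α i))).card ≤ L := card_le_univ _
      rcases hαβ i with ⟨h4, h5⟩ | ⟨h4, h5⟩ <;> rw [h4] at h3 <;> rw [h5] at h2 <;> rw [h2] <;>
        simp <;> omega
    · have : ¬ (3 ≤ (N (f i 0)).card ∨ 3 ≤ (N (f i 1)).card) := by
        simpa [hPdef] using hi
      omega
  have hpp : ∀ i j, heavyInd H V₀ c (f i 0) (f j 0) + heavyInd H V₀ c (f i 0) (f j 1) +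
      heavyInd H V₀ c (f i 1) (f j 0) + heavyInd H V₀ c (f i 1) (f j 1) +
      (if i ∈ P then 1 else 0) * (if j ∈ P then 1 else 0) ≤ 4 + if i = j then 1 else 0 := by
    intro i j
    have h1 := heavyInd_le_one (H := H) (V₀ := V₀) (c := c) (f i 0) (f j 0)
    have h2 := heavyInd_le_one (H := H) (V₀ := V₀) (c := c) (f i 0) (f j 1)
    have h3 := heavyInd_le_one (H := H) (V₀ := V₀) (c := c) (f i 1) (f j 0)
    have h4 := heavyInd_le_one (H := H) (V₀ := V₀) (c := c) (f i 1) (f j 1)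
    by_cases hi : i ∈ P <;> by_cases hj : j ∈ P <;> simp only [hi, hj, if_true, if_false] <;>
      split_ifs with hij <;> try omega
    have h5 : heavyInd H V₀ c (f i (β i)) (f j (β j)) = 0 := by
      rw [heavyInd_eq_zero]
      intro h
      refine hrich (h := {f i (β i), f j (β j)}) ?_ (card_le_two.trans (by norm_num)) (Or.inr h)
      intro x hx
      simp only [mem_insert, mem_singleton] at hx
      rw [mem_union, mem_image, mem_image]
      rcases hx with rfl | rfl
      · exact Or.inr ⟨i, hi, rfl⟩
      · exact Or.inr ⟨j, hj, rfl⟩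
    rcases hαβ i with ⟨-, h6⟩ | ⟨-, h6⟩ <;> rcases hαβ j with ⟨-, h7⟩ | ⟨-, h7⟩ <;>
      rw [h6, h7] at h5 <;> omega
  have hrr : ∀ i j, heavyInd H V₀ c (f i 2) (f j 2) = 0 := by
    intro i j
    rw [heavyInd_eq_zero]
    intro h
    refine hrich (h := {f i 2, f j 2}) ?_ (card_le_two.trans (by norm_num)) (Or.inr h)
    intro x hx
    simp only [mem_insert, mem_singleton] at hx
    rw [mem_union, mem_image, mem_image]
    rcases hx with rfl | rfl
    · exact Or.inl ⟨i, mem_univ _, rfl⟩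
    · exact Or.inl ⟨j, mem_univ _, rfl⟩
  refine ⟨univ.image (f · 2) ∪ P.image (fun i => f i (β i)), L - P.card, ?_, ?_, Nat.sub_le _ _,
    ?_, ?_⟩
  · exact fun e he hs => hrich hs (hH e he).le (Or.inl he)
  · intro x hx
    simp only [mem_union, mem_image, mem_univ, true_and] at hx
    rcases hx with ⟨i, rfl⟩ | ⟨i, -, rfl⟩
    · exact ⟨i, 2, rfl⟩
    · exact ⟨i, _, rfl⟩
  · rw [card_union_of_disjoint, card_image_of_injective _ (fun i j hij => (hinj _ _ _ _ hij).1),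
      card_image_of_injective _ (fun i j hij => (hinj _ _ _ _ hij).1), card_univ]
    · omega
    · rw [Finset.disjoint_left]
      intro x hx hx'
      simp only [mem_image] at hx hx'
      obtain ⟨i, -, rfl⟩ := hx
      obtain ⟨j, -, hj⟩ := hx'
      have := (hinj _ _ _ _ hj).2
      have := hαβ j
      grind
  · have hsplit : (∑ i, ∑ j, ∑ k, ∑ l, heavyInd H V₀ c (f i k) (f j l)) =
        (∑ i, ∑ j, (heavyInd H V₀ c (f i 0) (f j 0) + heavyInd H V₀ c (f i 0) (f j 1) +
          heavyInd H V₀ c (f i 1) (f j 0) + heavyInd H V₀ c (f i 1) (f j 1))) +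
        (∑ i, ∑ j, (heavyInd H V₀ c (f i 0) (f j 2) + heavyInd H V₀ c (f i 1) (f j 2))) +
        (∑ i, ∑ j, (heavyInd H V₀ c (f j 0) (f i 2) + heavyInd H V₀ c (f j 1) (f i 2))) := by
      simp only [← sum_add_distrib]
      refine sum_congr rfl fun i _ => sum_congr rfl fun j _ => ?_
      simp only [Fin.sum_univ_three]
      rw [hrr i j, heavyInd_comm (f i 2) (f j 0), heavyInd_comm (f i 2) (f j 1)]
      ring
    have h1 : (∑ i, ∑ j, (heavyInd H V₀ c (f i 0) (f j 2) + heavyInd H V₀ c (f i 1) (f j 2))) ≤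
        4 * L + P.card * L := by
      refine (sum_le_sum fun i _ => hpr i).trans ?_
      rw [sum_add_distrib, sum_ite_mem, univ_inter, sum_const, sum_const, card_univ, smul_eq_mul,
        smul_eq_mul]
      linarith
    have h2 : (∑ i, ∑ j, (heavyInd H V₀ c (f j 0) (f i 2) + heavyInd H V₀ c (f j 1) (f i 2))) ≤
        4 * L + P.card * L := by
      rwa [sum_comm]
    have h3 : (∑ i, ∑ j, (heavyInd H V₀ c (f i 0) (f j 0) + heavyInd H V₀ c (f i 0) (f j 1) +
          heavyInd H V₀ c (f i 1) (f j 0) + heavyInd H V₀ c (f i 1) (f j 1))) + P.card ^ 2 ≤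
        4 * L ^ 2 + L := by
      have h := sum_le_sum fun i (_ : i ∈ (univ : Finset ι)) =>
        sum_le_sum fun j (_ : j ∈ (univ : Finset ι)) => hpp i j
      simp only [sum_add_distrib (f := fun _ => (4 : ℕ)), sum_const, card_univ, smul_eq_mul,
        sum_ite_eq, mem_univ, if_true] at h
      have h4 : ∑ i : ι, ∑ j : ι, (if i ∈ P then 1 else 0) * (if j ∈ P then 1 else 0) =
          P.card ^ 2 := by
        rw [← sum_mul_sum]
        simp [sq]
      have h5 : ∑ i, ∑ j, (heavyInd H V₀ c (f i 0) (f j 0) + heavyInd H V₀ c (f i 0) (f j 1) +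
          heavyInd H V₀ c (f i 1) (f j 0) + heavyInd H V₀ c (f i 1) (f j 1) +
          (if i ∈ P then 1 else 0) * (if j ∈ P then 1 else 0)) =
          ∑ i, ∑ j, (heavyInd H V₀ c (f i 0) (f j 0) + heavyInd H V₀ c (f i 0) (f j 1) +
          heavyInd H V₀ c (f i 1) (f j 0) + heavyInd H V₀ c (f i 1) (f j 1)) + P.card ^ 2 := by
        rw [← h4]
        simp only [← sum_add_distrib]
      rw [h5] at h
      refine h.trans (le_of_eq ?_)
      rw [← hL]
      ring
    rw [hsplit]
    obtain ⟨q, hq⟩ := Nat.exists_eq_add_of_le hPcard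
    rw [hq, Nat.add_sub_cancel_left]
    rw [hq] at h1 h2 h3
    nlinarith

end Switching

section Blocks
variable {V : Type*} [DecidableEq V] {H M : Finset (Finset V)} {V₀ : Finset V} {c : ℕ}

/-- The number of heavy ordered pairs in `E ×ˢ F`. -/
def heavyCount (H : Finset (Finset V)) (V₀ : Finset V) (c : ℕ) (E F : Finset V) : ℕ :=
  ∑ x ∈ E, ∑ y ∈ F, heavyInd H V₀ c x y

lemma heavyCount_comm (E F : Finset V) : heavyCount H V₀ c E F = heavyCount H V₀ c F E := by
  unfold heavyCount
  rw [sum_comm]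
  exact sum_congr rfl fun x _ => sum_congr rfl fun y _ => heavyInd_comm _ _

lemma heavyCount_le_mul (E F : Finset V) : heavyCount H V₀ c E F ≤ E.card * F.card := by
  unfold heavyCount
  calc _ ≤ ∑ x ∈ E, ∑ y ∈ F, 1 := sum_le_sum fun x _ => sum_le_sum fun y _ => heavyInd_le_one x y
    _ = _ := by simp

/-- There are two disjoint heavy pairs between `E` and `F`. -/
def HasTwoHeavy (H : Finset (Finset V)) (V₀ : Finset V) (c : ℕ) (E F : Finset V) : Prop :=
  ∃ x ∈ E, ∃ x' ∈ E, ∃ y ∈ F, ∃ y' ∈ F, x ≠ x' ∧ y ≠ y' ∧ IsHeavy H V₀ c x y ∧ IsHeavy H V₀ c x' y'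

lemma sum_card_three {E : Finset V} {x y z : V} (hE : E = {x, y, z}) (h : E.card = 3) (φ : V → ℕ) :
    ∑ v ∈ E, φ v = φ x + φ y + φ z := by
  subst hE
  obtain ⟨h1, h2, h3⟩ := ne_of_card_triple h
  rw [sum_insert (by simp [h1, h2]), sum_pair h3, add_assoc]

lemma heavyCount_le_three {E F : Finset V} (hE : E.card = 3) (hF : F.card = 3)
    (h : ¬ HasTwoHeavy H V₀ c E F) : heavyCount H V₀ c E F ≤ 3 := by
  obtain ⟨x, y, z, h1, h2, h3, hE'⟩ := card_eq_three.1 hE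
  obtain ⟨a, b, d, h4, h5, h6, hF'⟩ := card_eq_three.1 hF
  unfold heavyCount
  rw [sum_card_three hE' hE]
  simp only [sum_card_three hF' hF]
  have key : ∀ s ∈ E, ∀ t ∈ E, ∀ v ∈ F, ∀ w ∈ F, s ≠ t → v ≠ w →
      heavyInd H V₀ c s v + heavyInd H V₀ c t w ≤ 1 := by
    intro s hs t ht v hv w hw hst hvw
    by_contra hcon
    refine h ⟨s, hs, t, ht, v, hv, w, hw, hst, hvw, ?_, ?_⟩
    · by_contra h'
      have := heavyInd_eq_zero.2 h'
      have := heavyInd_le_one (H := H) (V₀ := V₀) (c := c) t w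
      omega
    · by_contra h'
      have := heavyInd_eq_zero.2 h'
      have := heavyInd_le_one (H := H) (V₀ := V₀) (c := c) s v
      omega
  have hx : x ∈ E := by simp [hE']
  have hy : y ∈ E := by simp [hE']
  have hz : z ∈ E := by simp [hE']
  have ha : a ∈ F := by simp [hF']
  have hb : b ∈ F := by simp [hF']
  have hd : d ∈ F := by simp [hF']
  have := key x hx y hy a ha b hb h1 h4
  have := key x hx z hz a ha d hd h2 h5
  have := key y hy z hz b hb d hd h3 h6
  have := key x hx y hy b hb d hd h1 h6
  have := key x hx z hz b hb a ha h2 h4.symm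
  have := key y hy z hz d hd a ha h3 h5.symm
  have := key x hx y hy d hd a ha h1 h5.symm
  have := key x hx z hz d hd b hb h2 h6.symm
  have := key y hy z hz a ha b hb h3 h4
  omega

lemma IsMaximumMatching.heavyCount_le_six (hM : IsMaximumMatching H M V₀) (hc : 30 ≤ c)
    {E F : Finset V} (hE : E ∈ M) (hF : F ∈ M) (hEF : E ≠ F) : heavyCount H V₀ c E F ≤ 6 := by
  have hE3 := hM.card_eq E (hM.subset hE)
  have hF3 := hM.card_eq F (hM.subset hF)
  have hdis : Disjoint E F := hM.disjoint hE hF hEF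
  obtain ⟨x, y, z, h1, h2, h3, hE'⟩ := card_eq_three.1 hE3
  obtain ⟨a, b, d, h4, h5, h6, hF'⟩ := card_eq_three.1 hF3
  unfold heavyCount
  rw [sum_card_three hE' hE3]
  simp only [sum_card_three hF' hF3]
  have key : ∀ a ∈ F, ∀ b ∈ F, ∀ d ∈ F, a ≠ b → a ≠ d → b ≠ d →
      heavyInd H V₀ c x a + heavyInd H V₀ c y b + heavyInd H V₀ c z d ≤ 2 := by
    intro a ha b hb d hd hab had hbd
    by_contra hcon
    have l1 := heavyInd_le_one (H := H) (V₀ := V₀) (c := c) x a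
    have l2 := heavyInd_le_one (H := H) (V₀ := V₀) (c := c) y b
    have l3 := heavyInd_le_one (H := H) (V₀ := V₀) (c := c) z d
    have g1 : IsHeavy H V₀ c x a := by
      by_contra h'; have := heavyInd_eq_zero.2 h'; omega
    have g2 : IsHeavy H V₀ c y b := by
      by_contra h'; have := heavyInd_eq_zero.2 h'; omega
    have g3 : IsHeavy H V₀ c z d := by
      by_contra h'; have := heavyInd_eq_zero.2 h'; omega
    rw [Finset.disjoint_left] at hdis
    have hx : x ∉ F := hdis (by simp [hE'])
    have hy : y ∉ F := hdis (by simp [hE'])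
    have hz : z ∉ F := hdis (by simp [hE'])
    have d1 : Disjoint ({x, a} : Finset V) {y, b} := by
      rw [Finset.disjoint_left]; simp only [mem_insert, mem_singleton]; grind
    have d2 : Disjoint ({x, a} : Finset V) {z, d} := by
      rw [Finset.disjoint_left]; simp only [mem_insert, mem_singleton]; grind
    have d3 : Disjoint ({y, b} : Finset V) {z, d} := by
      rw [Finset.disjoint_left]; simp only [mem_insert, mem_singleton]; grind
    have n1 : ({x, a} : Finset V) ≠ {y, b} := by
      intro h; rw [h, disjoint_self_iff_empty] at d1; simp at d1
    have n2 : ({x, a} : Finset V) ≠ {z, d} := by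
      intro h; rw [h, disjoint_self_iff_empty] at d2; simp at d2
    have n3 : ({y, b} : Finset V) ≠ {z, d} := by
      intro h; rw [h, disjoint_self_iff_empty] at d3; simp at d3
    have hcard : ({{x, a}, {y, b}, {z, d}} : Finset (Finset V)).card = 3 := card_triple n1 n2 n3
    have := hM.card_rich_le (c := c) (𝓕 := {{x, a}, {y, b}, {z, d}}) (N := {E, F})
      (by simp [insert_subset_iff, hE, hF]) (by
        rw [coe_insert]
        refine (pairwiseDisjoint_pair d3).insert ?_
        intro e he _
        simp only [coe_insert, coe_singleton, Set.mem_insert_iff, Set.mem_singleton_iff] at he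
        rcases he with rfl | rfl
        · exact d1
        · exact d2) (by
        intro e he
        simp only [mem_insert, mem_singleton] at he
        rcases he with rfl | rfl | rfl
        · exact Or.inr g1
        · exact Or.inr g2
        · exact Or.inr g3) (by
        intro v hv
        simp only [mem_biUnion, mem_insert, mem_singleton, id] at hv ⊢
        obtain ⟨e, rfl | rfl | rfl, hv⟩ := hv <;>
          simp only [mem_insert, mem_singleton] at hv <;> rcases hv with rfl | rfl
        · exact ⟨E, by simp, by simp [hE']⟩
        · exact ⟨F, by simp, ha⟩
        · exact ⟨E, by simp, by simp [hE']⟩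
        · exact ⟨F, by simp, hb⟩
        · exact ⟨E, by simp, by simp [hE']⟩
        · exact ⟨F, by simp, hd⟩) (by omega)
    rw [hcard] at this
    have := card_le_two (a := E) (b := F)
    omega
  have ha : a ∈ F := by simp [hF']
  have hb : b ∈ F := by simp [hF']
  have hd : d ∈ F := by simp [hF']
  have := key a ha b hb d hd h4 h5 h6
  have := key b hb d hd a ha h6 h4.symm h5.symm
  have := key d hd a ha b hb h5.symm h6.symm h4
  omega

/-- The vertices of two triples joined by two disjoint heavy pairs can be arranged as two heavy
pairs and two further vertices. -/
lemma HasTwoHeavy.exists_block {E F : Finset V} (h : HasTwoHeavy H V₀ c E F) (hE : E.card = 3)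
    (hF : F.card = 3) (hdis : Disjoint E F) : ∃ g : Fin 2 → Fin 3 → V,
      (∀ t, IsHeavy H V₀ c (g t 0) (g t 1)) ∧
      (∀ t k t' k', g t k = g t' k' → t = t' ∧ k = k') ∧
      (∀ φ : V → ℕ, ∑ t, ∑ k, φ (g t k) = ∑ x ∈ E, φ x + ∑ x ∈ F, φ x) ∧
      ∀ t k, g t k ∈ E ∪ F := by
  obtain ⟨x, hx, x', hx', y, hy, y', hy', hxx, hyy, g1, g2⟩ := h
  have third : ∀ {E : Finset V} {x x' : V}, E.card = 3 → x ∈ E → x' ∈ E → x ≠ x' →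
      ∃ z, E = {x, x', z} := by
    intro E x x' hE hx hx' hne
    have h1 : ((E.erase x).erase x').card = 1 := by
      rw [card_erase_of_mem (mem_erase.2 ⟨hne.symm, hx'⟩), card_erase_of_mem hx, hE]
    obtain ⟨z, hz⟩ := card_eq_one.1 h1
    refine ⟨z, ?_⟩
    rw [← hz, insert_erase (mem_erase.2 ⟨hne.symm, hx'⟩), insert_erase hx]
  obtain ⟨z, hEz⟩ := third hE hx hx' hxx
  obtain ⟨w, hFw⟩ := third hF hy hy' hyy
  have hE3 := hE
  have hF3 := hF
  rw [hEz] at hE3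
  rw [hFw] at hF3
  obtain ⟨-, e2, e3⟩ := ne_of_card_triple hE3
  obtain ⟨-, f2, f3⟩ := ne_of_card_triple hF3
  have hz : z ∈ E := by rw [hEz]; simp
  have hw : w ∈ F := by rw [hFw]; simp
  have hne : ∀ a ∈ E, ∀ b ∈ F, a ≠ b := fun a ha b hb hab =>
    Finset.disjoint_left.1 hdis ha (hab ▸ hb)
  refine ⟨![![x, y, z], ![x', y', w]], ?_, ?_, ?_, ?_⟩
  · simp [Fin.forall_fin_two, g1, g2]
  · have := hne x hx y hy
    have := hne x hx y' hy'
    have := hne x hx w hw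
    have := hne x' hx' y hy
    have := hne x' hx' y' hy'
    have := hne x' hx' w hw
    have := hne z hz y hy
    have := hne z hz y' hy'
    have := hne z hz w hw
    intro t k t' k'
    fin_cases t <;> fin_cases t' <;> fin_cases k <;> fin_cases k' <;> simp <;> grind
  · intro φ
    rw [sum_card_three hEz hE, sum_card_three hFw hF]
    simp [Fin.sum_univ_two, Fin.sum_univ_three]
    ring
  · intro t k
    rw [mem_union]
    fin_cases t <;> fin_cases k <;> simp [*]

end Blocks

section BlockFamily
variable {V : Type*} [DecidableEq V] {H M : Finset (Finset V)} {V₀ : Finset V} {c : ℕ}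

/-- A set of pairwise disjoint pairs of elements of `M`, each of which has two disjoint heavy pairs
between its elements. -/
structure IsBlockFamily (H M : Finset (Finset V)) (V₀ : Finset V) (c : ℕ)
    (𝓑 : Finset (Finset V × Finset V)) : Prop where
  fst_mem : ∀ p ∈ 𝓑, p.1 ∈ M
  snd_mem : ∀ p ∈ 𝓑, p.2 ∈ M
  ne : ∀ p ∈ 𝓑, p.1 ≠ p.2
  hasTwoHeavy : ∀ p ∈ 𝓑, HasTwoHeavy H V₀ c p.1 p.2
  disjoint : ∀ p ∈ 𝓑, ∀ q ∈ 𝓑, p ≠ q → p.1 ≠ q.1 ∧ p.1 ≠ q.2 ∧ p.2 ≠ q.1 ∧ p.2 ≠ q.2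

/-- The elements of `M` which are not covered by `𝓑`. -/
def uncovered (M : Finset (Finset V)) (𝓑 : Finset (Finset V × Finset V)) : Finset (Finset V) :=
  {E ∈ M | ∀ p ∈ 𝓑, E ≠ p.1 ∧ E ≠ p.2}

lemma mem_uncovered {𝓑 : Finset (Finset V × Finset V)} {E : Finset V} :
    E ∈ uncovered M 𝓑 ↔ E ∈ M ∧ ∀ p ∈ 𝓑, E ≠ p.1 ∧ E ≠ p.2 := by
  simp [uncovered]

lemma IsBlockFamily.insert {𝓑 : Finset (Finset V × Finset V)} (h : IsBlockFamily H M V₀ c 𝓑)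
    {E F : Finset V} (hE : E ∈ uncovered M 𝓑) (hF : F ∈ uncovered M 𝓑) (hEF : E ≠ F)
    (hg : HasTwoHeavy H V₀ c E F) :
    IsBlockFamily H M V₀ c (insert (E, F) 𝓑) ∧ (insert (E, F) 𝓑).card = 𝓑.card + 1 := by
  rw [mem_uncovered] at hE hF
  refine ⟨⟨?_, ?_, ?_, ?_, ?_⟩, card_insert_of_notMem fun hm => (hE.2 _ hm).1 rfl⟩
  · intro p hp
    rcases mem_insert.1 hp with rfl | hp
    exacts [hE.1, h.fst_mem p hp]
  · intro p hp
    rcases mem_insert.1 hp with rfl | hp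
    exacts [hF.1, h.snd_mem p hp]
  · intro p hp
    rcases mem_insert.1 hp with rfl | hp
    exacts [hEF, h.ne p hp]
  · intro p hp
    rcases mem_insert.1 hp with rfl | hp
    exacts [hg, h.hasTwoHeavy p hp]
  · intro p hp q hq hpq
    rcases mem_insert.1 hp with rfl | hp <;> rcases mem_insert.1 hq with rfl | hq
    · exact absurd rfl hpq
    · exact ⟨(hE.2 q hq).1, (hE.2 q hq).2, (hF.2 q hq).1, (hF.2 q hq).2⟩
    · exact ⟨(hE.2 p hp).1.symm, (hF.2 p hp).1.symm, (hE.2 p hp).2.symm, (hF.2 p hp).2.symm⟩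
    · exact h.disjoint p hp q hq hpq

lemma IsBlockFamily.mono {𝓑 𝓑' : Finset (Finset V × Finset V)} (h : IsBlockFamily H M V₀ c 𝓑)
    (h' : 𝓑' ⊆ 𝓑) : IsBlockFamily H M V₀ c 𝓑' :=
  ⟨fun p hp => h.fst_mem p (h' hp), fun p hp => h.snd_mem p (h' hp), fun p hp => h.ne p (h' hp),
    fun p hp => h.hasTwoHeavy p (h' hp), fun p hp q hq => h.disjoint p (h' hp) q (h' hq)⟩

lemma exists_isBlockFamily_max (H M : Finset (Finset V)) (V₀ : Finset V) (c : ℕ) :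
    ∃ 𝓑, IsBlockFamily H M V₀ c 𝓑 ∧ ∀ 𝓑', IsBlockFamily H M V₀ c 𝓑' → 𝓑'.card ≤ 𝓑.card := by
  classical
  obtain ⟨𝓑, h𝓑, hmax⟩ := exists_max_image
    ({𝓑 ∈ (M ×ˢ M).powerset | IsBlockFamily H M V₀ c 𝓑}) Finset.card
    ⟨∅, by simp only [mem_filter, empty_mem_powerset, true_and]; constructor <;> simp⟩
  refine ⟨𝓑, (mem_filter.1 h𝓑).2, fun 𝓑' h => hmax 𝓑' (mem_filter.2 ⟨mem_powerset.2 ?_, h⟩)⟩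
  intro p hp
  exact mem_product.2 ⟨h.fst_mem p hp, h.snd_mem p hp⟩

variable {𝓑 : Finset (Finset V × Finset V)}

lemma IsBlockFamily.sum_add_sum_uncovered (h : IsBlockFamily H M V₀ c 𝓑) (φ : Finset V → ℕ) :
    ∑ E ∈ M, φ E = ∑ p ∈ 𝓑, (φ p.1 + φ p.2) + ∑ E ∈ uncovered M 𝓑, φ E := by
  have hM : M = (𝓑.image Prod.fst ∪ 𝓑.image Prod.snd) ∪ uncovered M 𝓑 := by
    ext E
    simp only [mem_union, mem_image, mem_uncovered]
    constructor
    · intro hE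
      by_contra hcon
      simp only [not_or, not_exists, not_and] at hcon
      exact hcon.2 hE fun p hp => ⟨fun e => hcon.1.1 p hp e.symm, fun e => hcon.1.2 p hp e.symm⟩
    · rintro ((⟨p, hp, rfl⟩ | ⟨p, hp, rfl⟩) | hE)
      exacts [h.fst_mem p hp, h.snd_mem p hp, hE.1]
  have d1 : Disjoint (𝓑.image Prod.fst) (𝓑.image Prod.snd) := by
    rw [Finset.disjoint_left]
    intro E hE hE'
    obtain ⟨p, hp, rfl⟩ := mem_image.1 hE
    obtain ⟨q, hq, hpq⟩ := mem_image.1 hE'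
    by_cases hne : p = q
    · subst hne; exact h.ne p hp hpq.symm
    · exact (h.disjoint p hp q hq hne).2.1 hpq.symm
  have d2 : Disjoint (𝓑.image Prod.fst ∪ 𝓑.image Prod.snd) (uncovered M 𝓑) := by
    rw [Finset.disjoint_right]
    intro E hE hE'
    rw [mem_uncovered] at hE
    simp only [mem_union, mem_image] at hE'
    rcases hE' with ⟨p, hp, rfl⟩ | ⟨p, hp, rfl⟩
    exacts [(hE.2 p hp).1 rfl, (hE.2 p hp).2 rfl]
  have i1 : Set.InjOn Prod.fst (𝓑 : Set (Finset V × Finset V)) := by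
    intro p hp q hq hpq
    by_contra hne
    exact (h.disjoint p hp q hq hne).1 hpq
  have i2 : Set.InjOn Prod.snd (𝓑 : Set (Finset V × Finset V)) := by
    intro p hp q hq hpq
    by_contra hne
    exact (h.disjoint p hp q hq hne).2.2.2 hpq
  conv_lhs => rw [hM]
  rw [sum_union d2, sum_union d1, sum_image i1, sum_image i2, sum_add_distrib]

lemma IsBlockFamily.not_hasTwoHeavy (h : IsBlockFamily H M V₀ c 𝓑)
    (hmax : ∀ 𝓑', IsBlockFamily H M V₀ c 𝓑' → 𝓑'.card ≤ 𝓑.card) {E F : Finset V}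
    (hE : E ∈ uncovered M 𝓑) (hF : F ∈ uncovered M 𝓑) (hEF : E ≠ F) :
    ¬ HasTwoHeavy H V₀ c E F := by
  intro hg
  have h1 := h.insert hE hF hEF hg
  have := hmax _ h1.1
  omega

lemma IsBlockFamily.not_hasTwoHeavy_of_ne (h : IsBlockFamily H M V₀ c 𝓑)
    (hmax : ∀ 𝓑', IsBlockFamily H M V₀ c 𝓑' → 𝓑'.card ≤ 𝓑.card) {p : Finset V × Finset V}
    (hp : p ∈ 𝓑) {A A' : Finset V} (hA : A ∈ uncovered M 𝓑) (hA' : A' ∈ uncovered M 𝓑)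
    (hne : A ≠ A') (hg : HasTwoHeavy H V₀ c p.1 A) : ¬ HasTwoHeavy H V₀ c p.2 A' := by
  intro hg'
  have hA2 := (mem_uncovered.1 hA)
  have hA2' := (mem_uncovered.1 hA')
  have h0 := h.mono (erase_subset p 𝓑)
  have h1 := h0.insert (E := p.1) (F := A) (by
      rw [mem_uncovered]
      refine ⟨h.fst_mem p hp, fun q hq => ?_⟩
      have := h.disjoint p hp q (mem_of_mem_erase hq) (ne_of_mem_erase hq).symm
      exact ⟨this.1, this.2.1⟩) (by
      rw [mem_uncovered]
      exact ⟨hA2.1, fun q hq => hA2.2 q (mem_of_mem_erase hq)⟩) (hA2.2 p hp).1.symm hg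
  have h2 := h1.1.insert (E := p.2) (F := A') (by
      rw [mem_uncovered]
      refine ⟨h.snd_mem p hp, fun q hq => ?_⟩
      rcases mem_insert.1 hq with rfl | hq
      · exact ⟨(h.ne p hp).symm, (hA2.2 p hp).2.symm⟩
      have := h.disjoint p hp q (mem_of_mem_erase hq) (ne_of_mem_erase hq).symm
      exact ⟨this.2.2.1, this.2.2.2⟩) (by
      rw [mem_uncovered]
      refine ⟨hA2'.1, fun q hq => ?_⟩
      rcases mem_insert.1 hq with rfl | hq
      · exact ⟨(hA2'.2 p hp).1, hne.symm⟩
      exact hA2'.2 q (mem_of_mem_erase hq)) (hA2'.2 p hp).2.symm hg'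
  have h3 := hmax _ h2.1
  have h4 := card_erase_add_one hp
  omega

lemma IsBlockFamily.sum_heavyCount_le (h : IsBlockFamily H M V₀ c 𝓑)
    (hM : IsMaximumMatching H M V₀) (hc : 30 ≤ c)
    (hmax : ∀ 𝓑', IsBlockFamily H M V₀ c 𝓑' → 𝓑'.card ≤ 𝓑.card) {p : Finset V × Finset V}
    (hp : p ∈ 𝓑) : ∑ A ∈ uncovered M 𝓑, (heavyCount H V₀ c p.1 A + heavyCount H V₀ c p.2 A) ≤
      9 * (uncovered M 𝓑).card + 3 := by
  have h3 : ∀ E ∈ M, E.card = 3 := fun E hE => hM.card_eq E (hM.subset hE)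
  have h1 := h.fst_mem p hp
  have h2 := h.snd_mem p hp
  have hU : ∀ A ∈ uncovered M 𝓑, A ∈ M := fun A hA => (mem_uncovered.1 hA).1
  have six : ∀ A ∈ uncovered M 𝓑, heavyCount H V₀ c p.1 A ≤ 6 ∧ heavyCount H V₀ c p.2 A ≤ 6 := by
    intro A hA
    have := (mem_uncovered.1 hA).2 p hp
    exact ⟨hM.heavyCount_le_six hc h1 (hU A hA) this.1.symm,
      hM.heavyCount_le_six hc h2 (hU A hA) this.2.symm⟩
  by_cases hA : ∃ A ∈ uncovered M 𝓑, HasTwoHeavy H V₀ c p.1 A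
  · obtain ⟨A₀, hA₀, hg⟩ := hA
    calc _ ≤ ∑ A ∈ uncovered M 𝓑, (9 + if A₀ = A then 3 else 0) := by
          refine sum_le_sum fun A hA => ?_
          have := six A hA
          split_ifs with heq
          · omega
          · have := heavyCount_le_three (h3 _ h2) (h3 _ (hU A hA))
              (h.not_hasTwoHeavy_of_ne hmax hp hA₀ hA heq hg)
            omega
      _ = _ := by
          rw [sum_add_distrib, sum_ite_eq, if_pos hA₀, sum_const, smul_eq_mul, mul_comm]
  · push Not at hA
    calc _ ≤ ∑ A ∈ uncovered M 𝓑, 9 := by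
          refine sum_le_sum fun A hA' => ?_
          have := six A hA'
          have := heavyCount_le_three (h3 _ h1) (h3 _ (hU A hA')) (hA A hA')
          omega
      _ ≤ _ := by
          rw [sum_const, smul_eq_mul, mul_comm]; omega

lemma IsBlockFamily.sum_sum_heavyCount_le (h : IsBlockFamily H M V₀ c 𝓑)
    (hM : IsMaximumMatching H M V₀)
    (hmax : ∀ 𝓑', IsBlockFamily H M V₀ c 𝓑' → 𝓑'.card ≤ 𝓑.card) :
    ∑ A ∈ uncovered M 𝓑, ∑ B ∈ uncovered M 𝓑, heavyCount H V₀ c A B ≤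
      3 * (uncovered M 𝓑).card ^ 2 + 6 * (uncovered M 𝓑).card := by
  have h3 : ∀ A ∈ uncovered M 𝓑, A.card = 3 := fun A hA =>
    hM.card_eq A (hM.subset (mem_uncovered.1 hA).1)
  calc _ ≤ ∑ A ∈ uncovered M 𝓑, (3 * (uncovered M 𝓑).card + 6) := by
        refine sum_le_sum fun A hA => ?_
        calc _ ≤ ∑ B ∈ uncovered M 𝓑, (3 + if A = B then 6 else 0) := by
              refine sum_le_sum fun B hB => ?_
              split_ifs with heq
              · have := heavyCount_le_mul (H := H) (V₀ := V₀) (c := c) A B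
                rw [h3 A hA, h3 B hB] at this
                omega
              · exact heavyCount_le_three (h3 A hA) (h3 B hB) (h.not_hasTwoHeavy hmax hA hB heq)
          _ = _ := by
              rw [sum_add_distrib, sum_ite_eq, if_pos hA, sum_const, smul_eq_mul, mul_comm]
    _ = _ := by rw [sum_const, smul_eq_mul]; ring

end BlockFamily

section BlockStructure
variable {V : Type*} [DecidableEq V] {H M : Finset (Finset V)} {V₀ : Finset V} {c : ℕ}
  {𝓑 : Finset (Finset V × Finset V)}

lemma IsBlockFamily.exists_isSwitchFree (h : IsBlockFamily H M V₀ c 𝓑)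
    (hM : IsMaximumMatching H M V₀) : ∃ f : 𝓑 × Fin 2 → Fin 3 → V, IsSwitchFree H V₀ c f ∧
      (∀ (p : 𝓑) (φ : V → ℕ), ∑ t, ∑ k, φ (f (p, t) k) =
        ∑ x ∈ p.1.1, φ x + ∑ x ∈ p.1.2, φ x) ∧
      ∀ i k, f i k ∈ M.biUnion id := by
  have h3 : ∀ E ∈ M, E.card = 3 := fun E hE => hM.card_eq E (hM.subset hE)
  have hex : ∀ p : 𝓑, ∃ g : Fin 2 → Fin 3 → V, (∀ t, IsHeavy H V₀ c (g t 0) (g t 1)) ∧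
      (∀ t k t' k', g t k = g t' k' → t = t' ∧ k = k') ∧
      (∀ φ : V → ℕ, ∑ t, ∑ k, φ (g t k) = ∑ x ∈ p.1.1, φ x + ∑ x ∈ p.1.2, φ x) ∧
      ∀ t k, g t k ∈ p.1.1 ∪ p.1.2 := fun p =>
    (h.hasTwoHeavy p p.2).exists_block (h3 _ (h.fst_mem p p.2)) (h3 _ (h.snd_mem p p.2))
      (hM.disjoint (h.fst_mem p p.2) (h.snd_mem p p.2) (h.ne p p.2))
  choose g hheavy hinj hsum hmem using hex
  have hdis : ∀ p q : 𝓑, p ≠ q → Disjoint (p.1.1 ∪ p.1.2) (q.1.1 ∪ q.1.2) := by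
    intro p q hpq
    obtain ⟨h1, h2, h4, h5⟩ := h.disjoint p p.2 q q.2 (fun he => hpq (Subtype.ext he))
    have m1 := h.fst_mem p p.2
    have m2 := h.snd_mem p p.2
    have m3 := h.fst_mem q q.2
    have m4 := h.snd_mem q q.2
    rw [disjoint_union_left, disjoint_union_right, disjoint_union_right]
    exact ⟨⟨hM.disjoint m1 m3 h1, hM.disjoint m1 m4 h2⟩,
      hM.disjoint m2 m3 h4, hM.disjoint m2 m4 h5⟩
  have hfinj : ∀ (i j : 𝓑 × Fin 2) (k l : Fin 3), g i.1 i.2 k = g j.1 j.2 l → i = j ∧ k = l := by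
    intro ⟨p, t⟩ ⟨q, t'⟩ k l hkl
    by_cases hpq : p = q
    · subst hpq
      obtain ⟨rfl, rfl⟩ := hinj p t k t' l hkl
      exact ⟨rfl, rfl⟩
    · exfalso
      refine Finset.disjoint_left.1 (hdis p q hpq) (hmem p t k) ?_
      have := hmem q t' l
      rwa [← hkl] at this
  refine ⟨fun i => g i.1 i.2, ⟨hfinj, ?_⟩, hsum, ?_⟩
  · intro 𝓕 D J hd hr hs hcard
    set T : Finset 𝓑 := (D ∪ J).image Prod.fst with hT
    set S : Finset (𝓑 × Fin 2) := T ×ˢ univ with hS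
    have hDS : D ⊆ S := fun i hi => by
      simp only [hS, mem_product, mem_univ, and_true, hT]
      exact mem_image_of_mem _ (mem_union_left _ hi)
    have hJS : J ⊆ S := fun i hi => by
      simp only [hS, mem_product, mem_univ, and_true, hT]
      exact mem_image_of_mem _ (mem_union_right _ hi)
    have hTc : T.card ≤ D.card + J.card := card_image_le.trans (card_union_le _ _)
    have hSc : S.card = 2 * T.card := by
      rw [hS, card_product]; simp [mul_comm]
    let pr : 𝓑 × Fin 2 → Finset V := fun i => {g i.1 i.2 0, g i.1 i.2 1}
    have hpr : ∀ i j, i ≠ j → Disjoint (pr i) (pr j) := by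
      intro i j hij
      rw [Finset.disjoint_left]
      intro x hx hx'
      simp only [pr, mem_insert, mem_singleton] at hx hx'
      rcases hx with rfl | rfl <;> rcases hx' with h | h <;> exact hij (hfinj _ _ _ _ h).1
    have hprF : ∀ i ∉ D, Disjoint (𝓕.biUnion id) (pr i) := by
      intro i hi
      refine Disjoint.mono_left hs ?_
      rw [disjoint_union_left, disjoint_biUnion_left]
      refine ⟨fun j hj => hpr j i (fun e => hi (e ▸ hj)), ?_⟩
      rw [Finset.disjoint_left]
      intro x hx hx'
      obtain ⟨j, -, rfl⟩ := mem_image.1 hx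
      simp only [pr, mem_insert, mem_singleton] at hx'
      rcases hx' with h | h <;> have := (hfinj _ _ _ _ h).2 <;> simp at this
    have hprinj : Set.InjOn pr (S \ D : Finset _) := by
      intro i _ j _ hij
      by_contra hne
      have := hpr i j hne
      rw [hij, disjoint_self_iff_empty] at this
      simp [pr] at this
    have hFd : Disjoint 𝓕 ((S \ D).image pr) := by
      rw [Finset.disjoint_right]
      intro e he heF
      obtain ⟨i, hi, rfl⟩ := mem_image.1 he
      have := (hprF i (mem_sdiff.1 hi).2).mono_left (subset_biUnion_of_mem id heF)
      rw [id, disjoint_self_iff_empty] at this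
      simp [pr] at this
    have hc1 : (𝓕 ∪ (S \ D).image pr).card + D.card = 𝓕.card + S.card := by
      rw [card_union_of_disjoint hFd, card_image_of_injOn hprinj, add_assoc,
        card_sdiff_add_card_eq_card hDS]
    have hN : (T.biUnion fun p => {p.1.1, p.1.2} : Finset (Finset V)).card ≤ S.card := by
      rw [hSc, mul_comm]
      exact card_biUnion_le_card_mul _ _ _ fun p _ => card_le_two
    have hS_sub : ∀ i ∈ S, ∀ k, g i.1 i.2 k ∈
        (T.biUnion fun p => {p.1.1, p.1.2} : Finset (Finset V)).biUnion id := by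
      intro i hi k
      have h1 : i.1 ∈ T := (mem_product.1 hi).1
      have h2 := hmem i.1 i.2 k
      simp only [mem_biUnion, mem_insert, mem_singleton, id]
      rcases mem_union.1 h2 with h2 | h2
      · exact ⟨_, ⟨i.1, h1, Or.inl rfl⟩, h2⟩
      · exact ⟨_, ⟨i.1, h1, Or.inr rfl⟩, h2⟩
    have key := hM.card_rich_le (c := c) (𝓕 := 𝓕 ∪ (S \ D).image pr)
      (N := T.biUnion fun p => {p.1.1, p.1.2}) (by
        intro e he
        simp only [mem_biUnion, mem_insert, mem_singleton] at he
        obtain ⟨p, -, rfl | rfl⟩ := he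
        exacts [h.fst_mem p p.2, h.snd_mem p p.2]) (by
        rw [coe_union, Set.pairwiseDisjoint_union]
        refine ⟨hd, ?_, ?_⟩
        · intro a ha b hb hab
          simp only [coe_image, Set.mem_image] at ha hb
          obtain ⟨i, -, rfl⟩ := ha
          obtain ⟨j, -, rfl⟩ := hb
          exact hpr i j (by rintro rfl; exact hab rfl)
        · intro a ha b hb _
          obtain ⟨i, hi, rfl⟩ := mem_image.1 (mem_coe.1 hb)
          exact (hprF i (mem_sdiff.1 hi).2).mono_left (subset_biUnion_of_mem id ha)) (by
        intro e he
        rcases mem_union.1 he with he | he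
        · exact hr e he
        · obtain ⟨i, -, rfl⟩ := mem_image.1 he
          exact Or.inr (hheavy i.1 i.2)) (by
        rw [union_biUnion]
        refine union_subset (hs.trans (union_subset ?_ ?_)) ?_
        · intro x hx
          simp only [mem_biUnion, mem_insert, mem_singleton] at hx
          obtain ⟨i, hi, rfl | rfl⟩ := hx <;> exact hS_sub i (hDS hi) _
        · intro x hx
          obtain ⟨i, hi, rfl⟩ := mem_image.1 hx
          exact hS_sub i (hJS hi) _
        · intro x hx
          simp only [mem_biUnion, mem_image, id] at hx
          obtain ⟨_, ⟨i, hi, rfl⟩, hx⟩ := hx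
          simp only [pr, mem_insert, mem_singleton] at hx
          rcases hx with rfl | rfl <;> exact hS_sub i (mem_sdiff.1 hi).1 _) (by omega)
    omega
  · intro i k
    rw [mem_biUnion]
    rcases mem_union.1 (hmem i.1 i.2 k) with h2 | h2
    · exact ⟨_, h.fst_mem _ i.1.2, h2⟩
    · exact ⟨_, h.snd_mem _ i.1.2, h2⟩

lemma IsMaximumMatching.exists_structure (hM : IsMaximumMatching H M V₀) (hc : 30 ≤ c) :
    ∃ (B : Finset V) (L u q : ℕ), (∀ e ∈ H, ¬ e ⊆ B) ∧ B ⊆ M.biUnion id ∧ q ≤ L ∧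
      B.card + q = 2 * L ∧ L + u = M.card ∧
      (∑ E ∈ M, ∑ F ∈ M, heavyCount H V₀ c E F) + u * M.card + u ^ 2 + q ^ 2 ≤
        5 * M.card ^ 2 + 22 * M.card := by
  obtain ⟨𝓑, h, hmax⟩ := exists_isBlockFamily_max H M V₀ c
  obtain ⟨f, hf, hsum, hmem⟩ := h.exists_isSwitchFree hM
  obtain ⟨B, q, hB, hBf, hqL, hBc, hcount⟩ := hf.exists_independent hc hM.card_eq
  have hL : Fintype.card (𝓑 × Fin 2) = 2 * 𝓑.card := by simp [mul_comm]
  rw [hL] at hqL hBc hcount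
  set U := uncovered M 𝓑 with hU
  have hsplit := h.sum_add_sum_uncovered
  have hMcard : M.card = 2 * 𝓑.card + U.card := by
    have := hsplit fun _ => 1
    simpa [mul_comm] using this
  refine ⟨B, 2 * 𝓑.card, U.card, q, hB, ?_, hqL, hBc, hMcard.symm, ?_⟩
  · intro x hx
    obtain ⟨i, k, rfl⟩ := hBf x hx
    exact hmem i k
  have hblock : ∀ φ : V → ℕ, ∑ i, ∑ k, φ (f i k) =
      ∑ p ∈ 𝓑, (∑ x ∈ p.1, φ x + ∑ x ∈ p.2, φ x) := by
    intro φ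
    rw [Fintype.sum_prod_type, ← sum_coe_sort 𝓑]
    exact sum_congr rfl fun p _ => hsum p φ
  have hZZ : ∑ i, ∑ j, ∑ k, ∑ l, heavyInd H V₀ c (f i k) (f j l) =
      ∑ p ∈ 𝓑, (∑ p' ∈ 𝓑, (heavyCount H V₀ c p.1 p'.1 + heavyCount H V₀ c p.1 p'.2) +
        ∑ p' ∈ 𝓑, (heavyCount H V₀ c p.2 p'.1 + heavyCount H V₀ c p.2 p'.2)) := by
    have h1 : ∀ i, ∑ j, ∑ k, ∑ l, heavyInd H V₀ c (f i k) (f j l) =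
        ∑ k, ∑ p' ∈ 𝓑, (∑ y ∈ p'.1, heavyInd H V₀ c (f i k) y +
          ∑ y ∈ p'.2, heavyInd H V₀ c (f i k) y) := by
      intro i
      rw [sum_comm]
      exact sum_congr rfl fun k _ => hblock _
    rw [sum_congr rfl fun i _ => h1 i, hblock fun x => ∑ p' ∈ 𝓑, (∑ y ∈ p'.1, heavyInd H V₀ c x y +
          ∑ y ∈ p'.2, heavyInd H V₀ c x y)]
    refine sum_congr rfl fun p _ => ?_
    rw [sum_comm, sum_comm (s := p.2)]
    simp only [heavyCount, sum_add_distrib]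
  have hcross : ∑ p ∈ 𝓑, ∑ A ∈ U, (heavyCount H V₀ c p.1 A + heavyCount H V₀ c p.2 A) ≤
      𝓑.card * (9 * U.card + 3) := by
    rw [← smul_eq_mul]
    exact sum_le_card_nsmul _ _ _ fun p hp => h.sum_heavyCount_le hM hc hmax hp
  have hUU := h.sum_sum_heavyCount_le hM hmax
  have htotal : ∑ E ∈ M, ∑ F ∈ M, heavyCount H V₀ c E F =
      ∑ i, ∑ j, ∑ k, ∑ l, heavyInd H V₀ c (f i k) (f j l) +
      2 * (∑ p ∈ 𝓑, ∑ A ∈ U, (heavyCount H V₀ c p.1 A + heavyCount H V₀ c p.2 A)) +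
      ∑ A ∈ U, ∑ B ∈ U, heavyCount H V₀ c A B := by
    rw [hZZ, hsplit]
    have h1 : ∀ E, ∑ F ∈ M, heavyCount H V₀ c E F =
        ∑ p ∈ 𝓑, (heavyCount H V₀ c E p.1 + heavyCount H V₀ c E p.2) +
          ∑ A ∈ U, heavyCount H V₀ c E A := fun E => hsplit _
    simp only [h1]
    have h2 : ∑ A ∈ U, ∑ p ∈ 𝓑, (heavyCount H V₀ c A p.1 + heavyCount H V₀ c A p.2) =
        ∑ p ∈ 𝓑, ∑ A ∈ U, (heavyCount H V₀ c p.1 A + heavyCount H V₀ c p.2 A) := by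
      rw [sum_comm]
      refine sum_congr rfl fun p _ => sum_congr rfl fun A _ => ?_
      rw [heavyCount_comm A, heavyCount_comm A]
    rw [sum_add_distrib (s := U), h2]
    simp only [sum_add_distrib]
    ring
  rw [htotal, hMcard]
  nlinarith

end BlockStructure

section Counting
variable {V : Type*} [DecidableEq V] {H M : Finset (Finset V)} {V₀ : Finset V} {c : ℕ}

lemma IsMaximumMatching.not_subset_left (hM : IsMaximumMatching H M V₀) {e : Finset V}
    (he : e ∈ H) : ¬ e ⊆ V₀ := by
  intro h
  have := hM.card_le_of_subset (M' := {e}) (N := ∅) (by simp) (by simpa using he) (by simp)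
    (by simpa using h)
  simp at this

lemma card_link_triple (v : V) (Y : Finset V) {E : Finset V} :
    (link H v Y E).card = ∑ x ∈ E, #{w ∈ Y | ({v, w, x} : Finset V) ∈ H} := by
  simp only [link, card_filter, sum_product_right]

lemma IsMaximumMatching.sum_card_link_le_sq (hM : IsMaximumMatching H M V₀) (hV₀ : 12 ≤ V₀.card)
    {E : Finset V} (hE : E ∈ M) : ∑ v ∈ V₀, (link H v V₀ E).card ≤ V₀.card ^ 2 := by
  set P : V → Finset (V × V) := fun x => {p ∈ V₀ ×ˢ V₀ | ({p.1, p.2, x} : Finset V) ∈ H} with hP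
  have h1 : ∑ v ∈ V₀, (link H v V₀ E).card = ∑ x ∈ E, (P x).card := by
    simp only [card_link_triple, hP, card_filter, sum_product]
    rw [sum_comm]
  have hsq : ∀ x, (P x).card ≤ V₀.card ^ 2 := by
    intro x
    refine (card_filter_le _ _).trans ?_
    rw [card_product, sq]
  have hE3 := hM.card_eq E (hM.subset hE)
  have hEV : Disjoint V₀ E := hM.disjoint_left.mono_right (subset_biUnion_of_mem id hE)
  have hcover : ∀ x ∈ E, ∀ y ∈ E, x ≠ y → ∀ p ∈ P y, (P x).card ≤ 4 * V₀.card := by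
    intro x hx y hy hxy p hp
    have hsub : P x ⊆ ({p.1, p.2} : Finset V) ×ˢ V₀ ∪ V₀ ×ˢ ({p.1, p.2} : Finset V) := by
      intro r hr
      by_contra hcon
      simp only [hP, mem_filter, mem_product] at hp hr
      simp only [mem_union, mem_product, mem_insert, mem_singleton, not_or, not_and] at hcon
      have c1 : ¬ (r.1 = p.1 ∨ r.1 = p.2) := fun h => hcon.1 h hr.1.2
      have c2 : ¬ (r.2 = p.1 ∨ r.2 = p.2) := fun h => by
        have := hcon.2 hr.1.1
        tauto
      rw [Finset.disjoint_left] at hEV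
      have hne : ∀ z ∈ V₀, z ≠ x ∧ z ≠ y := fun z hz =>
        ⟨fun h => hEV hz (h ▸ hx), fun h => hEV hz (h ▸ hy)⟩
      have n1 := hne _ hr.1.1
      have n2 := hne _ hr.1.2
      have n3 := hne _ hp.1.1
      have n4 := hne _ hp.1.2
      have hdis : Disjoint ({r.1, r.2, x} : Finset V) {p.1, p.2, y} := by
        rw [Finset.disjoint_left]
        simp only [mem_insert, mem_singleton]
        grind
      have hne' : ({r.1, r.2, x} : Finset V) ≠ {p.1, p.2, y} := by
        intro h
        rw [h, disjoint_self_iff_empty] at hdis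
        simp at hdis
      have := hM.card_le_of_subset (M' := {{r.1, r.2, x}, {p.1, p.2, y}}) (N := {E})
        (by simpa using hE) (by simp [insert_subset_iff, hp.2, hr.2]) (pairwiseDisjoint_pair hdis)
        (by
          intro z hz
          simp only [mem_biUnion, mem_insert, mem_singleton, id, exists_eq_or_imp,
            exists_eq_left] at hz
          simp only [singleton_biUnion, id, mem_union]
          rcases hz with (rfl | rfl | rfl) | (rfl | rfl | rfl)
          exacts [Or.inl hr.1.1, Or.inl hr.1.2, Or.inr hx, Or.inl hp.1.1, Or.inl hp.1.2, Or.inr hy])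
      rw [card_pair hne', card_singleton] at this
      omega
    refine (card_le_card hsub).trans ((card_union_le _ _).trans ?_)
    rw [card_product, card_product]
    have := card_le_two (a := p.1) (b := p.2)
    nlinarith
  rw [h1]
  by_cases hex : ∃ x ∈ E, ∃ y ∈ E, x ≠ y ∧ (P x).Nonempty ∧ (P y).Nonempty
  · obtain ⟨x, hx, y, hy, hxy, ⟨p, hp⟩, ⟨r, hr⟩⟩ := hex
    calc _ ≤ ∑ z ∈ E, 4 * V₀.card := by
          refine sum_le_sum fun z hz => ?_
          by_cases hzx : z = x
          · subst hzx; exact hcover z hz y hy hxy r hr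
          · exact hcover z hz x hx hzx p hp
      _ = 12 * V₀.card := by rw [sum_const, hE3, smul_eq_mul]; ring
      _ ≤ _ := by rw [sq]; exact Nat.mul_le_mul_right _ hV₀
  · push Not at hex
    by_cases hex' : ∃ x ∈ E, (P x).Nonempty
    · obtain ⟨x, hx, hne⟩ := hex'
      rw [sum_eq_single_of_mem x hx]
      · exact hsq x
      · intro y hy hyx
        rw [hex x hx y hy hyx.symm hne, card_empty]
    · push Not at hex'
      rw [sum_eq_zero]
      · exact Nat.zero_le _
      · intro x hx
        rw [hex' x hx, card_empty]

lemma sum_card_link_le_heavyCount (hM : IsMaximumMatching H M V₀) :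
    ∑ v ∈ V₀, (link H v (M.biUnion id) (M.biUnion id)).card ≤
      V₀.card * (∑ E ∈ M, ∑ F ∈ M, heavyCount H V₀ c E F) + 9 * c * M.card ^ 2 := by
  set Y := M.biUnion id with hY
  have hYc : Y.card = 3 * M.card :=
    card_biUnion_of_card_eq_three (fun e he => hM.card_eq e (hM.subset he)) hM.disjoint
  have h1 : ∑ v ∈ V₀, (link H v Y Y).card =
      ∑ x ∈ Y, ∑ y ∈ Y, (completions H V₀ {x, y}).card := by
    simp only [link, completions, card_filter, sum_product]
    rw [sum_comm]
    exact sum_congr rfl fun x _ => sum_comm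
  have h2 : ∑ E ∈ M, ∑ F ∈ M, heavyCount H V₀ c E F =
      ∑ x ∈ Y, ∑ y ∈ Y, heavyInd H V₀ c x y := by
    rw [hY, sum_biUnion hM.disjoint]
    refine sum_congr rfl fun E _ => ?_
    simp only [heavyCount]
    rw [sum_comm]
    refine sum_congr rfl fun x _ => ?_
    rw [sum_biUnion hM.disjoint]
    rfl
  rw [h1, h2]
  calc _ ≤ ∑ x ∈ Y, ∑ y ∈ Y, (V₀.card * heavyInd H V₀ c x y + c) := by
        refine sum_le_sum fun x _ => sum_le_sum fun y _ => ?_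
        unfold heavyInd
        split_ifs with h
        · have : (completions H V₀ {x, y}).card ≤ V₀.card := card_filter_le _ _
          omega
        · simp only [IsHeavy] at h
          omega
    _ = _ := by
        simp only [sum_add_distrib, ← mul_sum, sum_const, hYc, smul_eq_mul]
        ring

lemma IsMaximumMatching.sum_card_link_le (hM : IsMaximumMatching H M V₀) (hV₀ : 12 ≤ V₀.card) :
    ∑ v ∈ V₀, (link H v (V₀ ∪ M.biUnion id) (V₀ ∪ M.biUnion id)).card ≤
      2 * M.card * V₀.card ^ 2 +
      V₀.card * (∑ E ∈ M, ∑ F ∈ M, heavyCount H V₀ c E F) + 9 * c * M.card ^ 2 := by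
  set Y := M.biUnion id with hY
  have hsplit : ∀ v ∈ V₀, (link H v (V₀ ∪ Y) (V₀ ∪ Y)).card ≤
      2 * (∑ E ∈ M, (link H v V₀ E).card) + (link H v Y Y).card := by
    intro v hv
    have h0 : (link H v V₀ V₀).card = 0 := by
      rw [card_eq_zero, eq_empty_iff_forall_notMem]
      intro p hp
      rw [mem_link] at hp
      refine hM.not_subset_left hp.2 ?_
      simp [insert_subset_iff, hv, hp.1]
    have h1 := card_link_union_left H v V₀ Y (V₀ ∪ Y)
    have h2 := card_link_union_right H v V₀ V₀ Y
    have h3 := card_link_union_right H v Y V₀ Y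
    have h4 := card_link_swap H v Y V₀
    have h5 : (link H v V₀ Y).card = ∑ E ∈ M, (link H v V₀ E).card := by
      simp only [card_link_triple]
      rw [hY, sum_biUnion hM.disjoint]
      rfl
    omega
  refine (sum_le_sum hsplit).trans ?_
  rw [sum_add_distrib, ← mul_sum, sum_comm]
  have h1 := sum_card_link_le_heavyCount (c := c) hM
  have h2 : ∑ E ∈ M, ∑ v ∈ V₀, (link H v V₀ E).card ≤ M.card * V₀.card ^ 2 := by
    rw [← smul_eq_mul]
    exact sum_le_card_nsmul _ _ _ fun E hE => hM.sum_card_link_le_sq hV₀ hE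
  rw [← hY] at h1
  linarith

lemma le_of_counting_inequality {R s m n u q G d : ℕ} (hn : n = s + 3 * m) (hs : 810 * R ^ 2 ≤ s)
    (hs0 : 0 < s) (hn' : 198 * R ^ 2 ≤ n) (hd : 15 * R ^ 2 * n ^ 2 ≤ 27 * R ^ 2 * d + n ^ 2)
    (h : s * d ≤ 2 * m * s ^ 2 + s * G + 9 * 30 * m ^ 2)
    (hG : G + u * m + u ^ 2 + q ^ 2 ≤ 5 * m ^ 2 + 22 * m) :
    R * s ≤ n ∧ R * u ≤ n ∧ R * q ≤ n := by
  have key : 15 * R ^ 2 * s ^ 2 + 27 * R ^ 2 * (u ^ 2 + q ^ 2) ≤ 3 * n ^ 2 := by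
    have h1 : 27 * R ^ 2 * (s * d) ≤
        27 * R ^ 2 * (2 * m * s ^ 2 + s * G) + s * n ^ 2 := by
      have e1 : 27 * R ^ 2 * (9 * 30 * m ^ 2) ≤ s * n ^ 2 := by
        have : (3 * m) ^ 2 ≤ n ^ 2 := Nat.pow_le_pow_left (by omega) 2
        calc 27 * R ^ 2 * (9 * 30 * m ^ 2) = 810 * R ^ 2 * (3 * m) ^ 2 := by ring
          _ ≤ s * n ^ 2 := Nat.mul_le_mul hs this
      have e2 := Nat.mul_le_mul_left (27 * R ^ 2) h
      calc _ ≤ _ := e2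
        _ = 27 * R ^ 2 * (2 * m * s ^ 2 + s * G) + 27 * R ^ 2 * (9 * 30 * m ^ 2) := by ring
        _ ≤ _ := by omega
    have h2 : 27 * R ^ 2 * d ≤ 27 * R ^ 2 * (2 * m * s + G) + n ^ 2 := by
      refine Nat.le_of_mul_le_mul_left ?_ hs0
      calc s * (27 * R ^ 2 * d) = 27 * R ^ 2 * (s * d) := by ring
        _ ≤ _ := h1
        _ = _ := by ring
    have h3 : 27 * R ^ 2 * (22 * m) ≤ n ^ 2 := by
      calc 27 * R ^ 2 * (22 * m) = 198 * R ^ 2 * (3 * m) := by ring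
        _ ≤ n * n := Nat.mul_le_mul hn' (by omega)
        _ = _ := by ring
    have h4 := Nat.mul_le_mul_left (27 * R ^ 2) hG
    have h5 : 15 * R ^ 2 * n ^ 2 = 15 * R ^ 2 * s ^ 2 + 90 * R ^ 2 * (s * m) +
        27 * R ^ 2 * (5 * m ^ 2) := by rw [hn]; ring
    have h6 : 0 ≤ R ^ 2 * (s * m) := Nat.zero_le _
    have h7 : 0 ≤ R ^ 2 * (u * m) := Nat.zero_le _
    nlinarith
  refine ⟨?_, ?_, ?_⟩ <;> refine (Nat.pow_le_pow_iff_left two_ne_zero).1 ?_ <;> rw [mul_pow]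
  · have : 0 ≤ R ^ 2 * (u ^ 2 + q ^ 2) := Nat.zero_le _
    nlinarith
  · have : 0 ≤ R ^ 2 * s ^ 2 := Nat.zero_le _
    have : 0 ≤ R ^ 2 * q ^ 2 := Nat.zero_le _
    nlinarith
  · have : 0 ≤ R ^ 2 * s ^ 2 := Nat.zero_le _
    have : 0 ≤ R ^ 2 * u ^ 2 := Nat.zero_le _
    nlinarith

theorem exists_almost_perfect_matching_or_independent {R : ℕ} (hR : 0 < R) {X : Finset V}
    (hH : ∀ e ∈ H, e.card = 3) (hHX : ∀ e ∈ H, e ⊆ X) (hX : 198 * R ^ 2 ≤ X.card)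
    (hdeg : ∀ v ∈ X, 15 * R ^ 2 * X.card ^ 2 ≤ 27 * R ^ 2 * (link H v X X).card + X.card ^ 2) :
    (∃ S ⊆ X, PerfectlyMatched H S ∧ (X \ S).card ≤ 810 * R ^ 2) ∨
      ∃ I ⊆ X, (∀ e ∈ H, ¬ e ⊆ I) ∧ 2 * R * X.card ≤ 3 * R * I.card + 11 * X.card := by
  classical
  obtain ⟨M, hM, hmax⟩ := exists_max_image
    (H.powerset.filter fun M : Finset (Finset V) => (M : Set (Finset V)).PairwiseDisjoint id) Finset.card
    ⟨∅, by simp⟩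
  rw [mem_filter, mem_powerset] at hM
  have hMX : M.biUnion id ⊆ X := biUnion_subset.2 fun e he => hHX e (hM.1 he)
  set V₀ := X \ M.biUnion id with hV₀
  have hmax' : IsMaximumMatching H M V₀ := by
    refine ⟨hH, hM.1, hM.2, sdiff_disjoint, fun M' hM' hd _ => hmax M' ?_⟩
    rw [mem_filter, mem_powerset]
    exact ⟨hM', hd⟩
  by_cases hs : V₀.card ≤ 810 * R ^ 2
  · exact Or.inl ⟨M.biUnion id, hMX, ⟨M, hM.1, hM.2, rfl⟩, hs⟩
  right
  push Not at hs
  have hR2 : 0 < R ^ 2 := by positivity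
  have hXu : V₀ ∪ M.biUnion id = X := sdiff_union_of_subset hMX
  have hcard : X.card = V₀.card + 3 * M.card := by
    rw [← card_biUnion_of_card_eq_three (fun e he => hH e (hM.1 he)) hM.2,
      ← card_union_of_disjoint sdiff_disjoint, hXu]
  obtain ⟨B, L, u, q, hB, hBM, hqL, hBc, hLu, hG⟩ := hmax'.exists_structure (c := 30) le_rfl
  have hsum := hmax'.sum_card_link_le (c := 30) (by omega)
  rw [hXu] at hsum
  obtain ⟨v₀, hv₀, hmin⟩ := exists_min_image V₀ (fun v => (link H v X X).card)
    (card_pos.1 (by omega))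
  have hlow : V₀.card * (link H v₀ X X).card ≤ ∑ v ∈ V₀, (link H v X X).card := by
    rw [← smul_eq_mul]
    exact card_nsmul_le_sum _ _ _ hmin
  obtain ⟨h1, h2, h3⟩ := le_of_counting_inequality hcard hs.le (by omega) hX
    (hdeg v₀ (sdiff_subset hv₀)) (hlow.trans hsum) hG
  refine ⟨B, hBM.trans hMX, hB, ?_⟩
  zify at *
  have e1 : (3 : ℤ) * B.card = 2 * X.card - 2 * V₀.card - 6 * u - 3 * q := by linarith
  have e2 : (3 : ℤ) * R * B.card = 2 * (R * X.card) - 2 * (R * V₀.card) - 6 * (R * u) -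
      3 * (R * q) := by
    calc (3 : ℤ) * R * B.card = R * (3 * B.card) := by ring
      _ = _ := by rw [e1]; ring
  linarith

end Counting

section Main
variable {V : Type*} [DecidableEq V]

lemma two_mul_choose_two (m : ℕ) : 2 * (m + 1).choose 2 = (m + 1) * m := by
  induction m with
  | zero => simp
  | succ m ih =>
    rw [Nat.choose_succ_succ' (m + 1) 1, Nat.choose_one_right, mul_add, ih]
    ring

lemma le_card_link_of_choose_lt [Fintype V] {H : Finset (Finset V)} (hH : ∀ e ∈ H, e.card = 3)
    {k : ℕ} (hk : 0 < k) (hV : Fintype.card V = 3 * k) {v : V}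
    (h : Nat.choose (Fintype.card V - 1) 2 - Nat.choose (2 * Fintype.card V / 3) 2 <
      (H.filter fun e => v ∈ e).card) :
    5 * k ^ 2 + 4 ≤ (link H v univ univ).card + 7 * k := by
  obtain ⟨m, rfl⟩ := Nat.exists_eq_add_of_le' hk
  rw [card_link_univ hH]
  rw [hV, show 2 * (3 * (m + 1)) / 3 = 2 * m + 1 + 1 by omega,
    show 3 * (m + 1) - 1 = 3 * m + 1 + 1 by omega] at h
  have h1 := two_mul_choose_two (3 * m + 1)
  have h2 := two_mul_choose_two (2 * m + 1)
  have h3 : Nat.choose (3 * m + 1 + 1) 2 + 1 ≤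
      (H.filter fun e => v ∈ e).card + Nat.choose (2 * m + 1 + 1) 2 := by omega
  nlinarith

lemma exists_perfect_matching_of_link {R : ℕ} (hR : 44 * 10 ^ 7 ≤ R) :
    ∃ n₀ : ℕ, ∀ (V : Type) [Fintype V] [DecidableEq V] (H : Finset (Finset V)) (k : ℕ),
      (∀ e ∈ H, e.card = 3) → n₀ ≤ k → Fintype.card V = 3 * k →
      (∀ v, 5 * k ^ 2 + 4 ≤ (link H v univ univ).card + 7 * k) → PerfectlyMatched H univ := by
  have hR0 : 0 < R := by omega
  obtain ⟨n₁, habs⟩ := exists_absorbing_set (349920 * R ^ 4) (by positivity)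
  refine ⟨n₁ + 1000 * R ^ 2 + 10 ^ 8, fun V _ _ H k hH hk hV hdeg => ?_⟩
  have hR2 : R ≤ R ^ 2 := Nat.le_self_pow two_ne_zero R
  obtain ⟨n, hn⟩ : ∃ n, n = Fintype.card V := ⟨_, rfl⟩
  have hnk : n = 3 * k := hn.trans hV
  obtain ⟨w₀, hw₀⟩ : ∃ w₀, w₀ = 270 * R ^ 2 * (6 * (n / (349920 * R ^ 4))) := ⟨_, rfl⟩
  have hw₀n : 216 * R ^ 2 * w₀ ≤ n := by
    calc 216 * R ^ 2 * w₀ = n / (349920 * R ^ 4) * (349920 * R ^ 4) := by rw [hw₀]; ring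
      _ ≤ n := Nat.div_mul_le_self _ _
  have hRw : R * w₀ ≤ R ^ 2 * w₀ := Nat.mul_le_mul_right _ hR2
  have hRw' : 44 * 10 ^ 7 * w₀ ≤ R * w₀ := Nat.mul_le_mul_right _ hR
  have hw₀n' : 216 * (R ^ 2 * w₀) ≤ n := by linarith
  obtain ⟨W, hWc, hW, hWabs⟩ := habs V H hH (by omega) (fun v => by
      rw [hV]
      have := hdeg v
      have : 140 * k ≤ k * k := Nat.mul_le_mul_right _ (by omega)
      nlinarith) (270 * R ^ 2) (by
      rw [← hn, ← hw₀]
      omega)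
  rw [← hn, ← hw₀] at hWc
  set X := univ \ W with hX
  have hXc : X.card + W.card = n := by
    rw [hX, hn, card_sdiff_add_card_eq_card (subset_univ W), card_univ]
  have hXle : X.card ≤ n := by omega
  have hlinkX : ∀ v ∈ X, link (H.filter (· ⊆ X)) v X X = link H v X X := by
    intro v hv
    ext p
    simp only [mem_link, mem_filter, insert_subset_iff, singleton_subset_iff]
    tauto
  have hA := exists_almost_perfect_matching_or_independent (H := H.filter (· ⊆ X)) hR0
    (X := X) (fun e he => hH e (mem_filter.1 he).1) (fun e he => (mem_filter.1 he).2)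
    (by omega) (by
      intro v hv
      rw [hlinkX v hv]
      have h1 := card_link_sdiff H v univ univ W
      rw [← hX, card_univ, ← hn] at h1
      have h2 := hdeg v
      obtain ⟨d, hd⟩ : ∃ d, d = (link H v X X).card := ⟨_, rfl⟩
      rw [← hd] at h1 ⊢
      have h3 : 15 * n ^ 2 ≤ 27 * d + 54 * (w₀ * n) + 63 * n := by
        have : W.card * n ≤ w₀ * n := Nat.mul_le_mul_right _ hWc
        rw [hnk] at *
        nlinarith
      have h4 : n ^ 2 ≤ 2 * X.card ^ 2 := by
        have : 3 * n ≤ 4 * X.card := by omega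
        nlinarith
      have h5 : 54 * R ^ 2 * (w₀ * n) * 4 ≤ n ^ 2 := by
        calc 54 * R ^ 2 * (w₀ * n) * 4 = 216 * R ^ 2 * w₀ * n := by ring
          _ ≤ n * n := Nat.mul_le_mul_right _ hw₀n
          _ = _ := by ring
      have h6 : 63 * R ^ 2 * n * 4 ≤ n ^ 2 := by
        calc 63 * R ^ 2 * n * 4 = 252 * R ^ 2 * n := by ring
          _ ≤ n * n := Nat.mul_le_mul_right _ (by omega)
          _ = _ := by ring
      have h7 : 15 * R ^ 2 * X.card ^ 2 ≤ R ^ 2 * (15 * n ^ 2) := by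
        calc _ = R ^ 2 * (15 * X.card ^ 2) := by ring
          _ ≤ _ := Nat.mul_le_mul_left _ (Nat.mul_le_mul_left _ (Nat.pow_le_pow_left hXle 2))
      have h8 := Nat.mul_le_mul_left (R ^ 2) h3
      nlinarith)
  rcases hA with ⟨S, hSX, hS, hSc⟩ | ⟨I, hIX, hI, hIc⟩
  · set L := X \ S with hL
    have hS' : PerfectlyMatched H S := hS.mono (filter_subset _ _)
    have hLW : Disjoint L W := sdiff_disjoint.mono_left sdiff_subset
    have hSd : Disjoint (W ∪ L) S := by
      rw [disjoint_union_left]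
      exact ⟨disjoint_sdiff.mono_right hSX, sdiff_disjoint⟩
    have h3 : 3 ∣ L.card := by
      have h1 := hS'.three_dvd_card hH
      have h2 := hW.three_dvd_card hH
      have h4 : L.card + S.card = X.card := card_sdiff_add_card_eq_card hSX
      omega
    obtain ⟨j, hj⟩ := h3
    have h5 := (hWabs j (by omega) L hj hLW).union hSd hS'
    have h6 : W ∪ L ∪ S = univ := by
      rw [union_assoc, hL, sdiff_union_of_subset hSX, hX,
        union_sdiff_of_subset (subset_univ W)]
    rwa [h6] at h5
  · refine perfectlyMatched_of_independent hH hV hdeg (by omega) (I := I) ?_ ?_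
    · intro e he heI
      exact hI e (mem_filter.2 ⟨he, heI.trans hIX⟩) heI
    · have h1 : 44 * 10 ^ 7 * (2 * X.card - 3 * I.card) ≤ 11 * X.card := by
        calc _ ≤ R * (2 * X.card - 3 * I.card) := Nat.mul_le_mul_right _ hR
          _ = 2 * R * X.card - 3 * R * I.card := by rw [Nat.mul_sub]; ring_nf
          _ ≤ _ := by omega
      omega

end Main

/-- There exists `n₀` such that every 3-uniform hypergraph `H` whose
order `n ≥ n₀` is divisible by 3 and whose minimum vertex degree exceeds
`C(n-1,2) - C(2n/3,2)` has a perfect matching. -/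
theorem stmt_0 :
    ∃ n₀ : ℕ, ∀ (V : Type) [Fintype V] [DecidableEq V] (H : Finset (Finset V)),
      (∀ e ∈ H, e.card = 3) →
      n₀ ≤ Fintype.card V →
      3 ∣ Fintype.card V →
      (∀ v : V, Nat.choose (Fintype.card V - 1) 2 - Nat.choose (2 * Fintype.card V / 3) 2
        < (H.filter fun e => v ∈ e).card) →
      ∃ M ⊆ H, (M : Set (Finset V)).PairwiseDisjoint id ∧ M.biUnion id = Finset.univ := by
  obtain ⟨n₀, h⟩ := exists_perfect_matching_of_link le_rfl
  refine ⟨3 * n₀ + 1, fun V _ _ H hH hn h3 hdeg => ?_⟩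
  obtain ⟨k, hk⟩ := h3
  exact h V H k hH (by omega) hk fun v => le_card_link_of_choose_lt hH (by omega) hk (hdeg v)
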